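/- Assume the Riemann Hypothesis and that all zeros of the Riemann zeta-function are simple. Then for every fixed ε > 0 there exists T₀ such that for all T ≥ T₀, the sum of 1/|ζ'(ρ)|² over the non-trivial zeros ρ = 1/2 + iγ of ζ(s) with 0 < γ ≤ T is at least (3/(2π³) − ε)·T. -/

import Mathlib

open Complex

namespace Gonek

open Set Filter Topology MeasureTheory intervalIntegral

/-- The integral of `f` over the boundary of the rectangle `[a, b] × [u, v]`. -/
noncomputable def rectInt (f : ℂ → ℂ) (a b u v : ℝ) : ℂ :=
  (∫ x : ℝ in a..b, f (x + u * I)) - (∫ x : ℝ in a..b, f (x + v * I)) +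
    I * (∫ y : ℝ in u..v, f (b + y * I)) - I * (∫ y : ℝ in u..v, f (a + y * I))

lemma rectInt_eq_zero {f : ℂ → ℂ} {a b u v : ℝ} (hab : a ≤ b) (huv : u ≤ v)
    (hf : DifferentiableOn ℂ f (Icc a b ×ℂ Icc u v)) : rectInt f a b u v = 0 := by
  have := integral_boundary_rect_eq_zero_of_differentiableOn f (⟨a, u⟩ : ℂ) ⟨b, v⟩
    (by simpa [uIcc_of_le hab, uIcc_of_le huv] using hf)
  simpa [rectInt] using this

lemma log_sub_log_neg_I_mul {w : ℂ} (hre : 0 < w.re) (him : 0 < w.im) :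
    log w - log (-I * w) = Real.pi / 2 * I := by
  have hw : w ≠ 0 := fun h => by simp [h] at hre
  have harg : |arg w| < Real.pi / 2 := abs_arg_lt_pi_div_two_iff.2 (Or.inl hre)
  have h0 : 0 ≤ arg w := arg_nonneg_iff.2 him.le
  rw [abs_lt] at harg
  have hpi := Real.pi_pos
  rw [Complex.log_mul (by simp) hw]
  · rw [show (-I : ℂ) = -I from rfl, log_neg_I]; ring
  · rw [arg_neg_I]; constructor <;> linarith

lemma integral_horizontal_inv {ρ k : ℂ} {a b u : ℝ} (hk : k ≠ 0)
    (h : ∀ x : ℝ, 0 < (k * (x + u * I - ρ)).re) :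
    ∫ x : ℝ in a..b, ((x + u * I - ρ)⁻¹ : ℂ) =
      log (k * (b + u * I - ρ)) - log (k * (a + u * I - ρ)) := by
  have hne : ∀ x : ℝ, (x + u * I - ρ : ℂ) ≠ 0 := fun x h0 => by
    have := h x; simp [h0] at this
  apply integral_eq_sub_of_hasDerivAt (f := fun x : ℝ => log (k * (x + u * I - ρ)))
  · intro x _
    have h1 : HasDerivAt (fun x : ℝ => k * ((x : ℂ) + u * I - ρ)) (k * 1) x :=
      (((hasDerivAt_id x).ofReal_comp.add_const _).sub_const _).const_mul k
    refine (h1.clog_real (Or.inl (h x))).congr_deriv ?_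
    rw [mul_div_mul_left _ _ hk, one_div]
  · apply Continuous.intervalIntegrable
    exact Continuous.inv₀ (by fun_prop) hne

lemma integral_vertical_inv {ρ k : ℂ} {b u v : ℝ} (hk : k ≠ 0)
    (h : ∀ y : ℝ, 0 < (k * (b + y * I - ρ)).re) :
    I * ∫ y : ℝ in u..v, ((b + y * I - ρ)⁻¹ : ℂ) =
      log (k * (b + v * I - ρ)) - log (k * (b + u * I - ρ)) := by
  have hne : ∀ x : ℝ, (b + x * I - ρ : ℂ) ≠ 0 := fun x h0 => by
    have := h x; simp [h0] at this
  rw [← intervalIntegral.integral_const_mul]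
  apply integral_eq_sub_of_hasDerivAt (f := fun y : ℝ => log (k * (b + y * I - ρ)))
  · intro x _
    have h1 : HasDerivAt (fun x : ℝ => k * ((b : ℂ) + x * I - ρ)) (k * (1 * I)) x :=
      (((((hasDerivAt_id x).ofReal_comp.mul_const I).const_add (b : ℂ)).sub_const _).const_mul k)
    refine (h1.clog_real (Or.inl (h x))).congr_deriv ?_
    rw [mul_div_mul_left _ _ hk, one_mul, div_eq_mul_inv]
  · apply Continuous.intervalIntegrable
    exact continuous_const.mul (Continuous.inv₀ (by fun_prop) hne)

lemma rectInt_inv_sub {ρ : ℂ} {a b u v : ℝ} (h1 : a < ρ.re) (h2 : ρ.re < b) (h3 : u < ρ.im)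
    (h4 : ρ.im < v) : rectInt (fun s => (s - ρ)⁻¹) a b u v = 2 * Real.pi * I := by
  unfold rectInt
  rw [integral_horizontal_inv (k := I) (by simp) (by intro x; simp; linarith),
    integral_horizontal_inv (k := -I) (by simp) (by intro x; simp; linarith),
    integral_vertical_inv (k := 1) (by simp) (by intro x; simp; linarith),
    integral_vertical_inv (k := -1) (by simp) (by intro x; simp; linarith)]
  have e1 := log_sub_log_neg_I_mul (w := I * (b + u * I - ρ)) (by simp; linarith)
    (by simp; linarith)
  have e2 := log_sub_log_neg_I_mul (w := b + v * I - ρ) (by simp; linarith) (by simp; linarith)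
  have e3 := log_sub_log_neg_I_mul (w := -I * (a + v * I - ρ)) (by simp; linarith)
    (by simp; linarith)
  have e4 := log_sub_log_neg_I_mul (w := -1 * (a + u * I - ρ)) (by simp; linarith)
    (by simp; linarith)
  rw [show -I * (I * (b + u * I - ρ)) = 1 * (b + u * I - ρ) by
    rw [← mul_assoc]; simp] at e1
  rw [show -I * (-I * (a + v * I - ρ)) = -1 * (a + v * I - ρ) by
    rw [← mul_assoc]; simp] at e3
  rw [show -I * (-1 * (a + u * I - ρ)) = I * (a + u * I - ρ) by ring] at e4
  rw [one_mul (b + v * I - ρ : ℂ)]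
  linear_combination e1 + e2 + e3 + e4

lemma rectInt_add {f g : ℂ → ℂ} {a b u v : ℝ} (hab : a ≤ b) (huv : u ≤ v)
    (hf : ContinuousOn f ((Icc a b ×ℂ Icc u v) \ (Ioo a b ×ℂ Ioo u v)))
    (hg : ContinuousOn g ((Icc a b ×ℂ Icc u v) \ (Ioo a b ×ℂ Ioo u v))) :
    rectInt (fun s => f s + g s) a b u v = rectInt f a b u v + rectInt g a b u v := by
  have hor : ∀ {h : ℂ → ℂ}, ContinuousOn h ((Icc a b ×ℂ Icc u v) \ (Ioo a b ×ℂ Ioo u v)) →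
      ∀ w : ℝ, w = u ∨ w = v → IntervalIntegrable (fun x : ℝ => h (x + w * I)) volume a b := by
    intro h hh w hw
    apply ContinuousOn.intervalIntegrable
    rw [uIcc_of_le hab]
    refine hh.comp (by fun_prop) ?_
    intro x hx
    rcases hw with rfl | rfl <;> simp [mem_reProdIm, hx.1, hx.2, huv]
  have ver : ∀ {h : ℂ → ℂ}, ContinuousOn h ((Icc a b ×ℂ Icc u v) \ (Ioo a b ×ℂ Ioo u v)) →
      ∀ w : ℝ, w = a ∨ w = b → IntervalIntegrable (fun y : ℝ => h (w + y * I)) volume u v := by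
    intro h hh w hw
    apply ContinuousOn.intervalIntegrable
    rw [uIcc_of_le huv]
    refine hh.comp (by fun_prop) ?_
    intro x hx
    rcases hw with rfl | rfl <;> simp [mem_reProdIm, hx.1, hx.2, hab]
  unfold rectInt
  rw [integral_add (hor hf u (.inl rfl)) (hor hg u (.inl rfl)),
    integral_add (hor hf v (.inr rfl)) (hor hg v (.inr rfl)),
    integral_add (ver hf a (.inl rfl)) (ver hg a (.inl rfl)),
    integral_add (ver hf b (.inr rfl)) (ver hg b (.inr rfl))]
  ring

lemma rectInt_const_mul (c : ℂ) (f : ℂ → ℂ) (a b u v : ℝ) :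
    rectInt (fun s => c * f s) a b u v = c * rectInt f a b u v := by
  simp only [rectInt, intervalIntegral.integral_const_mul]
  ring

lemma rectInt_congr {f g : ℂ → ℂ} {a b u v : ℝ} (hab : a ≤ b) (huv : u ≤ v)
    (h : ∀ s ∈ (Icc a b ×ℂ Icc u v) \ (Ioo a b ×ℂ Ioo u v), f s = g s) :
    rectInt f a b u v = rectInt g a b u v := by
  unfold rectInt
  have hor : ∀ w : ℝ, w = u ∨ w = v → ∫ x : ℝ in a..b, f (x + w * I) =
      ∫ x : ℝ in a..b, g (x + w * I) := by
    intro w hw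
    apply integral_congr
    intro x hx
    rw [uIcc_of_le hab] at hx
    apply h
    rcases hw with rfl | rfl <;> simp [mem_reProdIm, hx.1, hx.2, huv]
  have ver : ∀ w : ℝ, w = a ∨ w = b → ∫ y : ℝ in u..v, f (w + y * I) =
      ∫ y : ℝ in u..v, g (w + y * I) := by
    intro w hw
    apply integral_congr
    intro x hx
    rw [uIcc_of_le huv] at hx
    apply h
    rcases hw with rfl | rfl <;> simp [mem_reProdIm, hx.1, hx.2, hab]
  rw [hor u (.inl rfl), hor v (.inr rfl), ver a (.inl rfl), ver b (.inr rfl)]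

/-- Dividing out finitely many zeros of a holomorphic function. -/
lemma exists_eq_mul_prod {U : Set ℂ} (hU : IsOpen U) {f : ℂ → ℂ} (hf : DifferentiableOn ℂ f U)
    (Z : Finset ℂ) (hZ : ∀ ρ ∈ Z, ρ ∈ U ∧ f ρ = 0) :
    ∃ g : ℂ → ℂ, DifferentiableOn ℂ g U ∧ ∀ s, f s = g s * ∏ ρ ∈ Z, (s - ρ) := by
  induction Z using Finset.induction_on generalizing f with
  | empty => exact ⟨f, hf, by simp⟩
  | insert ρ Z hρ ih =>
    have hρU := hZ ρ (by simp)
    have key : ∀ s, f s = (s - ρ) * dslope f ρ s := fun s => by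
      have := sub_smul_dslope f ρ s
      rw [hρU.2, sub_zero] at this
      exact this.symm
    obtain ⟨g, hg, hfg⟩ := ih
      ((differentiableOn_dslope (hU.mem_nhds hρU.1)).2 hf) (fun z hz => ⟨(hZ z (by simp [hz])).1, by
        have h1 := key z
        rw [(hZ z (by simp [hz])).2] at h1
        have : z - ρ ≠ 0 := sub_ne_zero.2 (fun h => hρ (h ▸ hz))
        simpa [this] using h1.symm⟩)
    refine ⟨g, hg, fun s => ?_⟩
    rw [Finset.prod_insert hρ, key s, hfg s]
    ring

lemma eq_zero_sub_of_mul_prod_ne {f g : ℂ → ℂ} {Z : Finset ℂ} {ρ : ℂ} (hρ : ρ ∈ Z)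
    (hfg : ∀ s, f s = g s * ∏ ρ ∈ Z, (s - ρ)) (hg : DifferentiableAt ℂ g ρ)
    (hd : deriv f ρ ≠ 0) : g ρ ≠ 0 := by
  classical
  intro h0
  apply hd
  have hff : f = fun s => (s - ρ) * (g s * ∏ ρ ∈ Z.erase ρ, (s - ρ)) := by
    ext s
    rw [hfg, ← Finset.mul_prod_erase Z _ hρ]; ring
  rw [hff]
  have h1 : DifferentiableAt ℂ (fun s => g s * ∏ ρ ∈ Z.erase ρ, (s - ρ)) ρ := by fun_prop
  have := ((hasDerivAt_id ρ).sub_const ρ).mul h1.hasDerivAt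
  have h2 := this.deriv
  simp only [id, sub_self, zero_mul, h0, mul_zero, add_zero] at h2
  exact h2

/-- Residue theorem for `h / f` on a rectangle, `f` having only simple zeros. -/
lemma rectInt_div_eq_sum {U : Set ℂ} (hU : IsOpen U) {f h : ℂ → ℂ} (hf : DifferentiableOn ℂ f U)
    (hh : DifferentiableOn ℂ h U) {a b u v : ℝ} (hab : a ≤ b) (huv : u ≤ v)
    (hsub : Icc a b ×ℂ Icc u v ⊆ U)
    (Z : Finset ℂ) (hZ : ∀ s ∈ Icc a b ×ℂ Icc u v, f s = 0 ↔ s ∈ Z)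
    (hZ' : ∀ ρ ∈ Z, ρ ∈ Ioo a b ×ℂ Ioo u v) (hs : ∀ ρ ∈ Z, deriv f ρ ≠ 0) :
    rectInt (fun s => h s / f s) a b u v = 2 * Real.pi * I * ∑ ρ ∈ Z, h ρ / deriv f ρ := by
  classical
  have hIoo : Ioo a b ×ℂ Ioo u v ⊆ Icc a b ×ℂ Icc u v :=
    reProdIm_subset_iff.2 (prod_mono Ioo_subset_Icc_self Ioo_subset_Icc_self)
  have hZU : ∀ ρ ∈ Z, ρ ∈ U := fun ρ hρ => hsub (hIoo (hZ' ρ hρ))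
  have hf0 : ∀ ρ ∈ Z, f ρ = 0 := fun ρ hρ => (hZ ρ (hIoo (hZ' ρ hρ))).2 hρ
  obtain ⟨g, hg, hfg⟩ := exists_eq_mul_prod hU hf Z (fun ρ hρ => ⟨hZU ρ hρ, hf0 ρ hρ⟩)
  have hds : ∀ ρ ∈ Z, ∀ s, f s = (s - ρ) * dslope f ρ s := fun ρ hρ s => by
    have := sub_smul_dslope f ρ s
    rw [hf0 ρ hρ, sub_zero] at this
    exact this.symm
  set c : ℂ → ℂ := fun ρ => h ρ / deriv f ρ with hc
  have hQd : DifferentiableOn ℂ (fun s => h s - ∑ ρ ∈ Z, c ρ * dslope f ρ s) U := by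
    apply hh.sub
    apply DifferentiableOn.fun_sum
    intro ρ hρ
    exact ((differentiableOn_dslope (hU.mem_nhds (hZU ρ hρ))).2 hf).const_mul _
  obtain ⟨q, hq, hQq⟩ := exists_eq_mul_prod hU hQd Z (fun z hz => ⟨hZU z hz, by
    rw [Finset.sum_eq_single z]
    · rw [dslope_same, hc]
      have := hs z hz
      field_simp
      simp
    · intro ρ hρ hne
      have h1 := hds ρ hρ z
      rw [hf0 z hz] at h1
      have : z - ρ ≠ 0 := sub_ne_zero.2 hne.symm
      have h2 : dslope f ρ z = 0 := by simpa [this] using h1.symm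
      rw [h2, mul_zero]
    · exact fun h => absurd hz h⟩)
  have hgne : ∀ s ∈ Icc a b ×ℂ Icc u v, g s ≠ 0 := by
    intro s hsm
    by_cases hsZ : s ∈ Z
    · exact eq_zero_sub_of_mul_prod_ne hsZ hfg (hg.differentiableAt (hU.mem_nhds (hsub hsm)))
        (hs s hsZ)
    · intro h0
      exact hsZ ((hZ s hsm).1 (by rw [hfg, h0, zero_mul]))
  have hb : ∀ s ∈ (Icc a b ×ℂ Icc u v) \ (Ioo a b ×ℂ Ioo u v), ∀ ρ ∈ Z, s - ρ ≠ 0 := by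
    intro s hsm ρ hρ h0
    rw [sub_eq_zero.1 h0] at hsm
    exact hsm.2 (hZ' ρ hρ)
  have hqg : DifferentiableOn ℂ (fun s => q s / g s) (Icc a b ×ℂ Icc u v) :=
    (hq.mono hsub).div (hg.mono hsub) hgne
  have hcongr : ∀ s ∈ (Icc a b ×ℂ Icc u v) \ (Ioo a b ×ℂ Ioo u v),
      h s / f s = q s / g s + ∑ ρ ∈ Z, c ρ * (s - ρ)⁻¹ := by
    intro s hsm
    have hP : ∏ ρ ∈ Z, (s - ρ) ≠ 0 := Finset.prod_ne_zero_iff.2 (hb s hsm)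
    have hg0 := hgne s hsm.1
    have hfs : f s ≠ 0 := by rw [hfg]; exact mul_ne_zero hg0 hP
    have e1 : ∑ ρ ∈ Z, c ρ * (s - ρ)⁻¹ = (∑ ρ ∈ Z, c ρ * dslope f ρ s) / f s := by
      rw [Finset.sum_div]
      refine Finset.sum_congr rfl fun ρ hρ => ?_
      have h2 := hb s hsm ρ hρ
      have h3 : dslope f ρ s ≠ 0 := fun h => hfs (by rw [hds ρ hρ, h, mul_zero])
      rw [hds ρ hρ s]
      field_simp
    have e2 : q s / g s = (h s - ∑ ρ ∈ Z, c ρ * dslope f ρ s) / f s := by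
      rw [hQq, hfg]; field_simp
    rw [e1, e2]; ring
  rw [rectInt_congr hab huv hcongr]
  have hsum : ∀ Z' ⊆ Z, ContinuousOn (fun s => ∑ ρ ∈ Z', c ρ * (s - ρ)⁻¹)
      ((Icc a b ×ℂ Icc u v) \ (Ioo a b ×ℂ Ioo u v)) ∧
      rectInt (fun s => ∑ ρ ∈ Z', c ρ * (s - ρ)⁻¹) a b u v =
        2 * Real.pi * I * ∑ ρ ∈ Z', c ρ := by
    intro Z'
    induction Z' using Finset.induction_on with
    | empty => intro _; simp [rectInt, continuousOn_const]
    | insert ρ Z' hρ ih =>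
      intro hsubZ
      obtain ⟨i1, i2⟩ := ih (fun x hx => hsubZ (by simp [hx]))
      have hρZ : ρ ∈ Z := hsubZ (by simp)
      have hc1 : ContinuousOn (fun s => c ρ * (s - ρ)⁻¹)
          ((Icc a b ×ℂ Icc u v) \ (Ioo a b ×ℂ Ioo u v)) := by
        apply continuousOn_const.mul
        apply ContinuousOn.inv₀ (by fun_prop)
        exact fun s hsm => hb s hsm ρ hρZ
      simp only [Finset.sum_insert hρ]
      refine ⟨hc1.add i1, ?_⟩
      rw [rectInt_add hab huv hc1 i1, i2, rectInt_const_mul]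
      have hm := hZ' ρ hρZ
      rw [mem_reProdIm] at hm
      rw [rectInt_inv_sub hm.1.1 hm.1.2 hm.2.1 hm.2.2]
      ring
  rw [rectInt_add hab huv (hqg.continuousOn.mono sdiff_subset) (hsum Z subset_rfl).1,
    (hsum Z subset_rfl).2, rectInt_eq_zero hab huv hqg, zero_add]

open Metric

/-- A holomorphic logarithm on a disc, with the Borel–Carathéodory bound on concentric discs. -/
lemma exists_log_ball_concentric {f : ℂ → ℂ} {c : ℂ} {R : ℝ} (hR : 0 < R)
    (hf : DifferentiableOn ℂ f (ball c R)) (hne : ∀ z ∈ ball c R, f z ≠ 0) :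
    ∃ g : ℂ → ℂ, DifferentiableOn ℂ g (ball c R) ∧ (∀ z ∈ ball c R, f z = f c * exp (g z)) ∧
      ∀ r M : ℝ, 0 < r → r ≤ R → 0 < M → (∀ z ∈ ball c r, ‖f z‖ ≤ Real.exp M * ‖f c‖) →
        ∀ z ∈ ball c r, ‖g z‖ ≤ 2 * M * ‖z - c‖ / (r - ‖z - c‖) := by
  have hcm : c ∈ ball c R := mem_ball_self hR
  have hld : DifferentiableOn ℂ (fun z => deriv f z / f z) (ball c R) :=
    (hf.deriv isOpen_ball).div hf hne
  obtain ⟨g0, hg0⟩ := hld.isExactOn_ball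
  set g : ℂ → ℂ := fun z => g0 z - g0 c with hg
  have hgd : ∀ z ∈ ball c R, HasDerivAt g (deriv f z / f z) z := fun z hz => (hg0 z hz).sub_const _
  have hgdiff : DifferentiableOn ℂ g (ball c R) := fun z hz =>
    (hgd z hz).differentiableAt.differentiableWithinAt
  have hgc : g c = 0 := by simp [hg]
  have hfe : ∀ z ∈ ball c R, f z = f c * exp (g z) := by
    have hconst : ∀ z ∈ ball c R, f z * exp (-g z) = f c * exp (-g c) := by
      intro z hz
      refine isOpen_ball.is_const_of_deriv_eq_zero (convex_ball c R).isPreconnected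
        (f := fun z => f z * exp (-g z)) ?_ ?_ hz hcm
      · exact hf.mul hgdiff.neg.cexp
      · intro w hw
        have h1 := ((hf.differentiableAt (isOpen_ball.mem_nhds hw)).hasDerivAt).mul
          (hgd w hw).neg.cexp
        have h2 := h1.deriv
        have := hne w hw
        simp only [Pi.zero_apply]
        refine h2.trans ?_
        field_simp
        ring
    intro z hz
    have := hconst z hz
    rw [hgc, neg_zero, exp_zero, mul_one] at this
    rw [← this, mul_assoc, ← exp_add]
    simp
  have hfc : 0 < ‖f c‖ := norm_pos_iff.2 (hne c hcm)
  refine ⟨g, hgdiff, hfe, fun r M hr hrR hM hb z hz => ?_⟩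
  have hsub : ball c r ⊆ ball c R := ball_subset_ball hrR
  have hsh : ∀ w ∈ ball (0 : ℂ) r, w + c ∈ ball c r := fun w hw => by
    simpa using hw
  have := borelCaratheodory_zero (f := fun w => g (w + c)) (z := z - c) (R := r) hM
    ((hgdiff.mono hsub).comp (by fun_prop) hsh) ?_ hr (by simpa [dist_eq_norm] using hz)
    (by simp [hgc])
  · simpa using this
  · intro w hw
    have h1 := hb _ (hsh w hw)
    rw [hfe _ (hsub (hsh w hw)), norm_mul, mul_comm, norm_exp] at h1
    exact Real.exp_le_exp.1 (le_of_mul_le_mul_right h1 hfc)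

/-- A holomorphic logarithm on a disc with the Borel–Carathéodory bound. -/
lemma exists_log_ball {f : ℂ → ℂ} {c : ℂ} {R M : ℝ} (hR : 0 < R) (hM : 0 < M)
    (hf : DifferentiableOn ℂ f (ball c R)) (hne : ∀ z ∈ ball c R, f z ≠ 0)
    (hb : ∀ z ∈ ball c R, ‖f z‖ ≤ Real.exp M * ‖f c‖) :
    ∃ g : ℂ → ℂ, DifferentiableOn ℂ g (ball c R) ∧ (∀ z ∈ ball c R, f z = f c * exp (g z)) ∧
      ∀ z ∈ ball c R, ‖g z‖ ≤ 2 * M * ‖z - c‖ / (R - ‖z - c‖) := by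
  obtain ⟨g, h1, h2, h3⟩ := exists_log_ball_concentric hR hf hne
  exact ⟨g, h1, h2, h3 R M hR le_rfl hM hb⟩

lemma norm_ge_of_ball {f : ℂ → ℂ} {c : ℂ} {R M : ℝ} (hR : 0 < R) (hM : 0 < M)
    (hf : DifferentiableOn ℂ f (ball c R)) (hne : ∀ z ∈ ball c R, f z ≠ 0)
    (hb : ∀ z ∈ ball c R, ‖f z‖ ≤ Real.exp M * ‖f c‖) {z : ℂ} (hz : z ∈ ball c R) :
    ‖f c‖ * Real.exp (-(2 * M * ‖z - c‖ / (R - ‖z - c‖))) ≤ ‖f z‖ := by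
  obtain ⟨g, -, h1, h2⟩ := exists_log_ball hR hM hf hne hb
  rw [h1 z hz, norm_mul, norm_exp]
  gcongr
  have := (abs_le.1 ((abs_re_le_norm (g z)).trans (h2 z hz))).1
  linarith

lemma norm_logDeriv_le_of_ball {f : ℂ → ℂ} {c : ℂ} {R M : ℝ} (hR : 0 < R) (hM : 0 < M)
    (hf : DifferentiableOn ℂ f (ball c R)) (hne : ∀ z ∈ ball c R, f z ≠ 0)
    (hb : ∀ z ∈ ball c R, ‖f z‖ ≤ Real.exp M * ‖f c‖) :
    ‖deriv f c / f c‖ ≤ 4 * M / R := by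
  obtain ⟨g, hg, h1, h2⟩ := exists_log_ball hR hM hf hne hb
  have hcm : c ∈ ball c R := mem_ball_self hR
  have hgc : g c = 0 := by simpa using h2 c hcm
  have hd : deriv f c / f c = deriv g c := by
    have e : f =ᶠ[𝓝 c] fun z => f c * exp (g z) := by
      filter_upwards [isOpen_ball.mem_nhds hcm] with z hz using h1 z hz
    have e2 :=
      ((hg.differentiableAt (isOpen_ball.mem_nhds hcm)).hasDerivAt.cexp.const_mul (f c)).deriv
    rw [e.deriv_eq, e2, hgc, exp_zero, one_mul, mul_div_cancel_left₀ _ (hne c hcm)]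
  rw [hd]
  have hR2 : 0 < R / 2 := by positivity
  have hsub : closedBall c (R / 2) ⊆ ball c R := closedBall_subset_ball (by linarith)
  have := norm_deriv_le_of_forall_mem_sphere_norm_le (f := g) (c := c) (C := 2 * M) hR2
    ((hg.mono hsub).diffContOnCl_ball (by simp)) (fun z hz => by
      have hzn : ‖z - c‖ = R / 2 := by simpa [dist_eq_norm] using hz
      refine (h2 z (hsub (sphere_subset_closedBall hz))).trans (le_of_eq ?_)
      rw [hzn]; field_simp; ring)
  calc ‖deriv g c‖ ≤ 2 * M / (R / 2) := this
    _ = 4 * M / R := by field_simp; ring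

/-- A local convexity bound in a strip, using a Gaussian weight. -/
lemma norm_le_of_rect {F : ℂ → ℂ} {a b t H B l : ℝ} (hH : 0 < H) (hB : 0 ≤ B) (hl : 0 ≤ l)
    (hF : DifferentiableOn ℂ F (Icc a b ×ℂ Icc (t - H) (t + H)))
    (hver : ∀ x y : ℝ, (x = a ∨ x = b) → y ∈ Icc (t - H) (t + H) → ‖F (x + y * I)‖ ≤ B)
    (hhor : ∀ x y : ℝ, (y = t - H ∨ y = t + H) → x ∈ Icc a b →
      ‖F (x + y * I)‖ ≤ B * Real.exp (l * H ^ 2)) {x : ℝ} (hx : x ∈ Icc a b) :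
    ‖F (x + t * I)‖ ≤ B * Real.exp (l * (b - a) ^ 2) := by
  rcases eq_or_lt_of_le hx.1 with rfl | hax
  · refine (hver a t (.inl rfl) ⟨by linarith, by linarith⟩).trans ?_
    exact le_mul_of_one_le_right hB (Real.one_le_exp (by positivity))
  rcases eq_or_lt_of_le hx.2 with rfl | hxb
  · refine (hver x t (.inr rfl) ⟨by linarith, by linarith⟩).trans ?_
    exact le_mul_of_one_le_right hB (Real.one_le_exp (by positivity))
  set s0 : ℂ := x + t * I
  set G : ℂ → ℂ := fun s => F s * exp (l * (s - s0) ^ 2) with hG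
  have hGn : ∀ p q : ℝ, ‖G (p + q * I)‖ =
      ‖F (p + q * I)‖ * Real.exp (l * ((p - x) ^ 2 - (q - t) ^ 2)) := by
    intro p q
    simp only [hG, norm_mul, norm_exp, s0]
    congr 2
    simp [sq]
  set U : Set ℂ := Ioo a b ×ℂ Ioo (t - H) (t + H) with hU
  have hcl : closure U = Icc a b ×ℂ Icc (t - H) (t + H) := by
    rw [hU, closure_reProdIm, closure_Ioo (by linarith), closure_Ioo (by linarith)]
  have hUo : IsOpen U := isOpen_Ioo.reProdIm isOpen_Ioo
  have hbd : Bornology.IsBounded U := (isBounded_Ioo a b).reProdIm (isBounded_Ioo _ _)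
  have hmain := norm_le_of_forall_mem_frontier_norm_le (f := G) hbd
    (C := B * Real.exp (l * (b - a) ^ 2)) ?_ ?_ (z := s0) ?_
  · have : G s0 = F s0 := by simp [hG]
    rwa [this] at hmain
  · apply DifferentiableOn.diffContOnCl
    rw [hcl]
    exact hF.mul (by fun_prop)
  · intro z hz
    rw [hUo.frontier_eq, hcl] at hz
    obtain ⟨hz1, hz2⟩ := hz
    rw [mem_reProdIm] at hz1
    have hze : z = z.re + z.im * I := (re_add_im z).symm
    have hsq : (z.re - x) ^ 2 ≤ (b - a) ^ 2 := by
      apply sq_le_sq'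
      · linarith [hz1.1.1, hx.2]
      · linarith [hz1.1.2, hx.1]
    rw [hze, hGn]
    by_cases hv : z.re = a ∨ z.re = b
    · have h1 := hver z.re z.im hv hz1.2
      have h2 : l * ((z.re - x) ^ 2 - (z.im - t) ^ 2) ≤ l * (b - a) ^ 2 := by
        apply mul_le_mul_of_nonneg_left _ hl
        nlinarith [sq_nonneg (z.im - t)]
      exact mul_le_mul h1 (Real.exp_le_exp.2 h2) (Real.exp_pos _).le hB
    · have hh : z.im = t - H ∨ z.im = t + H := by
        by_contra hcon
        push Not at hcon hv
        apply hz2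
        rw [hU, mem_reProdIm]
        exact ⟨⟨lt_of_le_of_ne hz1.1.1 hv.1.symm, lt_of_le_of_ne hz1.1.2 hv.2⟩,
          ⟨lt_of_le_of_ne hz1.2.1 hcon.1.symm, lt_of_le_of_ne hz1.2.2 hcon.2⟩⟩
      have h1 := hhor z.re z.im hh hz1.1
      have h2 : (z.im - t) ^ 2 = H ^ 2 := by rcases hh with h | h <;> rw [h] <;> ring
      rw [h2]
      calc _ ≤ B * Real.exp (l * H ^ 2) * Real.exp (l * ((z.re - x) ^ 2 - H ^ 2)) := by gcongr
        _ = B * Real.exp (l * (z.re - x) ^ 2) := by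
          rw [mul_assoc, ← Real.exp_add]; congr 2; ring
        _ ≤ _ := by gcongr
  · rw [hcl, mem_reProdIm]
    simp only [s0]
    constructor <;> constructor <;> simp <;> linarith

/-- A three-circles type bound. -/
lemma norm_le_of_annulus {g : ℂ → ℂ} {c : ℂ} {r0 R A B : ℝ} (hr0 : 0 < r0) (hrR : r0 < R)
    (hA : 0 ≤ A) (hg : DifferentiableOn ℂ g (closedBall c R))
    (h0 : ∀ z, ‖z - c‖ = r0 → ‖g z‖ ≤ A) (h1 : ∀ z, ‖z - c‖ = R → ‖g z‖ ≤ B) (N : ℕ) {z : ℂ}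
    (hz0 : r0 ≤ ‖z - c‖) (hz1 : ‖z - c‖ ≤ R) :
    ‖g z‖ ≤ A * (‖z - c‖ / r0) ^ N + B * (‖z - c‖ / R) ^ N := by
  have hR : 0 < R := hr0.trans hrR
  have hB : 0 ≤ B := (norm_nonneg _).trans (h1 (c + R) (by simp [abs_of_pos hR]))
  set U : Set ℂ := ball c R \ closedBall c r0 with hU
  have hUo : IsOpen U := isOpen_ball.sdiff isClosed_closedBall
  have hclo : ∀ w ∈ closure U, r0 ≤ ‖w - c‖ ∧ ‖w - c‖ ≤ R := by
    intro w hw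
    have hcont : Continuous fun w : ℂ => ‖w - c‖ := by fun_prop
    have hc : IsClosed {w : ℂ | r0 ≤ ‖w - c‖ ∧ ‖w - c‖ ≤ R} :=
      (isClosed_le continuous_const hcont).inter (isClosed_le hcont continuous_const)
    refine closure_minimal ?_ hc hw
    intro v hv
    rw [hU] at hv
    simp only [Set.mem_sdiff, mem_ball, mem_closedBall, dist_eq_norm, not_le] at hv
    exact ⟨hv.2.le, hv.1.le⟩
  have hzpos : 0 < ‖z - c‖ := hr0.trans_le hz0
  have hbound : ∀ w, ‖w - c‖ = r0 ∨ ‖w - c‖ = R →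
      ‖g w / (w - c) ^ N‖ ≤ A / r0 ^ N + B / R ^ N := by
    rintro w (hw | hw)
    · rw [norm_div, norm_pow, hw]
      have : ‖g w‖ / r0 ^ N ≤ A / r0 ^ N := by gcongr; exact h0 w hw
      have : 0 ≤ B / R ^ N := by positivity
      linarith
    · rw [norm_div, norm_pow, hw]
      have : ‖g w‖ / R ^ N ≤ B / R ^ N := by gcongr; exact h1 w hw
      have : 0 ≤ A / r0 ^ N := by positivity
      linarith
  have key : ‖g z / (z - c) ^ N‖ ≤ A / r0 ^ N + B / R ^ N := by
    by_cases hzU : z ∈ U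
    · refine norm_le_of_forall_mem_frontier_norm_le (U := U) (f := fun w => g w / (w - c) ^ N)
        (isBounded_ball.subset sdiff_subset) ?_ ?_ (subset_closure hzU)
      · apply DifferentiableOn.diffContOnCl
        apply DifferentiableOn.div (hg.mono fun w hw => by
          simpa [dist_eq_norm] using (hclo w hw).2) (by fun_prop)
        intro w hw
        apply pow_ne_zero
        intro h
        have := (hclo w hw).1
        rw [h, norm_zero] at this
        linarith
      · intro w hw
        rw [hUo.frontier_eq] at hw
        apply hbound
        have h3 := hclo w hw.1
        by_contra hcon
        push Not at hcon
        apply hw.2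
        rw [hU]
        simp only [Set.mem_sdiff, mem_ball, mem_closedBall, dist_eq_norm, not_le]
        exact ⟨lt_of_le_of_ne h3.2 hcon.2, lt_of_le_of_ne h3.1 hcon.1.symm⟩
    · apply hbound
      by_contra hcon
      push Not at hcon
      apply hzU
      rw [hU]
      simp only [Set.mem_sdiff, mem_ball, mem_closedBall, dist_eq_norm, not_le]
      exact ⟨lt_of_le_of_ne hz1 hcon.2, lt_of_le_of_ne hz0 hcon.1.symm⟩
  rw [norm_div, norm_pow, div_le_iff₀ (by positivity)] at key
  refine key.trans (le_of_eq ?_)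
  rw [div_pow, div_pow]
  ring

/-- Lower bound for a holomorphic function in terms of its nearby zeros. -/
lemma zeros_and_lower_bound {U : Set ℂ} (hU : IsOpen U) {f : ℂ → ℂ} {c : ℂ} {R M : ℝ} (hR : 0 < R)
    (hM : 0 < M) (hf : DifferentiableOn ℂ f U) (hRU : closedBall c R ⊆ U) (hfc : f c ≠ 0)
    (hb : ∀ z ∈ closedBall c R, ‖f z‖ ≤ Real.exp M * ‖f c‖) (Z : Finset ℂ)
    (hZ : ∀ s ∈ closedBall c (R / 3), f s = 0 ↔ s ∈ Z) (hZs : ∀ ρ ∈ Z, ρ ∈ closedBall c (R / 3))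
    (hs : ∀ ρ ∈ Z, deriv f ρ ≠ 0) :
    (2 : ℝ) ^ Z.card ≤ Real.exp M ∧ ∀ s ∈ closedBall c (R / 4),
      ‖f c‖ * Real.exp (-(6 * M)) * ∏ ρ ∈ Z, (‖s - ρ‖ / ‖c - ρ‖) ≤ ‖f s‖ := by
  have hR3 : closedBall c (R / 3) ⊆ closedBall c R := closedBall_subset_closedBall (by linarith)
  have hf0 : ∀ ρ ∈ Z, f ρ = 0 := fun ρ hρ => (hZ ρ (hZs ρ hρ)).2 hρ
  have hZU : ∀ ρ ∈ Z, ρ ∈ U := fun ρ hρ => hRU (hR3 (hZs ρ hρ))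
  obtain ⟨g, hg, hfg⟩ := exists_eq_mul_prod hU hf Z (fun ρ hρ => ⟨hZU ρ hρ, hf0 ρ hρ⟩)
  have hcne : ∀ ρ ∈ Z, 0 < ‖c - ρ‖ := by
    intro ρ hρ
    rw [norm_pos_iff, sub_ne_zero]
    rintro rfl
    exact hfc (hf0 _ hρ)
  set P : ℂ := ∏ ρ ∈ Z, (c - ρ) with hP
  have hP0 : 0 < ‖P‖ := by
    rw [hP, norm_prod]; exact Finset.prod_pos hcne
  set G : ℂ → ℂ := fun s => g s * P with hG
  have hGc : G c = f c := by rw [hG, hfg c]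
  have hGd : DifferentiableOn ℂ G U := hg.mul_const _
  have hbG : ∀ z ∈ closedBall c R, ‖G z‖ ≤ Real.exp M * ‖f c‖ / 2 ^ Z.card := by
    intro z hz
    refine norm_le_of_forall_mem_frontier_norm_le (U := ball c R) isBounded_ball
      ((hGd.mono hRU).diffContOnCl_ball subset_rfl) ?_ (by rwa [closure_ball c hR.ne'])
    intro w hw
    rw [frontier_ball c hR.ne'] at hw
    have hwR : ‖w - c‖ = R := by simpa [dist_eq_norm] using hw
    have hfw := hb w (sphere_subset_closedBall hw)
    have hle : ∀ ρ ∈ Z, 2 * ‖c - ρ‖ ≤ ‖w - ρ‖ := by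
      intro ρ hρ
      have h1 : ‖c - ρ‖ ≤ R / 3 := by
        have := hZs ρ hρ
        rwa [mem_closedBall, dist_comm, dist_eq_norm] at this
      have h2 : ‖w - c‖ ≤ ‖w - ρ‖ + ‖c - ρ‖ := by
        rw [norm_sub_rev c ρ]; exact norm_sub_le_norm_sub_add_norm_sub w ρ c
      linarith
    have hprod : 2 ^ Z.card * ‖P‖ ≤ ‖∏ ρ ∈ Z, (w - ρ)‖ := by
      rw [hP, norm_prod, norm_prod, ← Finset.prod_const, ← Finset.prod_mul_distrib]
      exact Finset.prod_le_prod (fun ρ hρ => by positivity) hle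
    rw [hfg w, norm_mul] at hfw
    rw [le_div_iff₀ (by positivity), hG]
    simp only [norm_mul]
    calc ‖g w‖ * ‖P‖ * 2 ^ Z.card = ‖g w‖ * (2 ^ Z.card * ‖P‖) := by ring
      _ ≤ ‖g w‖ * ‖∏ ρ ∈ Z, (w - ρ)‖ := by gcongr
      _ ≤ _ := hfw
  have hfcp : 0 < ‖f c‖ := norm_pos_iff.2 hfc
  have hcR : c ∈ closedBall c R := mem_closedBall_self hR.le
  refine ⟨?_, ?_⟩
  · have := hbG c hcR
    rw [hGc, le_div_iff₀ (by positivity), mul_comm] at this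
    exact le_of_mul_le_mul_right this hfcp
  · intro s hsm
    have hsn : ‖s - c‖ ≤ R / 4 := by simpa [dist_eq_norm] using hsm
    have hb3 : ball c (R / 3) ⊆ closedBall c (R / 3) := ball_subset_closedBall
    have hlow := norm_ge_of_ball (f := G) (c := c) (R := R / 3) (by positivity) hM
      (hGd.mono ((hb3.trans hR3).trans hRU)) (fun z hz => by
        apply mul_ne_zero _ (norm_pos_iff.1 hP0)
        by_cases hzZ : z ∈ Z
        · exact eq_zero_sub_of_mul_prod_ne hzZ hfg
            (hg.differentiableAt (hU.mem_nhds (hZU z hzZ))) (hs z hzZ)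
        · intro h0
          exact hzZ ((hZ z (hb3 hz)).1 (by rw [hfg, h0, zero_mul])))
      (fun z hz => by
        rw [hGc]
        refine (hbG z (hR3 (hb3 hz))).trans ?_
        apply div_le_self (by positivity)
        exact one_le_pow₀ (by norm_num)) (z := s) (by
          rw [mem_ball, dist_eq_norm]; linarith)
    rw [hGc] at hlow
    have hexp : 2 * M * ‖s - c‖ / (R / 3 - ‖s - c‖) ≤ 6 * M := by
      rw [div_le_iff₀ (by linarith)]
      nlinarith
    have hfs : ‖f s‖ = ‖G s‖ * ∏ ρ ∈ Z, (‖s - ρ‖ / ‖c - ρ‖) := by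
      rw [hfg s, hG, Finset.prod_div_distrib]
      simp only [norm_mul, norm_prod, hP]
      have : ∏ ρ ∈ Z, ‖c - ρ‖ ≠ 0 := (Finset.prod_pos hcne).ne'
      field_simp
    rw [hfs]
    gcongr
    refine le_trans ?_ hlow
    gcongr

/-- The fractional part on `(1, ∞)`, extended by zero. -/
noncomputable def fractTail : ℝ → ℂ := (Ioi 1).indicator fun t => ((Int.fract t : ℝ) : ℂ)

lemma norm_fractTail_le (t : ℝ) : ‖fractTail t‖ ≤ 1 := by
  unfold fractTail
  by_cases h : t ∈ Ioi (1 : ℝ)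
  · rw [indicator_of_mem h, norm_real, Real.norm_of_nonneg (Int.fract_nonneg t)]
    exact (Int.fract_lt_one t).le
  · simp [h]

lemma measurable_fractTail : Measurable fractTail :=
  (measurable_ofReal.comp measurable_fract).indicator measurableSet_Ioi

lemma mellin_fractTail (s : ℂ) :
    mellin fractTail (-s) = ∫ t in Ioi (1 : ℝ), (t : ℂ) ^ (-s - 1) * ((Int.fract t : ℝ) : ℂ) := by
  unfold mellin fractTail
  have : ∀ t : ℝ,
      (t : ℂ) ^ (-s - 1) • (Ioi (1 : ℝ)).indicator (fun t => ((Int.fract t : ℝ) : ℂ)) t =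
      (Ioi (1 : ℝ)).indicator (fun t : ℝ => (t : ℂ) ^ (-s - 1) * ((Int.fract t : ℝ) : ℂ)) t := by
    intro t
    by_cases h : t ∈ Ioi (1 : ℝ) <;> simp [h]
  simp_rw [this]
  rw [setIntegral_indicator measurableSet_Ioi,
    inter_eq_right.2 (Ioi_subset_Ioi zero_le_one)]

lemma norm_mellin_fractTail_le {s : ℂ} (hs : 0 < s.re) : ‖mellin fractTail (-s)‖ ≤ 1 / s.re := by
  rw [mellin_fractTail]
  have h1 : ∫ t : ℝ in Ioi (1 : ℝ), t ^ (-s.re - 1) = 1 / s.re := by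
    rw [integral_Ioi_rpow_of_lt (by linarith) one_pos]
    simp [neg_div_neg_eq]
  rw [← h1]
  refine norm_integral_le_of_norm_le (integrableOn_Ioi_rpow_of_lt (by linarith) one_pos) ?_
  refine (ae_restrict_iff' measurableSet_Ioi).2 (.of_forall fun t ht => ?_)
  have ht0 : 0 < t := one_pos.trans ht
  rw [norm_mul, norm_cpow_eq_rpow_re_of_pos ht0, norm_real,
    Real.norm_of_nonneg (Int.fract_nonneg t)]
  simpa using mul_le_of_le_one_right (by positivity) (Int.fract_lt_one t).le

lemma differentiableAt_mellin_fractTail {s : ℂ} (hs : s.re < 0) :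
    DifferentiableAt ℂ (mellin fractTail) s := by
  refine mellin_differentiableAt_of_isBigO_rpow (a := 0) (b := s.re - 1) ?_ ?_ hs ?_ (by linarith)
  · refine (LocallyIntegrable.locallyIntegrableOn ?_ _)
    refine (locallyIntegrable_const (1 : ℝ)).mono measurable_fractTail.aestronglyMeasurable
      (.of_forall fun t => ?_)
    simpa using norm_fractTail_le t
  · refine Asymptotics.IsBigO.of_bound 1 (.of_forall fun t => ?_)
    simpa using norm_fractTail_le t
  · refine Asymptotics.IsBigO.of_bound 1 ?_
    filter_upwards [Ioo_mem_nhdsGT (zero_lt_one' ℝ)] with t ht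
    have : fractTail t = 0 := indicator_of_notMem (by simpa using ht.2.le) _
    rw [this]
    simp

lemma riemannZeta_eq_of_one_lt {s : ℂ} (hs : 1 < s.re) :
    riemannZeta s = s / (s - 1) - s * mellin fractTail (-s) := by
  have hs0 : s ≠ 0 := by rintro rfl; simp at hs; linarith
  have hs1 : s - 1 ≠ 0 := by
    intro h
    have := congrArg re h
    simp at this
    linarith
  have h1 := LSeries_eq_mul_integral (1 : ℕ → ℂ) zero_le_one hs (LSeriesSummable_one_iff.2 hs)
    (Asymptotics.IsBigO.of_bound 1 (.of_forall fun n => by simp))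
  rw [← LSeries_one_eq_riemannZeta hs, h1, mellin_fractTail]
  have hA : IntegrableOn (fun t : ℝ => (t : ℂ) ^ (-s)) (Ioi 1) :=
    integrableOn_Ioi_cpow_of_lt (by simpa using hs) one_pos
  have hB : IntegrableOn (fun t : ℝ => (t : ℂ) ^ (-s - 1) * ((Int.fract t : ℝ) : ℂ)) (Ioi 1) := by
    refine Integrable.mul_bdd (c := 1)
      (integrableOn_Ioi_cpow_of_lt (by simp; linarith) one_pos)
      (measurable_ofReal.comp measurable_fract).aestronglyMeasurable (.of_forall fun t => ?_)
    simp only [norm_real, Real.norm_of_nonneg (Int.fract_nonneg t)]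
    exact (Int.fract_lt_one t).le
  have h2 : ∫ t in Ioi (1 : ℝ), (∑ k ∈ Finset.Icc 1 ⌊t⌋₊, (1 : ℕ → ℂ) k) * (t : ℂ) ^ (-(s + 1)) =
      ∫ t in Ioi (1 : ℝ), ((t : ℂ) ^ (-s) - (t : ℂ) ^ (-s - 1) * ((Int.fract t : ℝ) : ℂ)) := by
    refine setIntegral_congr_fun measurableSet_Ioi fun t ht => ?_
    have ht0 : 0 < t := one_pos.trans ht
    have htc : (t : ℂ) ≠ 0 := by exact_mod_cast ht0.ne'
    have hfl : ((⌊t⌋₊ : ℕ) : ℂ) = t - ((Int.fract t : ℝ) : ℂ) := by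
      rw [← ofReal_sub, Int.self_sub_fract, ← natCast_floor_eq_intCast_floor ht0.le]
      simp
    simp only [Pi.one_apply, Finset.sum_const, Nat.card_Icc, add_tsub_cancel_right, nsmul_eq_mul,
      mul_one, hfl]
    rw [neg_add', sub_mul, cpow_sub _ _ htc, cpow_one]
    field_simp
  rw [h2, integral_sub hA hB, integral_Ioi_cpow_of_lt (by simpa using hs) one_pos]
  simp only [ofReal_one, one_cpow]
  have : -s + 1 ≠ 0 := by rw [neg_add_eq_sub, ← neg_sub]; exact neg_ne_zero.2 hs1
  field_simp
  ring

lemma riemannZeta_eq_mellin {s : ℂ} (hs : 0 < s.re) (hs1 : s ≠ 1) :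
    riemannZeta s = s / (s - 1) - s * mellin fractTail (-s) := by
  have hopen : IsOpen {z : ℂ | 0 < z.re} := isOpen_lt continuous_const continuous_re
  have hg : DifferentiableOn ℂ (fun z => z - z * (z - 1) * mellin fractTail (-z))
      {z : ℂ | 0 < z.re} := by
    intro z hz
    have h1 : DifferentiableAt ℂ (fun w : ℂ => mellin fractTail (-w)) z :=
      (differentiableAt_mellin_fractTail (s := -z) (by simpa using hz)).comp z
        differentiableAt_id.neg
    exact ((by fun_prop : DifferentiableAt ℂ (fun w : ℂ => w) z).sub
      (DifferentiableAt.mul (by fun_prop) h1)).differentiableWithinAt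
  have heq := (differentiable_riemannZeta₁.differentiableOn.analyticOnNhd
    hopen).eqOn_of_preconnected_of_eventuallyEq (hg.analyticOnNhd hopen)
    (convex_halfSpace_re_gt 0).isPreconnected (z₀ := 2) (by simp) (by
      have : {z : ℂ | 1 < z.re} ∈ 𝓝 (2 : ℂ) :=
        (isOpen_lt continuous_const continuous_re).mem_nhds (by simp)
      filter_upwards [this] with z hz
      have hz1 : z ≠ 1 := by rintro rfl; simp at hz
      have h1 := riemannZeta_eq_of_one_lt hz
      rw [riemannZeta_eq_inv_sub_mul hz1] at h1
      have := sub_ne_zero.2 hz1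
      field_simp at h1
      rw [h1]
      ring)
  have h := heq hs
  rw [riemannZeta_eq_inv_sub_mul hs1]
  have := sub_ne_zero.2 hs1
  simp only at h
  rw [h]
  field_simp

lemma norm_riemannZeta_le {x t : ℝ} (hx : 1 / 2 ≤ x) (hx4 : x ≤ 4) (ht : 1 ≤ t) :
    ‖riemannZeta (x + t * I)‖ ≤ 15 * t := by
  have hre : ((x : ℂ) + t * I).re = x := by simp
  have him : ((x : ℂ) + t * I).im = t := by simp
  have hne : ((x : ℂ) + t * I) ≠ 1 := by
    intro h
    have := congrArg im h
    simp at this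
    linarith
  rw [riemannZeta_eq_mellin (by rw [hre]; linarith) hne]
  have h1 : ‖(x : ℂ) + t * I‖ ≤ 5 * t := by
    refine (norm_add_le _ _).trans ?_
    rw [norm_mul, norm_real, norm_real, norm_I, Real.norm_of_nonneg (by linarith),
      Real.norm_of_nonneg (by linarith)]
    linarith
  have h2 : 1 ≤ ‖(x : ℂ) + t * I - 1‖ := by
    have := abs_im_le_norm ((x : ℂ) + t * I - 1)
    simp at this
    rw [abs_of_nonneg (by linarith)] at this
    simpa using ht.trans this
  have h3 : ‖mellin fractTail (-(x + t * I))‖ ≤ 2 := by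
    refine (norm_mellin_fractTail_le (by rw [hre]; linarith)).trans ?_
    rw [hre, div_le_iff₀ (by linarith)]
    linarith
  calc _ ≤ ‖((x : ℂ) + t * I) / (x + t * I - 1)‖ +
        ‖((x : ℂ) + t * I) * mellin fractTail (-(x + t * I))‖ :=
        norm_sub_le _ _
    _ ≤ 5 * t + 5 * t * 2 := by
        rw [norm_div, norm_mul]
        gcongr
        exact (div_le_self (norm_nonneg _) h2).trans h1
    _ = 15 * t := by ring

open scoped ComplexConjugate

/-- The factor in the functional equation `ζ (1 - s) = χ s * ζ s`. -/
noncomputable def chi (s : ℂ) : ℂ := 2 * (2 * Real.pi) ^ (-s) * Gamma s * cos (Real.pi * s / 2)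

lemma ne_neg_nat_of_im_ne_zero {s : ℂ} (hs : s.im ≠ 0) (n : ℕ) : s ≠ -n := by
  rintro rfl; simp at hs

lemma ne_one_of_im_ne_zero {s : ℂ} (hs : s.im ≠ 0) : s ≠ 1 := by
  rintro rfl; simp at hs

lemma ne_zero_of_im_ne_zero {s : ℂ} (hs : s.im ≠ 0) : s ≠ 0 := by
  rintro rfl; simp at hs

lemma riemannZeta_one_sub_eq_chi {s : ℂ} (hs : s.im ≠ 0) :
    riemannZeta (1 - s) = chi s * riemannZeta s :=
  riemannZeta_one_sub (ne_neg_nat_of_im_ne_zero hs) (ne_one_of_im_ne_zero hs)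

lemma sin_pi_mul_ne_zero {s : ℂ} (hs : s.im ≠ 0) : sin (Real.pi * s) ≠ 0 := by
  rw [Ne, sin_eq_zero_iff]
  rintro ⟨k, hk⟩
  have h := congrArg im hk
  simp at h
  exact hs h

lemma ofReal_two_pi_ne_zero : (2 * Real.pi : ℂ) ≠ 0 := by
  exact_mod_cast (by positivity : (2 * Real.pi : ℝ) ≠ 0)

lemma chi_mul_chi_one_sub {s : ℂ} (hs : s.im ≠ 0) : chi s * chi (1 - s) = 1 := by
  have h1 := Gamma_mul_Gamma_one_sub s
  have hsin := sin_pi_mul_ne_zero hs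
  have h2 : cos (Real.pi * (1 - s) / 2) = sin (Real.pi * s / 2) := by
    rw [← cos_pi_div_two_sub]; ring_nf
  have h3 : sin (Real.pi * s) = 2 * sin (Real.pi * s / 2) * cos (Real.pi * s / 2) := by
    rw [← sin_two_mul]; ring_nf
  have h4 : (2 * Real.pi : ℂ) ^ (-s) * (2 * Real.pi) ^ (-(1 - s)) = (2 * Real.pi : ℂ)⁻¹ := by
    rw [← cpow_add _ _ ofReal_two_pi_ne_zero, ← cpow_neg_one]; ring_nf
  have hpi : (Real.pi : ℂ) ≠ 0 := by exact_mod_cast Real.pi_ne_zero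
  unfold chi
  rw [h2]
  calc _ = 2 * ((2 * Real.pi : ℂ) ^ (-s) * (2 * Real.pi) ^ (-(1 - s))) * (Gamma s * Gamma (1 - s)) *
        (2 * sin (Real.pi * s / 2) * cos (Real.pi * s / 2)) := by ring
    _ = 1 := by rw [h4, h1, ← h3]; field_simp

lemma chi_ne_zero {s : ℂ} (hs : s.im ≠ 0) : chi s ≠ 0 :=
  left_ne_zero_of_mul_eq_one (chi_mul_chi_one_sub hs)

lemma chi_conj (s : ℂ) : chi (conj s) = conj (chi s) := by
  unfold chi
  have h1 : (2 * Real.pi : ℂ) ^ (-conj s) = conj ((2 * Real.pi : ℂ) ^ (-s)) := by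
    have : (2 * Real.pi : ℂ) = ((2 * Real.pi : ℝ) : ℂ) := by push_cast; ring
    rw [this, ← map_neg, cpow_conj, conj_ofReal]
    rw [arg_ofReal_of_nonneg (by positivity)]
    exact Real.pi_pos.ne
  have h2 : cos (Real.pi * conj s / 2) = conj (cos (Real.pi * s / 2)) := by
    rw [← cos_conj]; simp [Complex.conj_ofNat]
  rw [h1, h2, Gamma_conj]
  simp [Complex.conj_ofNat]

lemma differentiableAt_chi {s : ℂ} (hs : s.im ≠ 0) : DifferentiableAt ℂ chi s := by
  unfold chi
  have h1 : DifferentiableAt ℂ (fun s : ℂ => (2 * Real.pi : ℂ) ^ (-s)) s :=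
    differentiableAt_id.neg.const_cpow (Or.inl ofReal_two_pi_ne_zero)
  have h2 := differentiableAt_Gamma s (ne_neg_nat_of_im_ne_zero hs)
  exact (((differentiableAt_const _).mul h1).mul h2).mul (by fun_prop)

lemma norm_chi_conj (x t : ℝ) : ‖chi (1 - (x + t * I))‖ = ‖chi ((1 - x : ℝ) + t * I)‖ := by
  have : (1 : ℂ) - (x + t * I) = conj (((1 - x : ℝ) : ℂ) + t * I) := by
    simp; ring
  rw [this, chi_conj, norm_conj]

lemma norm_chi_mul (x : ℝ) {t : ℝ} (ht : t ≠ 0) :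
    ‖chi (x + t * I)‖ * ‖chi ((1 - x : ℝ) + t * I)‖ = 1 := by
  rw [← norm_chi_conj, ← norm_mul, chi_mul_chi_one_sub (by simpa using ht), norm_one]

lemma norm_chi_half {t : ℝ} (ht : t ≠ 0) : ‖chi (1 / 2 + t * I)‖ = 1 := by
  have h := norm_chi_mul (1 / 2) ht
  norm_num at h ⊢
  nlinarith [norm_nonneg (chi (1 / 2 + t * I))]

lemma norm_sin_eq_norm_cos (t : ℝ) : ‖sin (Real.pi / 4 + t * I)‖ = ‖cos (Real.pi / 4 + t * I)‖ := by
  have h : cos (Real.pi / 4 + t * I) = conj (sin (Real.pi / 4 + t * I)) := by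
    rw [← sin_conj, ← cos_pi_div_two_sub]
    congr 1
    simp [Complex.conj_ofNat]
    ring
  rw [h, norm_conj]

lemma norm_chi_three_halves {t : ℝ} (ht : t ≠ 0) :
    ‖chi (3 / 2 + t * I)‖ = ‖(1 / 2 + t * I : ℂ)‖ / (2 * Real.pi) := by
  set s : ℂ := 1 / 2 + t * I with hs
  have him : s.im ≠ 0 := by simp [hs, ht]
  have e : (3 / 2 + t * I : ℂ) = s + 1 := by rw [hs]; ring
  have h1 : chi (s + 1) * cos (Real.pi * s / 2) =
      -(s / (2 * Real.pi)) * (sin (Real.pi * s / 2) * chi s) := by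
    unfold chi
    have h2 : cos (Real.pi * (s + 1) / 2) = -sin (Real.pi * s / 2) := by
      rw [← cos_add_pi_div_two]; ring_nf
    rw [h2, Gamma_add_one s (ne_zero_of_im_ne_zero him), neg_add',
      cpow_sub _ _ ofReal_two_pi_ne_zero,
      cpow_one]
    ring
  have h3 : ‖sin (Real.pi * s / 2)‖ = ‖cos (Real.pi * s / 2)‖ := by
    have := norm_sin_eq_norm_cos (Real.pi * t / 2)
    have e2 : (Real.pi * s / 2 : ℂ) = Real.pi / 4 + (Real.pi * t / 2 : ℝ) * I := by
      rw [hs]; push_cast; ring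
    rw [e2]; exact this
  have h4 : cos (Real.pi * s / 2) ≠ 0 := by
    have := chi_ne_zero him
    unfold chi at this
    exact right_ne_zero_of_mul this
  have h5 := congrArg norm h1
  rw [norm_mul, norm_mul, norm_mul, h3, norm_neg, norm_div, norm_chi_half ht, mul_one] at h5
  rw [e, mul_right_cancel₀ (norm_ne_zero_iff.2 h4) h5]
  congr 1
  simp [abs_of_pos Real.pi_pos]

lemma norm_cos_le_exp (z : ℂ) : ‖cos z‖ ≤ Real.exp |z.im| := by
  rw [Complex.cos, norm_div, Complex.norm_ofNat, div_le_iff₀ two_pos]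
  refine (norm_add_le _ _).trans ?_
  rw [norm_exp, norm_exp]
  have h1 : (z * I).re ≤ |z.im| := by simpa using neg_le_abs z.im
  have h2 : (-z * I).re ≤ |z.im| := by simpa using le_abs_self z.im
  have := Real.exp_le_exp.2 h1
  have := Real.exp_le_exp.2 h2
  linarith

lemma norm_Gamma_le {s : ℂ} (hs : 0 < s.re) : ‖Gamma s‖ ≤ Real.Gamma s.re := by
  rw [Gamma_eq_integral hs, Real.Gamma_eq_integral hs]
  refine (MeasureTheory.norm_integral_le_integral_norm _).trans (le_of_eq ?_)
  refine setIntegral_congr_fun measurableSet_Ioi fun x hx => ?_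
  simp [norm_cpow_eq_rpow_re_of_pos hx, norm_exp]

lemma exists_norm_chi_le_exp : ∃ C : ℝ, 0 < C ∧ ∀ x t : ℝ, x ∈ Icc (-1 / 2) (3 / 2) → 1 ≤ t →
    ‖chi (x + t * I)‖ ≤ C * Real.exp (2 * t) := by
  have hcont : ContinuousOn Real.Gamma (Icc (1 / 2) (5 / 2)) := fun x hx =>
    (Real.differentiableAt_Gamma (fun m h => by
      have : (0 : ℝ) ≤ m := Nat.cast_nonneg m
      have := hx.1
      linarith)).continuousAt.continuousWithinAt
  obtain ⟨G, hG⟩ := isCompact_Icc.exists_bound_of_continuousOn hcont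
  have hG0 : 0 ≤ G := (norm_nonneg _).trans (hG 1 (by norm_num))
  refine ⟨2 * (2 * Real.pi) * (G + 1), by positivity, fun x t hx ht => ?_⟩
  set s : ℂ := x + t * I with hs
  have hre : s.re = x := by simp [hs]
  have him : s.im = t := by simp [hs]
  have hs0 : s ≠ 0 := ne_zero_of_im_ne_zero (by rw [him]; linarith)
  have h1s : 1 ≤ ‖s‖ := by
    have := abs_im_le_norm s
    rw [him, abs_of_nonneg (by linarith)] at this
    linarith
  have hΓ : ‖Gamma s‖ ≤ G + 1 := by
    have e : ‖Gamma (s + 1)‖ ≤ G := by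
      refine (norm_Gamma_le (by simp [hre]; linarith [hx.1])).trans ?_
      refine (le_abs_self _).trans (hG _ ?_)
      simp only [add_re, hre, one_re]
      constructor <;> linarith [hx.1, hx.2]
    rw [Gamma_add_one s hs0, norm_mul] at e
    nlinarith [norm_nonneg (Gamma s)]
  have hcos : ‖cos (Real.pi * s / 2)‖ ≤ Real.exp (2 * t) := by
    refine (norm_cos_le_exp _).trans (Real.exp_le_exp.2 ?_)
    have : (Real.pi * s / 2 : ℂ).im = Real.pi * t / 2 := by
      simp [him]
    rw [this, abs_of_nonneg (by positivity)]
    nlinarith [Real.pi_lt_four]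
  have hpow : ‖(2 * Real.pi : ℂ) ^ (-s)‖ ≤ 2 * Real.pi := by
    have : (2 * Real.pi : ℂ) = ((2 * Real.pi : ℝ) : ℂ) := by push_cast; ring
    rw [this, norm_cpow_eq_rpow_re_of_pos (by positivity), neg_re, hre]
    calc (2 * Real.pi) ^ (-x) ≤ (2 * Real.pi) ^ (1 : ℝ) :=
          Real.rpow_le_rpow_of_exponent_le (by linarith [Real.pi_gt_three]) (by linarith [hx.1])
      _ = _ := Real.rpow_one _
  unfold chi
  rw [norm_mul, norm_mul, norm_mul, Complex.norm_ofNat]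
  gcongr

/-- The size of `χ` in the strip `-1/2 ≤ σ ≤ 3/2`, upper bound. -/
lemma exists_norm_chi_le : ∃ C : ℝ, 1 ≤ C ∧ ∀ x t : ℝ, x ∈ Icc (-1 / 2) (3 / 2) → 16 ≤ t →
    ‖chi (x + t * I)‖ ≤ C * t ^ (x - 1 / 2) := by
  obtain ⟨C0, hC0, hb⟩ := exists_norm_chi_le_exp
  refine ⟨(C0 + 13) * Real.exp 4, ?_, fun x t hx ht => ?_⟩
  · nlinarith [Real.add_one_le_exp 4]
  have ht0 : 0 < t := by linarith
  set F : ℂ → ℂ := fun s => chi s * exp (-(s - 1 / 2) * Real.log t) with hF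
  have hFn : ∀ p q : ℝ, ‖F (p + q * I)‖ = ‖chi (p + q * I)‖ * t ^ (1 / 2 - p) := by
    intro p q
    simp only [hF, norm_mul, norm_exp]
    rw [Real.rpow_def_of_pos ht0]
    congr 2
    simp
    ring
  have key := norm_le_of_rect (F := F) (a := -1 / 2) (b := 3 / 2) (t := t) (H := t / 2)
    (B := C0 + 13) (l := 1) (by positivity) (by positivity) zero_le_one ?_ ?_ ?_ hx
  · rw [hFn] at key
    have h1 : t ^ (1 / 2 - x) * t ^ (x - 1 / 2) = 1 := by
      rw [← Real.rpow_add ht0]; simp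
    calc ‖chi (x + t * I)‖ = ‖chi (x + t * I)‖ * t ^ (1 / 2 - x) * t ^ (x - 1 / 2) := by
          rw [mul_assoc, h1, mul_one]
      _ ≤ (C0 + 13) * Real.exp (1 * (3 / 2 - -1 / 2) ^ 2) * t ^ (x - 1 / 2) := by gcongr
      _ = _ := by norm_num
  · intro s hs
    have him : s.im ≠ 0 := by
      have := (mem_reProdIm.1 hs).2.1
      linarith
    exact ((differentiableAt_chi him).mul (by fun_prop)).differentiableWithinAt
  · intro p q hp hq
    have hq1 : t / 2 ≤ q := by linarith [hq.1]
    have hq2 : q ≤ 3 / 2 * t := by linarith [hq.2]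
    have hq0 : q ≠ 0 := by linarith
    rw [hFn]
    have hn : ‖(1 / 2 + q * I : ℂ)‖ ≤ 2 * t := by
      refine (norm_add_le _ _).trans ?_
      rw [norm_mul, norm_I, norm_real, Real.norm_of_nonneg (by linarith)]
      norm_num
      linarith
    have hn2 : t / 2 ≤ ‖(1 / 2 + q * I : ℂ)‖ := by
      have := abs_im_le_norm (1 / 2 + q * I : ℂ)
      simp at this
      rw [abs_of_nonneg (by linarith)] at this
      norm_num at this ⊢
      linarith
    rcases hp with rfl | rfl
    · have h := norm_chi_mul (-1 / 2) hq0
      have e : (((1 - -1 / 2 : ℝ) : ℂ) + q * I) = 3 / 2 + q * I := by push_cast; ring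
      rw [e, norm_chi_three_halves hq0] at h
      have h2 : ‖chi ((-1 / 2 : ℝ) + q * I)‖ * t ≤ 13 := by
        have hpi := Real.pi_lt_d2
        have hpi0 := Real.pi_pos
        rw [mul_div_assoc', div_eq_one_iff_eq (by positivity)] at h
        nlinarith [norm_nonneg (chi ((-1 / 2 : ℝ) + q * I))]
      norm_num at h2 ⊢
      linarith
    · have e : (((3 / 2 : ℝ) : ℂ) + q * I) = 3 / 2 + q * I := by push_cast; ring
      rw [e, norm_chi_three_halves hq0]
      have e2 : t ^ (1 / 2 - 3 / 2 : ℝ) = t⁻¹ := by norm_num [Real.rpow_neg_one]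
      rw [e2]
      have : ‖(1 / 2 + q * I : ℂ)‖ / (2 * Real.pi) * t⁻¹ ≤ 1 := by
        rw [← div_eq_mul_inv, div_div, div_le_one (by positivity)]
        nlinarith [Real.pi_gt_three]
      linarith
  · intro p q hq hp
    have hq1 : 1 ≤ q ∧ q ≤ 3 / 2 * t := by rcases hq with h | h <;> constructor <;> linarith
    rw [hFn]
    have h1 := hb p q hp hq1.1
    have h2 : t ^ (1 / 2 - p) ≤ Real.exp t := by
      calc t ^ (1 / 2 - p) ≤ t ^ (1 : ℝ) :=
            Real.rpow_le_rpow_of_exponent_le (by linarith) (by linarith [hp.1])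
        _ = t := Real.rpow_one _
        _ ≤ Real.exp t := by linarith [Real.add_one_le_exp t]
    calc _ ≤ C0 * Real.exp (2 * q) * Real.exp t := by gcongr
      _ = C0 * Real.exp (2 * q + t) := by rw [mul_assoc, ← Real.exp_add]
      _ ≤ (C0 + 13) * Real.exp (1 * (t / 2) ^ 2) := by
        gcongr
        · linarith
        · nlinarith

lemma exists_le_norm_chi : ∃ C : ℝ, 1 ≤ C ∧ ∀ x t : ℝ, x ∈ Icc (-1 / 2) (3 / 2) → 16 ≤ t →
    ‖chi (x + t * I)‖ ≤ C * t ^ (x - 1 / 2) ∧ t ^ (x - 1 / 2) ≤ C * ‖chi (x + t * I)‖ := by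
  obtain ⟨C, hC, h⟩ := exists_norm_chi_le
  refine ⟨C, hC, fun x t hx ht => ⟨h x t hx ht, ?_⟩⟩
  have h1 := h (1 - x) t (by constructor <;> linarith [hx.1, hx.2]) ht
  have h2 := norm_chi_mul x (t := t) (by linarith)
  have ht0 : 0 < t := by linarith
  have h3 : t ^ (1 - x - 1 / 2) * t ^ (x - 1 / 2) = 1 := by
    rw [← Real.rpow_add ht0]; ring_nf; simp
  have h4 : 0 < t ^ (x - 1 / 2) := by positivity
  calc t ^ (x - 1 / 2) = ‖chi (x + t * I)‖ * ‖chi ((1 - x : ℝ) + t * I)‖ * t ^ (x - 1 / 2) := by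
        rw [h2, one_mul]
    _ ≤ ‖chi (x + t * I)‖ * (C * t ^ (1 - x - 1 / 2)) * t ^ (x - 1 / 2) := by gcongr
    _ = C * ‖chi (x + t * I)‖ * (t ^ (1 - x - 1 / 2) * t ^ (x - 1 / 2)) := by ring
    _ = _ := by rw [h3, mul_one]

lemma exists_norm_logDeriv_chi_sub_log_le : ∃ C : ℝ, 0 < C ∧ ∀ x t : ℝ, x ∈ Icc (1 / 2) (5 / 4) →
    17 ≤ t → ‖deriv chi (x + t * I) / chi (x + t * I) - Real.log t‖ ≤ C := by
  obtain ⟨C, hC, h⟩ := exists_le_norm_chi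
  have hM : 0 < Real.log (2 * C ^ 2) := Real.log_pos (by nlinarith)
  refine ⟨4 * Real.log (2 * C ^ 2) / (1 / 4), by positivity, fun x t hx ht => ?_⟩
  have ht0 : 0 < t := by linarith
  set c : ℂ := x + t * I with hc
  have hcim : c.im ≠ 0 := by simp [hc]; linarith
  set f : ℂ → ℂ := fun s => chi s * exp (-(s - 1 / 2) * Real.log t) with hf
  have hball : ∀ z ∈ ball c (1 / 4), z.re ∈ Icc (1 / 4) (3 / 2) ∧ |z.im - t| ≤ 1 / 4 := by
    intro z hz
    rw [mem_ball, dist_eq_norm] at hz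
    have h1 := (abs_re_le_norm (z - c)).trans hz.le
    have h2 := (abs_im_le_norm (z - c)).trans hz.le
    simp [hc] at h1 h2
    rw [abs_le] at h1
    refine ⟨⟨by linarith [hx.1], by linarith [hx.2]⟩, h2.trans (by norm_num)⟩
  have him : ∀ z ∈ ball c (1 / 4), z.im ≠ 0 := by
    intro z hz
    have := (abs_le.1 (hball z hz).2).1
    linarith
  have hd : ∀ z, z.im ≠ 0 → HasDerivAt f (deriv chi z * exp (-(z - 1 / 2) * Real.log t) +
      chi z * (exp (-(z - 1 / 2) * Real.log t) * (-1 * Real.log t))) z := by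
    intro z hz
    exact (differentiableAt_chi hz).hasDerivAt.mul
      ((((hasDerivAt_id z).sub_const (1 / 2)).neg.mul_const _).cexp)
  have hfn : ∀ z, ‖f z‖ = ‖chi z‖ * t ^ (1 / 2 - z.re) := by
    intro z
    simp only [hf, norm_mul, norm_exp]
    rw [Real.rpow_def_of_pos ht0]
    congr 2
    simp
    ring
  have key := norm_logDeriv_le_of_ball (f := f) (c := c) (R := 1 / 4) (by norm_num) hM
    (fun z hz => (hd z (him z hz)).differentiableAt.differentiableWithinAt)
    (fun z hz => mul_ne_zero (chi_ne_zero (him z hz)) (exp_ne_zero _)) ?_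
  · have e : deriv f c / f c = deriv chi c / chi c - Real.log t := by
      rw [(hd c hcim).deriv, hf]
      have := chi_ne_zero hcim
      have := exp_ne_zero (-(c - 1 / 2) * Real.log t)
      field_simp
      ring
    rwa [e] at key
  · intro z hz
    obtain ⟨hz1, hz2⟩ := hball z hz
    rw [abs_le] at hz2
    rw [Real.exp_log (by positivity), hfn, hfn]
    have hzre : z = z.re + z.im * I := (re_add_im z).symm
    have h1 := (h z.re z.im ⟨by linarith [hz1.1], hz1.2⟩ (by linarith)).1
    rw [← hzre] at h1
    have h2 := (h x t ⟨by linarith [hx.1], by linarith [hx.2]⟩ (by linarith)).2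
    have hcre : c.re = x := by simp [hc]
    rw [hcre]
    have h3 : z.im ^ (z.re - 1 / 2) ≤ 2 * t ^ (z.re - 1 / 2) := by
      have hz0 : 0 < z.im := by linarith
      rw [← div_le_iff₀ (by positivity), ← Real.div_rpow hz0.le ht0.le]
      have hq1 : z.im / t ≤ 2 := by rw [div_le_iff₀ ht0]; linarith
      have hq2 : 1 / 2 ≤ z.im / t := by rw [le_div_iff₀ ht0]; linarith
      rcases le_total 0 (z.re - 1 / 2) with hp | hp
      · calc (z.im / t) ^ (z.re - 1 / 2) ≤ 2 ^ (z.re - 1 / 2) := by gcongr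
          _ ≤ 2 ^ (1 : ℝ) := Real.rpow_le_rpow_of_exponent_le (by norm_num) (by linarith [hz1.2])
          _ = 2 := Real.rpow_one _
      · calc (z.im / t) ^ (z.re - 1 / 2) ≤ (1 / 2) ^ (z.re - 1 / 2) :=
              Real.rpow_le_rpow_of_nonpos (by norm_num) hq2 hp
          _ ≤ (1 / 2 : ℝ) ^ (-1 : ℝ) :=
              Real.rpow_le_rpow_of_exponent_ge (by norm_num) (by norm_num) (by linarith [hz1.1])
          _ = 2 := by rw [Real.rpow_neg_one]; norm_num
    have h4 : t ^ (z.re - 1 / 2) * t ^ (1 / 2 - z.re) = 1 := by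
      rw [← Real.rpow_add ht0]; simp
    have h5 : t ^ (x - 1 / 2) * t ^ (1 / 2 - x) = 1 := by
      rw [← Real.rpow_add ht0]; simp
    calc ‖chi z‖ * t ^ (1 / 2 - z.re) ≤ C * (2 * t ^ (z.re - 1 / 2)) * t ^ (1 / 2 - z.re) := by
          gcongr
          exact h1.trans (by gcongr)
      _ = 2 * C * (t ^ (x - 1 / 2) * t ^ (1 / 2 - x)) := by
          rw [h5, mul_assoc, mul_assoc, h4]; ring
      _ ≤ 2 * C * ((C * ‖chi c‖) * t ^ (1 / 2 - x)) := by gcongr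
      _ = _ := by ring

lemma norm_LSeries_le {f : ℕ → ℂ} {a s : ℂ} (hf : LSeriesSummable f a) (h : a.re ≤ s.re) :
    ‖LSeries f s‖ ≤ ∑' n, ‖LSeries.term f a n‖ := by
  refine (norm_tsum_le_tsum_norm (hf.of_re_le_re h).norm).trans ?_
  exact (hf.of_re_le_re h).norm.tsum_le_tsum (LSeries.norm_term_le_of_re_le_re f h) hf.norm

lemma exists_riemannZeta_bounds {a : ℝ} (ha : 1 < a) :
    ∃ K : ℝ, 1 ≤ K ∧ ∀ s : ℂ, a ≤ s.re → ‖riemannZeta s‖ ≤ K ∧ 1 ≤ K * ‖riemannZeta s‖ := by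
  have h1 : LSeriesSummable (fun n => (ArithmeticFunction.zeta n : ℂ)) (a : ℂ) :=
    ArithmeticFunction.LSeriesSummable_zeta_iff.2 (by simpa using ha)
  have h2 : LSeriesSummable (fun n => (ArithmeticFunction.moebius n : ℂ)) (a : ℂ) :=
    ArithmeticFunction.LSeriesSummable_moebius_iff.2 (by simpa using ha)
  set K1 := ∑' n, ‖LSeries.term (fun n => (ArithmeticFunction.zeta n : ℂ)) (a : ℂ) n‖
  set K2 := ∑' n, ‖LSeries.term (fun n => (ArithmeticFunction.moebius n : ℂ)) (a : ℂ) n‖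
  refine ⟨max 1 (max K1 K2), le_max_left _ _, fun s hs => ?_⟩
  have hs1 : 1 < s.re := ha.trans_le hs
  have e := ArithmeticFunction.LSeries_zeta_eq_riemannZeta hs1
  have b1 := norm_LSeries_le h1 (s := s) (by simpa using hs)
  have b2 := norm_LSeries_le h2 (s := s) (by simpa using hs)
  have hmul := ArithmeticFunction.LSeries_zeta_mul_Lseries_moebius hs1
  rw [e] at b1 hmul
  refine ⟨b1.trans ((le_max_left _ _).trans (le_max_right _ _)), ?_⟩
  have h3 := congrArg norm hmul
  rw [norm_mul, norm_one] at h3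
  rw [← h3, mul_comm]
  gcongr
  exact b2.trans ((le_max_right _ _).trans (le_max_right _ _))

lemma eventually_mul_rpow_le (A a : ℝ) {b : ℝ} (hab : a < b) :
    ∀ᶠ t : ℝ in atTop, A * t ^ a ≤ t ^ b := by
  filter_upwards [(tendsto_rpow_atTop (sub_pos.2 hab)).eventually_ge_atTop A,
    eventually_gt_atTop 0] with t ht ht0
  calc A * t ^ a ≤ t ^ (b - a) * t ^ a := by gcongr
    _ = t ^ b := by rw [← Real.rpow_add ht0, sub_add_cancel]

lemma riemannZeta_ne_zero_of_half_lt (hRH : RiemannHypothesis) {s : ℂ} (hs : 1 / 2 < s.re)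
    (him : s.im ≠ 0) :
    riemannZeta s ≠ 0 := by
  intro h0
  have := hRH s h0 (by rintro ⟨n, rfl⟩; simp at him) (ne_one_of_im_ne_zero him)
  linarith

lemma re_eq_half_of_zero (hRH : RiemannHypothesis) {s : ℂ} (h0 : riemannZeta s = 0)
    (him : s.im ≠ 0) : s.re = 1 / 2 :=
  hRH s h0 (by rintro ⟨n, rfl⟩; simp at him) (ne_one_of_im_ne_zero him)

/-- The Lindelöf-type bounds to the right of the critical line. -/
lemma eventually_riemannZeta_bounds (hRH : RiemannHypothesis) {δ ε : ℝ} (hδ : 0 < δ)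
    (hδ1 : δ ≤ 1 / 2) (hε : 0 < ε) :
    ∀ᶠ t : ℝ in atTop, ∀ x ∈ Icc (1 / 2 + δ) 2,
      ‖riemannZeta (x + t * I)‖ ≤ t ^ ε ∧ t ^ (-ε) ≤ ‖riemannZeta (x + t * I)‖ := by
  obtain ⟨K, hK, hKb⟩ := exists_riemannZeta_bounds (a := 5 / 4) (by norm_num)
  set M0 := Real.log (K ^ 2) + 1 with hM0
  have hM0pos : 0 < M0 := by have := Real.log_nonneg (one_le_pow₀ hK (n := 2)); linarith
  set R := 3 / 2 - δ / 2 with hR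
  set r1 := 3 / 2 - δ with hr1
  have hq1 : r1 / R < 1 := by rw [div_lt_one (by linarith)]; linarith
  obtain ⟨N, hN⟩ := exists_pow_lt_of_lt_one (show 0 < ε * δ / 24 by positivity) hq1
  set D := 4 * M0 * 3 ^ N with hD
  have hE1 := eventually_mul_rpow_le (45 * K) 1 (show (1 : ℝ) < 2 by norm_num)
  have hE2 := eventually_mul_rpow_le (K * Real.exp D) 0 (half_pos hε)
  filter_upwards [hE1, hE2, eventually_ge_atTop 16] with t ht1 ht2 ht16 x hx
  have ht0 : 0 < t := by linarith
  have hlog : 0 < Real.log t := Real.log_pos (by linarith)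
  rw [Real.rpow_one] at ht1
  rw [Real.rpow_zero, mul_one] at ht2
  set c : ℂ := 2 + t * I with hc
  have hcre : c.re = 2 := by simp [hc]
  have hcim : c.im = t := by simp [hc]
  have hcoord : ∀ z : ℂ, |z.re - 2| ≤ ‖z - c‖ ∧ |z.im - t| ≤ ‖z - c‖ := by
    intro z
    have h1 := abs_re_le_norm (z - c)
    have h2 := abs_im_le_norm (z - c)
    rw [sub_re, hcre] at h1
    rw [sub_im, hcim] at h2
    exact ⟨h1, h2⟩
  have hball : ∀ z ∈ ball c (3 / 2), 1 / 2 < z.re ∧ z.re ≤ 4 ∧ 1 ≤ z.im ∧ z.im ≤ t + 2 := by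
    intro z hz
    rw [mem_ball, dist_eq_norm] at hz
    obtain ⟨h1, h2⟩ := hcoord z
    rw [abs_le] at h1 h2
    refine ⟨?_, ?_, ?_, ?_⟩ <;> linarith
  have hbim : ∀ z ∈ ball c (3 / 2), z.im ≠ 0 := fun z hz => by linarith [(hball z hz).2.2.1]
  obtain ⟨g, hg1, hg2, hg3⟩ := exists_log_ball_concentric (f := riemannZeta) (c := c) (R := 3 / 2)
    (by norm_num)
    (fun z hz => (differentiableAt_riemannZeta
      (ne_one_of_im_ne_zero (hbim z hz))).differentiableWithinAt)
    (fun z hz => riemannZeta_ne_zero_of_half_lt hRH (hball z hz).1 (hbim z hz))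
  have hKc := hKb c (by rw [hcre]; norm_num)
  have hnc : 0 < ‖riemannZeta c‖ := by
    by_contra h
    nlinarith [norm_nonneg (riemannZeta c)]
  have hin : ∀ z, ‖z - c‖ ≤ 1 / 2 → ‖g z‖ ≤ 4 * M0 := by
    intro z hz
    refine (hg3 (3 / 4) M0 (by norm_num) (by norm_num) hM0pos (fun w hw => ?_) z (by
      rw [mem_ball, dist_eq_norm]; linarith)).trans ?_
    · have hwre : 5 / 4 ≤ w.re := by
        rw [mem_ball, dist_eq_norm] at hw
        have := (abs_le.1 (hcoord w).1).1
        linarith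
      calc ‖riemannZeta w‖ ≤ K * (K * ‖riemannZeta c‖) :=
            (hKb w hwre).1.trans (le_mul_of_one_le_right (by linarith) hKc.2)
        _ = K ^ 2 * ‖riemannZeta c‖ := by ring
        _ ≤ _ := by
          gcongr
          rw [hM0, Real.exp_add, Real.exp_log (by positivity)]
          exact le_mul_of_one_le_right (by positivity) (Real.one_le_exp zero_le_one)
    · rw [div_le_iff₀ (by linarith)]
      nlinarith
  set M1 := 2 * Real.log t with hM1
  have hM1pos : 0 < M1 := by positivity
  have hout : ∀ z, ‖z - c‖ = R → ‖g z‖ ≤ 6 * M1 / δ := by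
    intro z hz
    refine (hg3 (3 / 2) M1 (by norm_num) le_rfl hM1pos (fun w hw => ?_) z (by
      rw [mem_ball, dist_eq_norm]; linarith)).trans ?_
    · obtain ⟨h1, h2, h3, h4⟩ := hball w hw
      have := norm_riemannZeta_le h1.le h2 h3
      rw [re_add_im] at this
      have e : Real.exp M1 = t ^ (2 : ℝ) := by
        rw [hM1, Real.rpow_def_of_pos ht0]; ring_nf
      rw [e]
      calc ‖riemannZeta w‖ ≤ 45 * t := by linarith
        _ ≤ 45 * t * (K * ‖riemannZeta c‖) := le_mul_of_one_le_right (by linarith) hKc.2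
        _ = 45 * K * t * ‖riemannZeta c‖ := by ring
        _ ≤ _ := by gcongr
    · rw [hz, hR, div_le_div_iff₀ (by linarith) hδ]
      nlinarith [mul_pos hM1pos hδ, mul_nonneg (mul_nonneg hM1pos.le hδ.le) hδ.le]
  have hRlt : R < 3 / 2 := by linarith
  have hRpos : 0 < R := by linarith
  set z : ℂ := x + t * I with hz
  have hzc : z - c = ((x - 2 : ℝ) : ℂ) := by rw [hz, hc]; push_cast; ring
  have hzn : ‖z - c‖ = 2 - x := by
    rw [hzc, norm_real, Real.norm_eq_abs, abs_of_nonpos (by linarith [hx.2])]; ring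
  have hzr : ‖z - c‖ ≤ r1 := by rw [hzn, hr1]; linarith [hx.1]
  have hgz : ‖g z‖ ≤ D + ε / 2 * Real.log t := by
    by_cases hsm : ‖z - c‖ ≤ 1 / 2
    · have h1 := hin z hsm
      have : (1 : ℝ) ≤ 3 ^ N := one_le_pow₀ (by norm_num)
      have : 4 * M0 ≤ D := le_mul_of_one_le_right (by positivity) this
      have : 0 ≤ ε / 2 * Real.log t := by positivity
      linarith
    · push Not at hsm
      have h1 := norm_le_of_annulus (g := g) (c := c) (r0 := 1 / 2) (R := R) (A := 4 * M0)
        (B := 6 * M1 / δ) (by norm_num) (by linarith) (by positivity)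
        (hg1.mono (closedBall_subset_ball hRlt)) (fun w hw => hin w hw.le) hout N hsm.le
        (by linarith)
      refine h1.trans (add_le_add ?_ ?_)
      · rw [hD]
        gcongr
        linarith
      · calc 6 * M1 / δ * (‖z - c‖ / R) ^ N ≤ 6 * M1 / δ * (r1 / R) ^ N := by gcongr
          _ ≤ 6 * M1 / δ * (ε * δ / 24) := by gcongr
          _ = ε / 2 * Real.log t := by rw [hM1]; field_simp; ring
  have hzb : z ∈ ball c (3 / 2) := by rw [mem_ball, dist_eq_norm]; linarith
  have hre := abs_le.1 ((abs_re_le_norm (g z)).trans hgz)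
  have hζ : ‖riemannZeta z‖ = ‖riemannZeta c‖ * Real.exp (g z).re := by
    rw [hg2 z hzb, norm_mul, norm_exp]
  have hsplit : t ^ ε = t ^ (ε / 2) * t ^ (ε / 2) := by
    rw [← Real.rpow_add ht0]; ring_nf
  have hexp : Real.exp (D + ε / 2 * Real.log t) = Real.exp D * t ^ (ε / 2) := by
    rw [Real.exp_add, Real.rpow_def_of_pos ht0, mul_comm (Real.log t)]
  constructor
  · rw [hζ]
    calc _ ≤ K * (Real.exp D * t ^ (ε / 2)) := by
          rw [← hexp]
          exact mul_le_mul hKc.1 (Real.exp_le_exp.2 hre.2) (Real.exp_pos _).le (by linarith)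
      _ = (K * Real.exp D) * t ^ (ε / 2) := by ring
      _ ≤ t ^ ε := by rw [hsplit]; gcongr
  · rw [Real.rpow_neg ht0.le, inv_le_iff_one_le_mul₀ (by positivity), hζ]
    have h5 : 1 ≤ Real.exp (g z).re * (Real.exp D * t ^ (ε / 2)) := by
      rw [← hexp, ← Real.exp_add]
      exact Real.one_le_exp (by linarith)
    calc 1 ≤ (K * ‖riemannZeta c‖) * (Real.exp (g z).re * (Real.exp D * t ^ (ε / 2))) :=
          one_le_mul_of_one_le_of_one_le hKc.2 h5
      _ = ‖riemannZeta c‖ * Real.exp (g z).re * ((K * Real.exp D) * t ^ (ε / 2)) := by ring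
      _ ≤ _ := by rw [hsplit]; gcongr

lemma norm_riemannZeta_reflect (x : ℝ) {y : ℝ} (hy : y ≠ 0) :
    ‖riemannZeta ((1 - x : ℝ) + y * I)‖ = ‖chi (x + y * I)‖ * ‖riemannZeta (x + y * I)‖ := by
  have e : (((1 - x : ℝ) : ℂ) + y * I) = conj (1 - (x + y * I)) := by simp; ring
  rw [e, riemannZeta_conj, norm_conj, riemannZeta_one_sub_eq_chi (by simpa using hy), norm_mul]

lemma eventually_riemannZeta_le (hRH : RiemannHypothesis) {ε : ℝ} (hε : 0 < ε) :
    ∃ δ : ℝ, 0 < δ ∧ δ ≤ 1 / 8 ∧ ∀ᶠ t : ℝ in atTop, ∀ x ∈ Icc (1 / 2 - δ) 2,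
      ‖riemannZeta (x + t * I)‖ ≤ t ^ ε := by
  obtain ⟨C, hC, hchi⟩ := exists_le_norm_chi
  set δ := min (1 / 8) (ε / 8) with hδ
  have hδ0 : 0 < δ := by positivity
  have hδ8 : δ ≤ 1 / 8 := min_le_left _ _
  have hδε : δ ≤ ε / 8 := min_le_right _ _
  refine ⟨δ, hδ0, hδ8, ?_⟩
  set e := ε / 4 with he
  have he0 : 0 < e := by positivity
  obtain ⟨T1, hT1⟩ := eventually_atTop.1
    (eventually_riemannZeta_bounds hRH (δ := δ) (ε := e) hδ0 (by linarith) he0)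
  have hE1 := eventually_mul_rpow_le (C * 2 ^ (δ + e)) (2 * δ + e) (show 2 * δ + e < ε by linarith)
  filter_upwards [eventually_ge_atTop (T1 + 1), eventually_ge_atTop 30, hE1] with t ht1 ht30 htE
  have ht0 : 0 < t := by linarith
  have hlog : 0 ≤ Real.log t := Real.log_nonneg (by linarith)
  intro x hx
  by_cases hx1 : 1 / 2 + δ ≤ x
  · refine ((hT1 t (by linarith) x ⟨hx1, hx.2⟩).1).trans ?_
    exact Real.rpow_le_rpow_of_exponent_le (by linarith) (by linarith)
  push Not at hx1
  have hleft : ∀ p y : ℝ, p ∈ Icc (1 / 2 - δ) (1 / 2) → y ∈ Icc (t - 1) (t + 1) →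
      ‖riemannZeta (p + y * I)‖ ≤ C * (2 * t) ^ δ * ‖riemannZeta ((1 - p : ℝ) + y * I)‖ := by
    intro p y hp hy
    have hy1 := hy.1
    have hy2 := hy.2
    have h := norm_riemannZeta_reflect (1 - p) (y := y) (by linarith)
    rw [sub_sub_cancel] at h
    rw [h]
    have h2 := (hchi (1 - p) y ⟨by linarith [hp.2], by linarith [hp.1]⟩ (by linarith)).1
    have h3 : y ^ (1 - p - 1 / 2) ≤ (2 * t) ^ δ :=
      (Real.rpow_le_rpow_of_exponent_le (by linarith) (by linarith [hp.1])).trans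
        (Real.rpow_le_rpow (by linarith) (by linarith) hδ0.le)
    gcongr
    exact h2.trans (by gcongr)
  have h2t : 1 ≤ (2 * t) ^ δ := Real.one_le_rpow (by linarith) hδ0.le
  have h2e : 1 ≤ (2 * t) ^ e := Real.one_le_rpow (by linarith) he0.le
  have hB1 : 1 ≤ C * (2 * t) ^ δ := one_le_mul_of_one_le_of_one_le hC h2t
  have hright : ∀ y ∈ Icc (t - 1) (t + 1),
      ‖riemannZeta ((1 / 2 + δ : ℝ) + y * I)‖ ≤ (2 * t) ^ e := by
    intro y hy
    refine ((hT1 y (by linarith [hy.1]) (1 / 2 + δ) ⟨le_rfl, by linarith⟩).1).trans ?_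
    exact Real.rpow_le_rpow (by linarith [hy.1]) (by linarith [hy.2]) he0.le
  have key := norm_le_of_rect (F := riemannZeta) (a := 1 / 2 - δ) (b := 1 / 2 + δ) (t := t) (H := 1)
    (B := C * (2 * t) ^ δ * (2 * t) ^ e) (l := 2 * Real.log t) one_pos (by positivity)
    (by positivity) ?_ ?_ ?_ (x := x) ⟨hx.1, hx1.le⟩
  · refine key.trans ?_
    calc C * (2 * t) ^ δ * (2 * t) ^ e * Real.exp (2 * Real.log t * (1 / 2 + δ - (1 / 2 - δ)) ^ 2)
        = C * 2 ^ (δ + e) * (t ^ (δ + e) * t ^ (8 * δ ^ 2)) := by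
          rw [mul_assoc C, ← Real.rpow_add (by positivity), Real.mul_rpow (by norm_num) ht0.le,
            Real.rpow_def_of_pos ht0 (8 * δ ^ 2)]
          ring_nf
      _ = C * 2 ^ (δ + e) * t ^ (δ + e + 8 * δ ^ 2) := by rw [← Real.rpow_add ht0]
      _ ≤ C * 2 ^ (δ + e) * t ^ (2 * δ + e) := by
          refine mul_le_mul_of_nonneg_left
            (Real.rpow_le_rpow_of_exponent_le (by linarith) (by nlinarith)) (by positivity)
      _ ≤ _ := htE
  · intro z hz
    have := hz.2.1
    exact (differentiableAt_riemannZeta (ne_one_of_im_ne_zero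
      (by linarith))).differentiableWithinAt
  · rintro p y (rfl | rfl) hy
    · refine (hleft _ y ⟨le_rfl, by linarith⟩ hy).trans ?_
      gcongr
      have := hright y hy
      rwa [show (1 : ℝ) - (1 / 2 - δ) = 1 / 2 + δ by ring]
    · exact (hright y hy).trans (le_mul_of_one_le_left (by positivity) hB1)
  · intro p y hy hp
    have hy' : y ∈ Icc (t - 1) (t + 1) := by
      rcases hy with rfl | rfl <;> constructor <;> linarith
    have hexp : Real.exp (2 * Real.log t * 1 ^ 2) = t * t := by
      rw [show 2 * Real.log t * 1 ^ 2 = Real.log t + Real.log t by ring, Real.exp_add,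
        Real.exp_log ht0]
    rw [hexp]
    have hfin : C * (2 * t) ^ δ * (t * t) ≤ C * (2 * t) ^ δ * (2 * t) ^ e * (t * t) := by
      refine mul_le_mul_of_nonneg_right ?_ (by positivity)
      exact le_mul_of_one_le_right (by positivity) h2e
    refine le_trans ?_ hfin
    by_cases hp2 : p ≤ 1 / 2
    · refine (hleft p y ⟨hp.1, hp2⟩ hy').trans ?_
      gcongr
      refine (norm_riemannZeta_le (by linarith) (by linarith [hp.1]) (by linarith [hy'.1])).trans ?_
      nlinarith [hy'.2]
    · push Not at hp2
      have := norm_riemannZeta_le hp2.le (by linarith [hp.2]) (t := y) (by linarith [hy'.1])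
      calc _ ≤ 15 * y := this
        _ ≤ t * t := by nlinarith [hy'.2]
        _ ≤ _ := le_mul_of_one_le_left (by positivity) hB1

lemma exists_prod_abs_sub_ge {ι : Type*} (Z : Finset ι) (a : ι → ℝ) (t : ℝ) {δ : ℝ} (hδ : 0 < δ) :
    ∃ y, |y - t| ≤ δ ∧ (δ / 2) ^ Z.card ≤ ∏ i ∈ Z, |y - a i| := by
  by_contra! h
  set P : Polynomial ℝ := Polynomial.C (2 ^ Z.card) *
    ∏ i ∈ Z, (Polynomial.X - Polynomial.C ((a i - t) / δ)) with hP
  have hmon : (∏ i ∈ Z, (Polynomial.X - Polynomial.C ((a i - t) / δ))).Monic :=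
    Polynomial.monic_prod_X_sub_C _ _
  have hdeg : P.degree ≤ (Z.card : ℕ) := by
    rw [hP, Polynomial.degree_C_mul (by positivity), Polynomial.degree_prod]
    simp
  have hlead : P.leadingCoeff = 2 ^ Z.card := by
    rw [hP, Polynomial.leadingCoeff_mul, hmon.leadingCoeff, mul_one, Polynomial.leadingCoeff_C]
  have hle := Polynomial.Chebyshev.leadingCoeff_le_of_forall_abs_le_one (n := Z.card) hdeg
    (fun x hx => by
      have h1 := h (t + δ * x) (by
        rw [add_sub_cancel_left, abs_mul, abs_of_pos hδ]
        exact mul_le_of_le_one_right hδ.le (abs_le.2 hx))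
      have h2 : ∏ i ∈ Z, |t + δ * x - a i| = δ ^ Z.card * ∏ i ∈ Z, |x - (a i - t) / δ| := by
        rw [← Finset.prod_const, ← Finset.prod_mul_distrib]
        refine Finset.prod_congr rfl fun i _ => ?_
        rw [← abs_of_pos hδ, ← abs_mul, abs_of_pos hδ]
        congr 1
        field_simp
        ring
      rw [h2, div_pow, lt_div_iff₀ (by positivity), mul_assoc] at h1
      have h3 := lt_of_mul_lt_mul_left (h1.trans_eq (mul_one _).symm) (by positivity)
      rw [hP, Polynomial.eval_mul, Polynomial.eval_C, Polynomial.eval_prod, abs_mul,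
        abs_of_pos (by positivity), Finset.abs_prod, mul_comm]
      simpa using h3.le)
  rw [hlead] at hle
  rcases Nat.eq_zero_or_pos Z.card with h0 | h0
  · have := h t (by simpa using hδ.le)
    rw [Finset.card_eq_zero] at h0
    simp [h0] at this
  · have : (2 : ℝ) ^ (Z.card - 1) < 2 ^ Z.card := pow_lt_pow_right₀ (by norm_num) (by omega)
    linarith

lemma eventually_exists_good_height (hRH : RiemannHypothesis)
    (hsimple : ∀ ρ : ℂ, riemannZeta ρ = 0 → deriv riemannZeta ρ ≠ 0) {ε : ℝ} (hε : 0 < ε) :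
    ∀ᶠ T : ℝ in atTop, ∃ T' ∈ Icc (T - 1) T, ∀ x ∈ Icc (1 / 2 : ℝ) 2,
      T ^ (-ε) ≤ ‖riemannZeta (x + T' * I)‖ := by
  set e := ε / 28 with he
  have he0 : 0 < e := by positivity
  obtain ⟨δ₀, hδ₀, hδ₀8, hup⟩ := eventually_riemannZeta_le hRH he0
  set δ := δ₀ / 8 with hδ
  have hδ0 : 0 < δ := by positivity
  have hδ1 : δ ≤ 1 / 64 := by linarith
  obtain ⟨T1, hT1⟩ := eventually_atTop.1 hup
  obtain ⟨T2, hT2⟩ := eventually_atTop.1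
    (eventually_riemannZeta_bounds hRH (δ := δ) (ε := e) hδ0 (by linarith) he0)
  filter_upwards [eventually_ge_atTop (T1 + 2), eventually_ge_atTop (T2 + 2),
    eventually_ge_atTop 4] with T hTT1 hTT2 hT4
  have hT0 : 0 < T := by linarith
  have hlog : 0 < Real.log T := Real.log_pos (by linarith)
  set T0 := T - 1 / 2 with hT0def
  set c : ℂ := ((1 / 2 + δ : ℝ) : ℂ) + T0 * I with hc
  have hcre : c.re = 1 / 2 + δ := by simp [hc]
  have hcim : c.im = T0 := by simp [hc]
  have hcoord : ∀ z : ℂ, |z.re - (1 / 2 + δ)| ≤ ‖z - c‖ ∧ |z.im - T0| ≤ ‖z - c‖ := by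
    intro z
    have h1 := abs_re_le_norm (z - c)
    have h2 := abs_im_le_norm (z - c)
    rw [sub_re, hcre] at h1
    rw [sub_im, hcim] at h2
    exact ⟨h1, h2⟩
  have hball : ∀ z ∈ closedBall c δ₀, z.re ∈ Icc (1 / 2 - δ₀) 2 ∧ z.im ∈ Icc (T - 1) T := by
    intro z hz
    rw [mem_closedBall, dist_eq_norm] at hz
    obtain ⟨h1, h2⟩ := hcoord z
    rw [abs_le] at h1 h2
    refine ⟨⟨?_, ?_⟩, ?_, ?_⟩ <;> linarith
  have hlow : ∀ t ∈ Icc (T - 1) T, ∀ x ∈ Icc (1 / 2 + δ) 2,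
      T ^ (-e) ≤ ‖riemannZeta (x + t * I)‖ := by
    intro t ht x hx
    refine le_trans ?_ (hT2 t (by linarith [ht.1]) x hx).2
    exact Real.rpow_le_rpow_of_nonpos (by linarith [ht.1]) ht.2 (by linarith)
  have hcl : T ^ (-e) ≤ ‖riemannZeta c‖ :=
    hlow T0 ⟨by linarith, by linarith⟩ (1 / 2 + δ) ⟨le_rfl, by linarith⟩
  have hcpos : 0 < ‖riemannZeta c‖ := lt_of_lt_of_le (by positivity) hcl
  set M := 3 * e * Real.log T with hM
  have hMpos : 0 < M := by positivity
  have hexpM : ∀ k : ℝ, Real.exp (k * M) = T ^ (k * 3 * e) := by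
    intro k; rw [Real.rpow_def_of_pos hT0, hM]; ring_nf
  have hfin := (isCompact_closedBall c (δ₀ / 3)).inter_riemannZetaZeros_finite
  set Z := hfin.toFinset with hZ
  have hZmem : ∀ s, s ∈ Z ↔ s ∈ closedBall c (δ₀ / 3) ∧ riemannZeta s = 0 := by
    intro s
    rw [hZ, Set.Finite.mem_toFinset]
    rfl
  have hsub3 : closedBall c (δ₀ / 3) ⊆ closedBall c δ₀ := closedBall_subset_closedBall (by linarith)
  obtain ⟨hcard, hprod⟩ := zeros_and_lower_bound (U := {s : ℂ | 0 < s.im}) (f := riemannZeta)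
    (c := c) (R := δ₀) (M := M) (isOpen_lt continuous_const continuous_im) hδ₀ hMpos
    (fun z hz => (differentiableAt_riemannZeta
      (ne_one_of_im_ne_zero (ne_of_gt hz))).differentiableWithinAt)
    (fun z hz => by
      have := (hball z hz).2.1
      exact show 0 < z.im by linarith)
    (norm_pos_iff.1 hcpos)
    (fun z hz => by
      obtain ⟨h1, h2⟩ := hball z hz
      have h3 := hT1 z.im (by linarith [h2.1]) z.re h1
      rw [re_add_im] at h3
      calc ‖riemannZeta z‖ ≤ z.im ^ e := h3
        _ ≤ T ^ e := Real.rpow_le_rpow (by linarith [h2.1]) h2.2 he0.le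
        _ ≤ T ^ (3 * e + -e) := Real.rpow_le_rpow_of_exponent_le (by linarith) (by linarith)
        _ = Real.exp M * T ^ (-e) := by
          rw [Real.rpow_add hT0, ← one_mul M, hexpM, one_mul]
        _ ≤ _ := by gcongr)
    Z (fun s hs => by rw [hZmem]; simp [hs]) (fun ρ hρ => ((hZmem ρ).1 hρ).1)
    (fun ρ hρ => hsimple ρ ((hZmem ρ).1 hρ).2)
  obtain ⟨T', hT', hT'prod⟩ := exists_prod_abs_sub_ge Z (fun ρ => ρ.im) T0 hδ0
  rw [abs_le] at hT'
  have hT'mem : T' ∈ Icc (T - 1) T := ⟨by linarith, by linarith⟩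
  refine ⟨T', hT'mem, fun x hx => ?_⟩
  by_cases hx1 : 1 / 2 + δ ≤ x
  · refine le_trans ?_ (hlow T' hT'mem x ⟨hx1, hx.2⟩)
    exact Real.rpow_le_rpow_of_exponent_le (by linarith) (by linarith)
  push Not at hx1
  set s : ℂ := x + T' * I with hs
  have hsball : s ∈ closedBall c (δ₀ / 4) := by
    rw [mem_closedBall, dist_eq_norm]
    refine (norm_le_abs_re_add_abs_im _).trans ?_
    have e1 : (s - c).re = x - (1 / 2 + δ) := by simp [hs, hc]
    have e2 : (s - c).im = T' - T0 := by simp [hs, hc]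
    rw [e1, e2]
    have h1 : |x - (1 / 2 + δ)| ≤ δ := abs_le.2 ⟨by linarith [hx.1], by linarith⟩
    have h2 : |T' - T0| ≤ δ := abs_le.2 hT'
    linarith
  refine le_trans ?_ (hprod s hsball)
  have hP : T ^ (-(9 * e)) ≤ ∏ ρ ∈ Z, (‖s - ρ‖ / ‖c - ρ‖) := by
    have h1 : ∏ ρ ∈ Z, (|T' - ρ.im| / (8 * δ / 3)) ≤ ∏ ρ ∈ Z, (‖s - ρ‖ / ‖c - ρ‖) := by
      refine Finset.prod_le_prod (fun ρ _ => by positivity) fun ρ hρ => ?_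
      have h2 := ((hZmem ρ).1 hρ)
      have h3 : 0 < ‖c - ρ‖ := by
        rw [norm_pos_iff, sub_ne_zero]
        rintro h
        rw [h] at hcpos
        simp [h2.2] at hcpos
      have h4 : ‖c - ρ‖ ≤ 8 * δ / 3 := by
        have := h2.1
        rw [mem_closedBall, dist_comm, dist_eq_norm] at this
        linarith
      have h5 : |T' - ρ.im| ≤ ‖s - ρ‖ := by
        have := abs_im_le_norm (s - ρ)
        rwa [sub_im, show s.im = T' by simp [hs]] at this
      gcongr
    refine le_trans ?_ h1
    rw [Finset.prod_div_distrib, Finset.prod_const]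
    have h6 : (1 / 8 : ℝ) ^ Z.card ≤ (δ / 2) ^ Z.card / (8 * δ / 3) ^ Z.card := by
      rw [← div_pow]
      refine pow_le_pow_left₀ (by norm_num) ?_ _
      rw [le_div_iff₀ (by positivity)]
      linarith
    have h7 : T ^ (-(9 * e)) ≤ (1 / 8 : ℝ) ^ Z.card := by
      rw [Real.rpow_neg hT0.le, one_div, inv_pow]
      refine inv_anti₀ (by positivity) ?_
      calc (8 : ℝ) ^ Z.card = (2 ^ Z.card) ^ 3 := by
            rw [← pow_mul, mul_comm, pow_mul]; norm_num
        _ ≤ Real.exp M ^ 3 := by gcongr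
        _ = T ^ (9 * e) := by
          rw [← Real.exp_nat_mul, hexpM]; push_cast; ring_nf
    refine (h7.trans h6).trans ?_
    gcongr
  calc T ^ (-ε) = T ^ (-e) * T ^ (-6 * 3 * e) * T ^ (-(9 * e)) := by
        rw [← Real.rpow_add hT0, ← Real.rpow_add hT0]
        congr 1
        rw [he]; ring
    _ ≤ _ := by
      rw [← hexpM, neg_mul]
      gcongr

lemma eventually_norm_deriv_riemannZeta_le (hRH : RiemannHypothesis) {ε : ℝ} (hε : 0 < ε) :
    ∀ᶠ t : ℝ in atTop, ∀ x ∈ Icc (1 / 2 : ℝ) (3 / 2),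
      ‖deriv riemannZeta (x + t * I)‖ ≤ t ^ ε := by
  obtain ⟨δ, hδ, hδ8, h⟩ := eventually_riemannZeta_le hRH (half_pos hε)
  obtain ⟨T, hT⟩ := eventually_atTop.1 h
  filter_upwards [eventually_ge_atTop (T + 1), eventually_ge_atTop 2,
    eventually_mul_rpow_le (2 ^ (ε / 2) / δ) (ε / 2) (half_lt_self hε)] with t ht ht2 hA x hx
  have hbd : ∀ z ∈ sphere ((x : ℂ) + t * I) δ, ‖riemannZeta z‖ ≤ (2 * t) ^ (ε / 2) := by
    intro z hz
    rw [mem_sphere, dist_eq_norm] at hz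
    have h1 := (abs_re_le_norm (z - (x + t * I))).trans hz.le
    have h2 := (abs_im_le_norm (z - (x + t * I))).trans hz.le
    simp only [sub_re, add_re, ofReal_re, mul_re, I_re, mul_zero, ofReal_im, I_im, mul_one,
      sub_self, add_zero, sub_im, add_im, mul_im, zero_add] at h1 h2
    rw [abs_le] at h1 h2
    have h3 := hT z.im (by linarith) z.re ⟨by linarith [hx.1], by linarith [hx.2]⟩
    rw [re_add_im] at h3
    exact h3.trans (Real.rpow_le_rpow (by linarith) (by linarith) (by linarith))
  have hdiff : DiffContOnCl ℂ riemannZeta (ball ((x : ℂ) + t * I) δ) := by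
    refine (DifferentiableOn.diffContOnCl fun z hz => ?_)
    refine (differentiableAt_riemannZeta ?_).differentiableWithinAt
    rintro rfl
    have hz' := closure_ball_subset_closedBall hz
    rw [mem_closedBall, dist_eq_norm] at hz'
    have h2 := (abs_im_le_norm (1 - (x + t * I))).trans hz'
    simp at h2
    rw [abs_le] at h2
    linarith
  refine (norm_deriv_le_of_forall_mem_sphere_norm_le hδ hdiff hbd).trans ?_
  rw [Real.mul_rpow (by norm_num) (by linarith), mul_div_right_comm]
  exact hA

lemma deriv_riemannZeta_conj (s : ℂ) :
    deriv riemannZeta (conj s) = conj (deriv riemannZeta s) := by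
  have : riemannZeta = fun z => conj (riemannZeta (conj z)) := by
    funext z; rw [riemannZeta_conj]; simp
  conv_lhs => rw [this]
  have := congrFun (deriv_conj_conj (𝕜 := ℂ) (f := riemannZeta)) (conj s)
  simpa [Function.comp_def] using this

lemma logDeriv_riemannZeta_reflect {w : ℂ} (hw : w.im ≠ 0) (h0 : riemannZeta w ≠ 0) :
    deriv riemannZeta (1 - conj w) / riemannZeta (1 - conj w) =
      -conj (deriv chi w / chi w + deriv riemannZeta w / riemannZeta w) := by
  have h1 : HasDerivAt (fun z => riemannZeta (1 - z)) (-deriv riemannZeta (1 - w)) w := by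
    have h := (differentiableAt_riemannZeta (s := 1 - w) (ne_one_of_im_ne_zero (by simpa using hw)))
    have := h.hasDerivAt.comp w ((hasDerivAt_id w).const_sub 1)
    exact this.congr_deriv (by simp)
  have h2 : HasDerivAt (fun z => chi z * riemannZeta z)
      (deriv chi w * riemannZeta w + chi w * deriv riemannZeta w) w :=
    (differentiableAt_chi hw).hasDerivAt.mul
      (differentiableAt_riemannZeta (ne_one_of_im_ne_zero hw)).hasDerivAt
  have h3 : (fun z => riemannZeta (1 - z)) =ᶠ[𝓝 w] fun z => chi z * riemannZeta z := by
    filter_upwards [continuous_im.continuousAt.eventually_ne hw] with z hz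
    exact riemannZeta_one_sub_eq_chi hz
  have h4 := h1.unique (h2.congr_of_eventuallyEq h3)
  have h5 : (1 : ℂ) - conj w = conj (1 - w) := by simp
  rw [h5, deriv_riemannZeta_conj, riemannZeta_conj, ← map_div₀, ← map_neg,
    riemannZeta_one_sub_eq_chi hw, ← neg_neg (deriv riemannZeta (1 - w)), h4]
  congr 1
  have := chi_ne_zero hw
  field_simp

/-- A horizontal line which avoids the zeros of zeta by a wide margin. -/
def IsGoodHeight (η B t : ℝ) : Prop :=
  ∀ x ∈ Icc (-η) (1 + η), riemannZeta (x + t * I) ≠ 0 ∧ ‖riemannZeta (x + t * I)‖⁻¹ ≤ B ∧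
    ‖deriv riemannZeta (x + t * I) / riemannZeta (x + t * I)‖ ≤ B

lemma eventually_exists_isGoodHeight (hRH : RiemannHypothesis)
    (hsimple : ∀ ρ : ℂ, riemannZeta ρ = 0 → deriv riemannZeta ρ ≠ 0) {η ε : ℝ}
    (hη4 : η ≤ 1 / 4) (hε : 0 < ε) :
    ∀ᶠ T : ℝ in atTop, ∃ T' ∈ Icc (T - 1) T, IsGoodHeight η (T ^ ε) T' := by
  obtain ⟨C, hC1, hC⟩ := exists_le_norm_chi
  obtain ⟨D, hD0, hD⟩ := exists_norm_logDeriv_chi_sub_log_le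
  obtain ⟨T₀, hT₀⟩ := eventually_atTop.1
    (eventually_norm_deriv_riemannZeta_le hRH (show 0 < ε / 4 by positivity))
  have hlog : ∀ᶠ T : ℝ in atTop, Real.log T ≤ T ^ (ε / 2) := by
    have := (isLittleO_log_rpow_atTop (half_pos hε)).bound one_pos
    filter_upwards [this, eventually_ge_atTop 1] with T hT h1
    rw [one_mul, Real.norm_of_nonneg (Real.log_nonneg h1),
      Real.norm_of_nonneg (by positivity)] at hT
    exact hT
  filter_upwards [eventually_exists_good_height hRH hsimple (show 0 < ε / 4 by positivity), hlog,
    eventually_mul_rpow_le C (ε / 4) (show ε / 4 < ε by linarith),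
    eventually_mul_rpow_le (2 + D) (ε / 2) (show ε / 2 < ε by linarith),
    eventually_ge_atTop (T₀ + 1), eventually_ge_atTop 18] with T hgood hL hCT hDT hTT h18
  obtain ⟨T', hT', h⟩ := hgood
  refine ⟨T', hT', ?_⟩
  have hT'1 : 1 ≤ T' := by linarith [hT'.1]
  have hT0 : 0 < T := by linarith
  have hT1 : 1 ≤ T := by linarith
  have hright : ∀ x ∈ Icc (1 / 2 : ℝ) (1 + η), riemannZeta (x + T' * I) ≠ 0 ∧
      ‖riemannZeta (x + T' * I)‖⁻¹ ≤ T ^ (ε / 4) ∧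
      ‖deriv riemannZeta (x + T' * I) / riemannZeta (x + T' * I)‖ ≤ T ^ (ε / 2) := by
    intro x hx
    have h1 := h x ⟨hx.1, by linarith [hx.2]⟩
    have h2 : 0 < T ^ (-(ε / 4)) := by positivity
    have h3 : ‖riemannZeta (x + T' * I)‖⁻¹ ≤ T ^ (ε / 4) := by
      rw [Real.rpow_neg hT0.le] at h1
      exact inv_le_of_inv_le₀ (by positivity) h1
    refine ⟨norm_pos_iff.1 (h2.trans_le h1), h3, ?_⟩
    rw [norm_div, div_eq_mul_inv]
    have h4 := hT₀ T' (by linarith [hT'.1]) x ⟨hx.1, by linarith [hx.2]⟩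
    have h5 : T' ^ (ε / 4) ≤ T ^ (ε / 4) :=
      Real.rpow_le_rpow (by linarith) hT'.2 (by positivity)
    calc _ ≤ T ^ (ε / 4) * T ^ (ε / 4) :=
          mul_le_mul (h4.trans h5) h3 (by positivity) (by positivity)
      _ = T ^ (ε / 2) := by rw [← Real.rpow_add hT0]; ring_nf
  intro x hx
  rcases le_total (1 / 2) x with hx2 | hx2
  · obtain ⟨h1, h2, h3⟩ := hright x ⟨hx2, hx.2⟩
    exact ⟨h1, h2.trans (Real.rpow_le_rpow_of_exponent_le hT1 (by linarith)),
      h3.trans (Real.rpow_le_rpow_of_exponent_le hT1 (by linarith))⟩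
  · obtain ⟨h1, h2, h3⟩ := hright (1 - x) ⟨by linarith, by linarith [hx.1]⟩
    have him : (((1 - x : ℝ) : ℂ) + T' * I).im ≠ 0 := by simp; linarith
    have hTn : T' ≠ 0 := by linarith
    have hre := norm_riemannZeta_reflect (1 - x) hTn
    rw [sub_sub_cancel] at hre
    have hchi := (hC (1 - x) T' ⟨by linarith, by linarith [hx.1]⟩ (by linarith [hT'.1])).2
    have hchi1 : 1 ≤ C * ‖chi (((1 - x : ℝ) : ℂ) + T' * I)‖ :=
      (Real.one_le_rpow hT'1 (by linarith)).trans hchi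
    have hchi2 : ‖chi (((1 - x : ℝ) : ℂ) + T' * I)‖⁻¹ ≤ C := by
      have : 0 < ‖chi (((1 - x : ℝ) : ℂ) + T' * I)‖ := norm_pos_iff.2 (chi_ne_zero him)
      rw [inv_le_iff_one_le_mul₀ this]; exact hchi1
    refine ⟨?_, ?_, ?_⟩
    · rw [← norm_pos_iff, hre]
      have := chi_ne_zero him
      positivity
    · rw [hre, mul_inv]
      refine le_trans ?_ hCT
      exact mul_le_mul hchi2 h2 (by positivity) (by linarith)
    · have h4 := logDeriv_riemannZeta_reflect him h1
      have h5 : 1 - conj (((1 - x : ℝ) : ℂ) + T' * I) = x + T' * I := by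
        simp only [map_add, map_mul, conj_ofReal, conj_I]; push_cast; ring
      rw [h5] at h4
      rw [h4, norm_neg, RCLike.norm_conj]
      have h6 := hD (1 - x) T' ⟨by linarith, by linarith [hx.1]⟩ (by linarith [hT'.1])
      have h7 := norm_le_insert' (deriv chi (((1 - x : ℝ) : ℂ) + T' * I) /
        chi (((1 - x : ℝ) : ℂ) + T' * I)) (Real.log T' : ℂ)
      have h8 : ‖(Real.log T' : ℂ)‖ ≤ T ^ (ε / 2) := by
        rw [Complex.norm_real, Real.norm_of_nonneg (Real.log_nonneg hT'1)]
        exact (Real.log_le_log (by linarith) hT'.2).trans hL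
      have h9 : 1 ≤ T ^ (ε / 2) := Real.one_le_rpow hT1 (by linarith)
      refine (norm_add_le _ _).trans (le_trans ?_ hDT)
      nlinarith

lemma norm_integral_exp_I_mul_le {L : ℝ} (hL : L ≠ 0) (u v : ℝ) :
    ‖∫ y in u..v, exp (L * I * y)‖ ≤ 2 / |L| := by
  have hc : (L * I : ℂ) ≠ 0 := mul_ne_zero (ofReal_ne_zero.2 hL) I_ne_zero
  have hn : ∀ y : ℝ, ‖exp (L * I * y)‖ = 1 := by
    intro y
    rw [norm_exp]
    simp
  rw [integral_exp_mul_complex hc, norm_div, norm_mul, norm_I, mul_one, norm_real, Real.norm_eq_abs]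
  gcongr
  refine (norm_sub_le _ _).trans ?_
  rw [hn, hn]
  norm_num

lemma inv_abs_log_sub_log_le {a n : ℝ} (ha : 0 < a) (hn : 0 < n) (h : a ≠ n) :
    1 / |Real.log n - Real.log a| ≤ 1 + n / |a - n| := by
  rcases lt_or_gt_of_ne h with h | h
  · have h1 := Real.one_sub_inv_le_log_of_pos (div_pos hn ha)
    rw [Real.log_div hn.ne' ha.ne', inv_div] at h1
    have h2 : (n - a) / n ≤ |Real.log n - Real.log a| := by
      refine le_trans (le_of_eq ?_) (h1.trans (le_abs_self _)); field_simp
    have h3 : 0 < (n - a) / n := div_pos (by linarith) hn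
    rw [abs_of_neg (by linarith : a - n < 0), neg_sub]
    refine (one_div_le_one_div_of_le h3 h2).trans ?_
    rw [one_div_div]
    linarith
  · have h1 := Real.one_sub_inv_le_log_of_pos (div_pos ha hn)
    rw [Real.log_div ha.ne' hn.ne', inv_div] at h1
    have h2 : (a - n) / a ≤ |Real.log n - Real.log a| := by
      rw [abs_sub_comm]
      refine le_trans (le_of_eq ?_) (h1.trans (le_abs_self _)); field_simp
    have h3 : 0 < (a - n) / a := div_pos (by linarith) ha
    rw [abs_of_pos (by linarith : 0 < a - n)]
    refine (one_div_le_one_div_of_le h3 h2).trans (le_of_eq ?_)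
    rw [one_div_div]
    have : a - n ≠ 0 := by linarith
    field_simp
    ring

/-- The weight governing off-diagonal terms. -/
lemma rpow_mul_inv_log_le {a n : ℝ} (ha : 1 ≤ a) (hn : 1 ≤ n) (h : 1 ≤ |a - n|) {η : ℝ}
    (hη : 0 < η) :
    a ^ (-1 - η / 2) * (1 + n / |a - n|) ≤
      n ^ (η / 2) * (2 * a ^ (-1 - η / 2) + |a - n| ^ (-1 - η / 2)) := by
  have ha0 : 0 < a := by linarith
  have hn0 : 0 < n := by linarith
  have hd0 : 0 < |a - n| := by linarith
  have h1 : 1 ≤ n ^ (η / 2) := Real.one_le_rpow hn (by positivity)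
  have h2 : n / |a - n| ≤ a / |a - n| + 1 := by
    rw [div_add_one hd0.ne']
    gcongr
    have := neg_abs_le (a - n)
    linarith
  have h3 : a ^ (-1 - η / 2) * (a / |a - n|) ≤ n ^ (η / 2) * |a - n| ^ (-1 - η / 2) := by
    have e1 : a ^ (-1 - η / 2) * a = a ^ (-(η / 2)) := by
      rw [← Real.rpow_add_one ha0.ne']; ring_nf
    have e2 : |a - n| ^ (-1 - η / 2) = |a - n| ^ (-(η / 2)) / |a - n| := by
      rw [← Real.rpow_sub_one hd0.ne']; ring_nf
    rw [← mul_div_assoc, e1, e2, ← mul_div_assoc]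
    gcongr
    rw [Real.rpow_neg ha0.le, Real.rpow_neg hd0.le, ← div_eq_mul_inv, ← one_div,
      div_le_div_iff₀ (by positivity) (by positivity), one_mul, ← Real.mul_rpow hn0.le ha0.le]
    refine Real.rpow_le_rpow hd0.le ?_ (by positivity)
    rw [abs_le]
    constructor <;> nlinarith
  have h4 : 0 < a ^ (-1 - η / 2) := by positivity
  calc a ^ (-1 - η / 2) * (1 + n / |a - n|)
      ≤ a ^ (-1 - η / 2) * (1 + (a / |a - n| + 1)) := by gcongr
    _ = 2 * a ^ (-1 - η / 2) + a ^ (-1 - η / 2) * (a / |a - n|) := by ring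
    _ ≤ n ^ (η / 2) * (2 * a ^ (-1 - η / 2)) + n ^ (η / 2) * |a - n| ^ (-1 - η / 2) :=
        add_le_add (le_mul_of_one_le_left (by positivity) h1) h3
    _ = _ := by ring

lemma natCast_cpow_eq_exp {n : ℕ} (hn : n ≠ 0) (s : ℂ) :
    (n : ℂ) ^ s = exp (Real.log n * s) := by
  rw [cpow_def_of_ne_zero (by exact_mod_cast hn), natCast_log]

lemma term_mul_cpow_eq (α : ℕ → ℂ) {a n : ℕ} (ha : a ≠ 0) (hn : n ≠ 0) (c y : ℝ) :
    LSeries.term α (c + y * I) a * (n : ℂ) ^ ((c - 1 : ℝ) + y * I : ℂ) =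
      α a * ((a : ℝ) ^ (-c) * (n : ℝ) ^ (c - 1) : ℝ) *
        exp ((Real.log n - Real.log a : ℝ) * I * y) := by
  have han : (0 : ℝ) < a := by positivity
  have hnn : (0 : ℝ) < n := by positivity
  rw [LSeries.term_of_ne_zero ha, natCast_cpow_eq_exp ha, natCast_cpow_eq_exp hn,
    Real.rpow_def_of_pos han, Real.rpow_def_of_pos hnn, div_eq_mul_inv, ← exp_neg]
  push_cast
  rw [mul_assoc, ← exp_add, ← exp_add, mul_assoc, ← exp_add]
  ring_nf

lemma exists_integral_LSeries_mul_cpow {η : ℝ} (hη : 0 < η) :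
    ∃ C : ℝ, 0 < C ∧ ∀ (α : ℕ → ℂ) (K : ℝ), (∀ a, a ≠ 0 → ‖α a‖ ≤ K * (a : ℝ) ^ (η / 2)) →
      ∀ (n : ℕ), n ≠ 0 → ∀ u v : ℝ, u ≤ v →
      ‖(∫ y in u..v, LSeries α ((1 + η : ℝ) + y * I) * (n : ℂ) ^ ((1 + η - 1 : ℝ) + y * I : ℂ)) -
        (v - u) * (α n / n)‖ ≤ C * K * (n : ℝ) ^ (2 * η) := by
  have hW : Summable fun k : ℤ => |(k : ℝ)| ^ (-(1 + η / 2)) :=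
    Real.summable_abs_int_rpow (by linarith)
  have hWn : Summable fun a : ℕ => (a : ℝ) ^ (-(1 + η / 2)) := by
    simpa [Function.comp_def] using hW.comp_injective Nat.cast_injective
  set W := ∑' k : ℤ, |(k : ℝ)| ^ (-(1 + η / 2)) with hWdef
  have hW0 : 0 ≤ W := tsum_nonneg fun k => by positivity
  refine ⟨6 * W + 1, by positivity, fun α K hα n hn u v huv => ?_⟩
  have hn1 : (1 : ℝ) ≤ n := by exact_mod_cast Nat.one_le_iff_ne_zero.2 hn
  have hn0 : (0 : ℝ) < n := by linarith
  have hK : 0 ≤ K := by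
    have := (norm_nonneg _).trans (hα 1 one_ne_zero)
    simpa using this
  set e : ℝ := -1 - η / 2 with he
  have hee : -(1 + η / 2) = e := by rw [he]; ring
  rw [hee] at hWn
  simp only [hee] at hW hWdef
  set F : ℕ → ℝ → ℂ := fun a y =>
    LSeries.term α ((1 + η : ℝ) + y * I) a * (n : ℂ) ^ ((1 + η - 1 : ℝ) + y * I : ℂ) with hF
  have hF0 : ∀ y, F 0 y = 0 := fun y => by simp [hF]
  have hFe : ∀ a, a ≠ 0 → ∀ y, F a y = α a * ((a : ℝ) ^ (-(1 + η)) * (n : ℝ) ^ (1 + η - 1) : ℝ) *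
        exp ((Real.log n - Real.log a : ℝ) * I * y) := fun a ha y => term_mul_cpow_eq α ha hn _ _
  have hcoef : ∀ a : ℕ, a ≠ 0 → ‖α a * ((a : ℝ) ^ (-(1 + η)) * (n : ℝ) ^ (1 + η - 1) : ℝ)‖ ≤
      K * (n : ℝ) ^ η * (a : ℝ) ^ e := by
    intro a ha
    have ha0 : (0 : ℝ) < a := by positivity
    rw [norm_mul, norm_real, Real.norm_of_nonneg (by positivity), add_sub_cancel_left]
    calc _ ≤ K * (a : ℝ) ^ (η / 2) * ((a : ℝ) ^ (-(1 + η)) * (n : ℝ) ^ η) := by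
          gcongr; exact hα a ha
      _ = K * (n : ℝ) ^ η * ((a : ℝ) ^ (η / 2) * (a : ℝ) ^ (-(1 + η))) := by ring
      _ = _ := by rw [← Real.rpow_add ha0, he]; ring_nf
  have hexp1 : ∀ L y : ℝ, ‖exp (L * I * y)‖ = 1 := by
    intro L y
    rw [norm_exp]
    simp
  have hFb : ∀ a y, ‖F a y‖ ≤ K * (n : ℝ) ^ η * (a : ℝ) ^ e := by
    intro a y
    rcases eq_or_ne a 0 with rfl | ha
    · rw [hF0, norm_zero]; positivity
    · rw [hFe a ha, norm_mul, hexp1, mul_one]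
      exact hcoef a ha
  have hFc : ∀ a, Continuous (F a) := by
    intro a
    rcases eq_or_ne a 0 with rfl | ha
    · simp only [funext hF0]; exact continuous_const
    · rw [funext (hFe a ha)]; fun_prop
  have hsumb : Summable fun a : ℕ => K * (n : ℝ) ^ η * (a : ℝ) ^ e := hWn.mul_left _
  have hsum : HasSum (fun a => ∫ y in u..v, F a y)
      (∫ y in u..v, LSeries α ((1 + η : ℝ) + y * I) * (n : ℂ) ^ ((1 + η - 1 : ℝ) + y * I : ℂ)) := by
    refine intervalIntegral.hasSum_integral_of_dominated_convergence
      (fun a _ => K * (n : ℝ) ^ η * (a : ℝ) ^ e) (fun a => (hFc a).aestronglyMeasurable)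
      (fun a => Eventually.of_forall fun y _ => hFb a y) (Eventually.of_forall fun _ _ => hsumb)
      intervalIntegrable_const (Eventually.of_forall fun y _ => ?_)
    have hs : Summable (fun a => F a y) := Summable.of_norm_bounded hsumb fun a => hFb a y
    rw [LSeries, ← tsum_mul_right]
    exact hs.hasSum
  have hdiag : ∫ y in u..v, F n y = (v - u) * (α n / n) := by
    have : ∀ y, F n y = α n / n := by
      intro y
      rw [hFe n hn, sub_self, ← Real.rpow_add hn0,
        show -(1 + η) + (1 + η - 1) = -1 by ring, Real.rpow_neg_one]
      simp
      rfl
    simp only [this, intervalIntegral.integral_const]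
    simp
  have hsub := hsum.sub (hasSum_ite_eq n (∫ y in u..v, F n y))
  rw [hdiag] at hsub
  set g : ℕ → ℝ := fun a => 2 * K * (n : ℝ) ^ η * ((n : ℝ) ^ (η / 2) *
    (2 * (a : ℝ) ^ e + |((a : ℤ) - (n : ℤ) : ℤ)| ^ e)) with hg
  have hinj : Function.Injective fun a : ℕ => (a : ℤ) - (n : ℤ) := fun a b h => by
    have : (a : ℤ) - n = b - n := h
    omega
  have hshift : Summable fun a : ℕ => (|(((a : ℤ) - (n : ℤ) : ℤ) : ℝ)|) ^ e :=
    hW.comp_injective hinj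
  have hgs : HasSum g (∑' a, g a) := by
    refine Summable.hasSum ?_
    simp only [hg, Int.cast_abs]
    exact (((hWn.mul_left 2).add hshift).mul_left _).mul_left _
  have hle := hsub.norm_le_of_bounded hgs (fun a => by
    rcases eq_or_ne a n with rfl | han
    · simp only [if_true, hdiag, sub_self, norm_zero, hg]
      positivity
    rw [if_neg han, sub_zero]
    rcases eq_or_ne a 0 with rfl | ha
    · simp only [hF0, intervalIntegral.integral_zero, norm_zero, hg]
      positivity
    have ha0 : (0 : ℝ) < a := by positivity
    have han' : (a : ℝ) ≠ n := by exact_mod_cast han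
    have ha1 : (1 : ℝ) ≤ a := by exact_mod_cast Nat.one_le_iff_ne_zero.2 ha
    have hd : (1 : ℝ) ≤ |(a : ℝ) - n| := by
      have h : (a : ℤ) - n ≠ 0 := by omega
      have := Int.one_le_abs h
      exact_mod_cast this
    have hL : Real.log n - Real.log a ≠ 0 := by
      rw [sub_ne_zero]
      intro h
      exact han' (Real.log_injOn_pos (mem_Ioi.2 hn0) (mem_Ioi.2 ha0) h).symm
    simp only [hFe a ha, intervalIntegral.integral_const_mul]
    rw [norm_mul]
    calc _ ≤ (K * (n : ℝ) ^ η * (a : ℝ) ^ e) * (2 * (1 + n / |(a : ℝ) - n|)) := by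
          refine mul_le_mul (hcoef a ha) ?_ (norm_nonneg _) (by positivity)
          refine (norm_integral_exp_I_mul_le hL u v).trans ?_
          rw [div_eq_mul_one_div]
          gcongr
          exact inv_abs_log_sub_log_le ha0 hn0 han'
      _ = 2 * K * (n : ℝ) ^ η * ((a : ℝ) ^ e * (1 + n / |(a : ℝ) - n|)) := by ring
      _ ≤ _ := by
          simp only [hg]
          push_cast
          refine mul_le_mul_of_nonneg_left ?_ (by positivity)
          exact rpow_mul_inv_log_le ha1 hn1 hd hη)
  refine hle.trans ?_
  have hs1 : ∑' a : ℕ, (a : ℝ) ^ e ≤ W := by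
    have := tsum_comp_le_tsum_of_inj hW (fun k => by positivity) (Nat.cast_injective (R := ℤ))
    rw [hWdef]
    simpa [Function.comp_def] using this
  have hs2 : ∑' a : ℕ, (|(((a : ℤ) - (n : ℤ) : ℤ) : ℝ)|) ^ e ≤ W := by
    rw [hWdef]
    exact tsum_comp_le_tsum_of_inj hW (fun k => by positivity) hinj
  simp only [hg, Int.cast_abs]
  rw [tsum_mul_left, tsum_mul_left, (hWn.mul_left 2).tsum_add hshift, tsum_mul_left]
  calc _ ≤ 2 * K * (n : ℝ) ^ η * ((n : ℝ) ^ (η / 2) * (2 * W + W)) := by gcongr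
    _ = 6 * W * K * ((n : ℝ) ^ η * (n : ℝ) ^ (η / 2)) := by ring
    _ ≤ (6 * W + 1) * K * (n : ℝ) ^ (2 * η) := by
        rw [← Real.rpow_add hn0]
        gcongr
        · linarith
        · linarith

open ArithmeticFunction (moebius vonMangoldt)

/-- The Dirichlet polynomial `∑_{n ≤ N} μ(n) n^{-s}`. -/
noncomputable def mollifier (N : ℕ) (s : ℂ) : ℂ :=
  ∑ n ∈ Finset.Icc 1 N, (moebius n : ℂ) * (n : ℂ) ^ (-s)

/-- The coefficients of `mollifier N`. -/
noncomputable def moebiusTrunc (N n : ℕ) : ℂ := if n ∈ Finset.Icc 1 N then (moebius n : ℂ) else 0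

noncomputable def moebiusSqSum (N : ℕ) : ℝ := ∑ n ∈ Finset.Icc 1 N, (moebius n : ℝ) ^ 2 / n

noncomputable def moebiusSqLogSum (N : ℕ) : ℝ :=
  ∑ n ∈ Finset.Icc 1 N, (moebius n : ℝ) ^ 2 * Real.log n / n

lemma norm_moebius_le_one (n : ℕ) : ‖(moebius n : ℂ)‖ ≤ 1 := by
  rw [norm_intCast]
  exact_mod_cast ArithmeticFunction.abs_moebius_le_one

lemma norm_moebiusTrunc_le_one (N n : ℕ) : ‖moebiusTrunc N n‖ ≤ 1 := by
  unfold moebiusTrunc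
  split_ifs
  · exact norm_moebius_le_one n
  · simp

lemma mollifier_eq_LSeries (N : ℕ) (s : ℂ) : mollifier N s = LSeries (moebiusTrunc N) s := by
  rw [LSeries, tsum_eq_sum (s := Finset.Icc 1 N), mollifier]
  · refine Finset.sum_congr rfl fun n hn => ?_
    rw [LSeries.term_of_ne_zero (by have := (Finset.mem_Icc.1 hn).1; omega), moebiusTrunc,
      if_pos hn,
      cpow_neg, div_eq_mul_inv]
  · intro n hn
    rw [LSeries.term_def, moebiusTrunc, if_neg hn]
    simp

lemma moebiusTrunc_summable (N : ℕ) {s : ℂ} (hs : 1 < s.re) : LSeriesSummable (moebiusTrunc N) s :=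
  LSeriesSummable_of_bounded_of_one_lt_re (fun n _ => norm_moebiusTrunc_le_one N n) hs

lemma differentiable_mollifier (N : ℕ) : Differentiable ℂ (mollifier N) := by
  unfold mollifier
  refine Differentiable.fun_sum fun n hn => ?_
  have : (n : ℂ) ≠ 0 := by
    have := (Finset.mem_Icc.1 hn).1
    exact_mod_cast (by omega : n ≠ 0)
  exact (differentiable_id.neg.const_cpow (Or.inl this)).const_mul _

lemma mollifier_conj (N : ℕ) (s : ℂ) : mollifier N (conj s) = conj (mollifier N s) := by
  unfold mollifier
  rw [map_sum]
  refine Finset.sum_congr rfl fun n hn => ?_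
  have hn0 : n ≠ 0 := by have := (Finset.mem_Icc.1 hn).1; omega
  rw [map_mul, natCast_cpow_eq_exp hn0, natCast_cpow_eq_exp hn0, ← exp_conj]
  simp only [map_mul, map_neg, conj_ofReal, map_intCast]

lemma exists_norm_mollifier_le {η : ℝ} (hη : 0 < η) : ∃ C : ℝ, 0 < C ∧ ∀ N : ℕ, N ≠ 0 → ∀ s : ℂ,
    s.re ≤ 1 + η → ‖mollifier N s‖ ≤ C * (N : ℝ) ^ (1 + η - s.re) := by
  have hW : Summable fun a : ℕ => (a : ℝ) ^ (-(1 + η)) := Real.summable_nat_rpow.2 (by linarith)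
  refine ⟨∑' a : ℕ, (a : ℝ) ^ (-(1 + η)) + 1, by positivity, fun N hN s hs => ?_⟩
  have hN0 : (0 : ℝ) < N := by positivity
  calc ‖mollifier N s‖ ≤ ∑ n ∈ Finset.Icc 1 N, (n : ℝ) ^ (-(1 + η)) * (N : ℝ) ^ (1 + η - s.re) := by
        refine norm_sum_le_of_le _ fun n hn => ?_
        obtain ⟨h1, h2⟩ := Finset.mem_Icc.1 hn
        have hn0 : (0 : ℝ) < n := by exact_mod_cast h1
        rw [norm_mul, norm_natCast_cpow_of_pos h1]
        calc _ ≤ 1 * (n : ℝ) ^ (-s).re := by gcongr; exact norm_moebius_le_one n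
          _ = (n : ℝ) ^ (-(1 + η)) * (n : ℝ) ^ (1 + η - s.re) := by
            rw [one_mul, ← Real.rpow_add hn0, neg_re]; ring_nf
          _ ≤ _ := by
            gcongr
    _ = (∑ n ∈ Finset.Icc 1 N, (n : ℝ) ^ (-(1 + η))) * (N : ℝ) ^ (1 + η - s.re) := by
        rw [Finset.sum_mul]
    _ ≤ _ := by
        gcongr
        refine (hW.sum_le_tsum _ fun a _ => by positivity).trans ?_
        linarith

lemma vonMangoldt_mul_moebius (n : ℕ) :
    ∑ p ∈ n.divisorsAntidiagonal, vonMangoldt p.1 * (moebius p.2 : ℝ) =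
      -(moebius n * Real.log n) := by
  have h : ArithmeticFunction.pmul (moebius : ArithmeticFunction ℝ) ArithmeticFunction.log *
      (ArithmeticFunction.zeta : ArithmeticFunction ℝ) = -vonMangoldt := by
    ext n
    rw [ArithmeticFunction.coe_mul_zeta_apply]
    simp only [ArithmeticFunction.pmul_apply, ArithmeticFunction.intCoe_apply,
      ArithmeticFunction.sum_moebius_mul_log_eq]
    rfl
  have h2 : vonMangoldt * (moebius : ArithmeticFunction ℝ) =
      -ArithmeticFunction.pmul (moebius : ArithmeticFunction ℝ) ArithmeticFunction.log := by
    rw [← neg_eq_iff_eq_neg, ← neg_mul, ← h, mul_assoc,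
      ArithmeticFunction.coe_zeta_mul_coe_moebius, mul_one]
  have := congrArg (fun f : ArithmeticFunction ℝ => f n) h2
  simpa [ArithmeticFunction.mul_apply] using this

/-- The coefficients of `ζ'/ζ * mollifier N`. -/
noncomputable def logDerivCoeff (N n : ℕ) : ℂ :=
  -LSeries.convolution (fun n => (vonMangoldt n : ℂ)) (moebiusTrunc N) n

lemma logDerivCoeff_of_le {N n : ℕ} (hn : n ∈ Finset.Icc 1 N) :
    logDerivCoeff N n = (moebius n : ℂ) * (Real.log n : ℝ) := by
  have h := vonMangoldt_mul_moebius n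
  obtain ⟨h1, h2⟩ := Finset.mem_Icc.1 hn
  have e : ∑ p ∈ n.divisorsAntidiagonal, (vonMangoldt p.1 : ℂ) * moebiusTrunc N p.2 =
      ((∑ p ∈ n.divisorsAntidiagonal, vonMangoldt p.1 * (moebius p.2 : ℝ) : ℝ) : ℂ) := by
    push_cast
    refine Finset.sum_congr rfl fun p hp => ?_
    have hp2 : p.2 ∈ Finset.Icc 1 N := by
      have hd : p.2 ∣ n := Dvd.intro_left _ (Nat.mem_divisorsAntidiagonal.1 hp).1
      exact Finset.mem_Icc.2 ⟨Nat.pos_of_dvd_of_pos hd h1, (Nat.le_of_dvd h1 hd).trans h2⟩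
    rw [moebiusTrunc, if_pos hp2]
  rw [logDerivCoeff, LSeries.convolution_def]
  simp only
  rw [e, h]
  push_cast
  ring

lemma norm_logDerivCoeff_le (N n : ℕ) : ‖logDerivCoeff N n‖ ≤ Real.log n := by
  rw [logDerivCoeff, LSeries.convolution_def, norm_neg, ← ArithmeticFunction.vonMangoldt_sum,
    ← Nat.sum_divisorsAntidiagonal (fun i _ => vonMangoldt i)]
  refine norm_sum_le_of_le _ fun p _ => ?_
  rw [norm_mul, norm_real, Real.norm_of_nonneg ArithmeticFunction.vonMangoldt_nonneg]
  exact mul_le_of_le_one_right ArithmeticFunction.vonMangoldt_nonneg (norm_moebiusTrunc_le_one _ _)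

lemma LSeries_logDerivCoeff (N : ℕ) {s : ℂ} (hs : 1 < s.re) :
    LSeries (logDerivCoeff N) s = deriv riemannZeta s / riemannZeta s * mollifier N s := by
  have h1 := ArithmeticFunction.LSeriesSummable_vonMangoldt hs
  have e : logDerivCoeff N =
      -LSeries.convolution (fun n => (vonMangoldt n : ℂ)) (moebiusTrunc N) := rfl
  rw [e, LSeries_neg, LSeries_convolution' h1 (moebiusTrunc_summable N hs),
    ArithmeticFunction.LSeries_vonMangoldt_eq_deriv_riemannZeta_div hs, mollifier_eq_LSeries]
  ring

lemma continuous_LSeries_line {η K : ℝ} (hη : 0 < η) {α : ℕ → ℂ}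
    (hα : ∀ a, a ≠ 0 → ‖α a‖ ≤ K * (a : ℝ) ^ (η / 2)) :
    Continuous fun y : ℝ => LSeries α ((1 + η : ℝ) + y * I) := by
  have hW : Summable fun a : ℕ => K * (a : ℝ) ^ (-(1 + η / 2)) :=
    (Real.summable_nat_rpow.2 (by linarith)).mul_left K
  refine continuous_tsum (fun a => ?_) hW fun a y => ?_
  · rcases eq_or_ne a 0 with rfl | ha
    · simpa using continuous_const
    · have : (a : ℂ) ≠ 0 := by exact_mod_cast ha
      simp only [LSeries.term_of_ne_zero ha, natCast_cpow_eq_exp ha]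
      exact continuous_const.div (by fun_prop) fun y => exp_ne_zero _
  · rw [LSeries.norm_term_eq]
    rcases eq_or_ne a 0 with rfl | ha
    · rw [if_pos rfl, Nat.cast_zero, Real.zero_rpow (by linarith), mul_zero]
    · have ha0 : (0 : ℝ) < a := by positivity
      rw [if_neg ha, div_le_iff₀ (by positivity)]
      refine (hα a ha).trans (le_of_eq ?_)
      rw [mul_assoc, ← Real.rpow_add ha0]
      simp
      ring_nf
      simp

lemma exists_integral_LSeries_mul_mollifier {η : ℝ} (hη : 0 < η) :
    ∃ C : ℝ, 0 < C ∧ ∀ (α : ℕ → ℂ) (K : ℝ), (∀ a, a ≠ 0 → ‖α a‖ ≤ K * (a : ℝ) ^ (η / 2)) →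
      ∀ (N : ℕ), N ≠ 0 → ∀ u v : ℝ, u ≤ v →
      ‖(∫ y in u..v, LSeries α ((1 + η : ℝ) + y * I) * mollifier N (1 - ((1 + η : ℝ) + y * I))) -
        (v - u) * ∑ n ∈ Finset.Icc 1 N, (moebius n : ℂ) * (α n / n)‖ ≤
          C * K * (N : ℝ) ^ (1 + 2 * η) := by
  obtain ⟨C, hC, h⟩ := exists_integral_LSeries_mul_cpow hη
  refine ⟨C, hC, fun α K hα N hN u v huv => ?_⟩
  have hN0 : (0 : ℝ) < N := by positivity
  have hK : 0 ≤ K := by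
    have := (norm_nonneg _).trans (hα 1 one_ne_zero)
    simpa using this
  have hcont := continuous_LSeries_line hη hα
  have e : ∀ y : ℝ, LSeries α ((1 + η : ℝ) + y * I) * mollifier N (1 - ((1 + η : ℝ) + y * I)) =
      ∑ n ∈ Finset.Icc 1 N, (moebius n : ℂ) * (LSeries α ((1 + η : ℝ) + y * I) *
        (n : ℂ) ^ ((1 + η - 1 : ℝ) + y * I : ℂ)) := by
    intro y
    rw [mollifier, Finset.mul_sum]
    refine Finset.sum_congr rfl fun n _ => ?_
    rw [show -(1 - (((1 + η : ℝ) : ℂ) + y * I)) = ((1 + η - 1 : ℝ) : ℂ) + y * I by push_cast; ring]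
    ring
  simp only [e]
  rw [intervalIntegral.integral_finsetSum]
  · simp only [intervalIntegral.integral_const_mul]
    rw [Finset.mul_sum, ← Finset.sum_sub_distrib]
    calc _ ≤ ∑ n ∈ Finset.Icc 1 N, C * K * (N : ℝ) ^ (2 * η) := by
          refine norm_sum_le_of_le _ fun n hn => ?_
          obtain ⟨h1, h2⟩ := Finset.mem_Icc.1 hn
          have hn0 : n ≠ 0 := by omega
          have := h α K hα n hn0 u v huv
          rw [mul_left_comm ((v : ℂ) - u), ← mul_sub, norm_mul]
          refine (mul_le_of_le_one_left (norm_nonneg _) (norm_moebius_le_one n)).trans ?_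
          refine this.trans ?_
          gcongr
      _ = C * K * (N : ℝ) ^ (1 + 2 * η) := by
          rw [Finset.sum_const, Nat.card_Icc, nsmul_eq_mul, Real.rpow_add hN0, Real.rpow_one]
          simp
          ring
  · intro n hn
    have hn0 : n ≠ 0 := by have := (Finset.mem_Icc.1 hn).1; omega
    refine Continuous.intervalIntegrable ?_ _ _
    simp only [natCast_cpow_eq_exp hn0]
    fun_prop

/-- Mean values of the Dirichlet series and polynomials on the line `Re s = 1 + η`. -/
lemma exists_mean_value_bounds {η : ℝ} (hη : 0 < η) :
    ∃ C : ℝ, 0 < C ∧ ∀ (N : ℕ), N ≠ 0 → ∀ u v : ℝ, u ≤ v →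
      ‖(∫ y in u..v, mollifier N (1 - ((1 + η : ℝ) + y * I)) / riemannZeta ((1 + η : ℝ) + y * I)) -
        (v - u) * moebiusSqSum N‖ ≤ C * (N : ℝ) ^ (1 + 2 * η) ∧
      ‖(∫ y in u..v, mollifier N ((1 + η : ℝ) + y * I) *
        mollifier N (1 - ((1 + η : ℝ) + y * I))) -
        (v - u) * moebiusSqSum N‖ ≤ C * (N : ℝ) ^ (1 + 2 * η) ∧
      ‖(∫ y in u..v, deriv riemannZeta ((1 + η : ℝ) + y * I) / riemannZeta ((1 + η : ℝ) + y * I) *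
        (mollifier N ((1 + η : ℝ) + y * I) * mollifier N (1 - ((1 + η : ℝ) + y * I)))) -
        (v - u) * moebiusSqLogSum N‖ ≤ C * (N : ℝ) ^ (1 + 2 * η) := by
  obtain ⟨C, hC, h⟩ := exists_integral_LSeries_mul_mollifier hη
  have hre : ∀ y : ℝ, 1 < (((1 + η : ℝ) : ℂ) + y * I).re := fun y => by simp [hη]
  have hbd : ∀ f : ℕ → ℂ, (∀ a, ‖f a‖ ≤ 1) → ∀ a : ℕ, a ≠ 0 → ‖f a‖ ≤ 1 * (a : ℝ) ^ (η / 2) := by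
    intro f hf a ha
    rw [one_mul]
    refine (hf a).trans (Real.one_le_rpow ?_ (by positivity))
    exact_mod_cast Nat.one_le_iff_ne_zero.2 ha
  refine ⟨max C (C * (1 / (η / 2))), by positivity, fun N hN u v huv => ⟨?_, ?_, ?_⟩⟩
  · have h1 := h (fun n => (moebius n : ℂ)) 1 (hbd _ norm_moebius_le_one) N hN u v huv
    have e : ∀ y : ℝ, LSeries (fun n => (moebius n : ℂ)) ((1 + η : ℝ) + y * I) =
        (riemannZeta ((1 + η : ℝ) + y * I))⁻¹ := by
      intro y
      rw [eq_comm, inv_eq_iff_eq_inv, eq_comm]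
      refine inv_eq_of_mul_eq_one_left ?_
      rw [← ArithmeticFunction.LSeries_zeta_eq_riemannZeta (hre y)]
      exact ArithmeticFunction.LSeries_zeta_mul_Lseries_moebius (hre y)
    have e2 : ∑ n ∈ Finset.Icc 1 N, (moebius n : ℂ) * ((moebius n : ℂ) / n) = moebiusSqSum N := by
      rw [moebiusSqSum]
      push_cast
      exact Finset.sum_congr rfl fun n _ => by ring
    simp only [e, e2] at h1
    simp only [div_eq_inv_mul]
    refine h1.trans ?_
    rw [mul_one]
    gcongr
    exact le_max_left _ _
  · have h1 := h (moebiusTrunc N) 1 (hbd _ (norm_moebiusTrunc_le_one N)) N hN u v huv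
    have e2 : ∑ n ∈ Finset.Icc 1 N, (moebius n : ℂ) * (moebiusTrunc N n / n) = moebiusSqSum N := by
      rw [moebiusSqSum]
      push_cast
      exact Finset.sum_congr rfl fun n hn => by rw [moebiusTrunc, if_pos hn]; ring
    simp only [← mollifier_eq_LSeries, e2] at h1
    refine h1.trans ?_
    rw [mul_one]
    gcongr
    exact le_max_left _ _
  · have h1 := h (logDerivCoeff N) (1 / (η / 2)) (fun a _ => by
      refine (norm_logDerivCoeff_le N a).trans
        ((Real.log_le_rpow_div (Nat.cast_nonneg a) (half_pos hη)).trans (le_of_eq ?_))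
      ring) N hN u v huv
    have e2 : ∑ n ∈ Finset.Icc 1 N, (moebius n : ℂ) * (logDerivCoeff N n / n) =
        moebiusSqLogSum N := by
      rw [moebiusSqLogSum]
      push_cast
      exact Finset.sum_congr rfl fun n hn => by
        rw [logDerivCoeff_of_le hn]; push_cast; ring
    simp only [fun y : ℝ => LSeries_logDerivCoeff N (hre y), e2, mul_assoc] at h1
    refine h1.trans ?_
    rw [← mul_assoc]
    gcongr
    exact le_max_right _ _

lemma moebius_sq_eq_one {n : ℕ} (h : Squarefree n) : (moebius n : ℝ) ^ 2 = 1 := by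
  have := ArithmeticFunction.moebius_sq_eq_one_of_squarefree h
  exact_mod_cast this

lemma log_succ_le_sum_inv (N : ℕ) : Real.log (N + 1) ≤ ∑ n ∈ Finset.Icc 1 N, (1 : ℝ) / n := by
  have h := log_add_one_le_harmonic N
  rw [harmonic_eq_sum_Icc] at h
  push_cast at h
  simpa using h

lemma sum_inv_le_moebiusSqSum (N : ℕ) :
    ∑ n ∈ Finset.Icc 1 N, (1 : ℝ) / n ≤ Real.pi ^ 2 / 6 * moebiusSqSum N := by
  choose a b hab hsq using Nat.sq_mul_squarefree
  set φ : ℕ → ℕ × ℕ := fun n => (a n, b n) with hφ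
  set g : ℕ × ℕ → ℝ := fun p => (moebius p.1 : ℝ) ^ 2 / p.1 * (1 / (p.2 : ℝ) ^ 2) with hg
  have hinj : Set.InjOn φ (Finset.Icc 1 N : Finset ℕ) := by
    intro m _ n _ h
    simp only [hφ, Prod.mk.injEq] at h
    rw [← hab m, ← hab n, h.1, h.2]
  have hsub : (Finset.Icc 1 N).image φ ⊆ Finset.Icc 1 N ×ˢ Finset.Icc 1 N := by
    intro p hp
    obtain ⟨n, hn, rfl⟩ := Finset.mem_image.1 hp
    obtain ⟨h1, h2⟩ := Finset.mem_Icc.1 hn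
    have h3 := hab n
    have hb : 0 < b n := by
      rcases Nat.eq_zero_or_pos (b n) with h | h
      · rw [h] at h3; simp at h3; omega
      · exact h
    have ha : 0 < a n := by
      rcases Nat.eq_zero_or_pos (a n) with h | h
      · rw [h] at h3; simp at h3; omega
      · exact h
    have ha2 : a n ≤ n := by nlinarith [pow_pos hb 2]
    have hb2 : b n ≤ n := by nlinarith
    simp only [hφ, Finset.mem_product, Finset.mem_Icc]
    omega
  have hpi : ∑ n ∈ Finset.Icc 1 N, 1 / (n : ℝ) ^ 2 ≤ Real.pi ^ 2 / 6 :=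
    sum_le_hasSum _ (fun n _ => by positivity) hasSum_zeta_two
  calc ∑ n ∈ Finset.Icc 1 N, (1 : ℝ) / n = ∑ n ∈ Finset.Icc 1 N, g (φ n) := by
        refine Finset.sum_congr rfl fun n hn => ?_
        simp only [hg, hφ]
        rw [moebius_sq_eq_one (hsq n), div_mul_div_comm, mul_one]
        congr 1
        have := hab n
        rw [← this]
        push_cast
        rw [this]
        ring
    _ = ∑ p ∈ (Finset.Icc 1 N).image φ, g p := (Finset.sum_image hinj).symm
    _ ≤ ∑ p ∈ Finset.Icc 1 N ×ˢ Finset.Icc 1 N, g p :=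
        Finset.sum_le_sum_of_subset_of_nonneg hsub fun p _ _ => by positivity
    _ = moebiusSqSum N * ∑ n ∈ Finset.Icc 1 N, 1 / (n : ℝ) ^ 2 := by
        rw [Finset.sum_product, moebiusSqSum, Finset.sum_mul_sum]
    _ ≤ _ := by
        rw [mul_comm]
        refine mul_le_mul_of_nonneg_right hpi (Finset.sum_nonneg fun n _ => by positivity)

lemma log_succ_le_moebiusSqSum (N : ℕ) :
    6 / Real.pi ^ 2 * Real.log (N + 1) ≤ moebiusSqSum N := by
  have h := (log_succ_le_sum_inv N).trans (sum_inv_le_moebiusSqSum N)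
  have hpi : 0 < Real.pi ^ 2 := by positivity
  rw [div_mul_eq_mul_div, div_le_iff₀ hpi]
  linarith

lemma moebiusSqLogSum_le {N : ℕ} (hN : 1 ≤ N) :
    moebiusSqLogSum N + 3 / Real.pi ^ 2 * Real.log N ^ 2 ≤ moebiusSqSum N * Real.log N := by
  induction N, hN using Nat.le_induction with
  | base => simp [moebiusSqLogSum]
  | succ n hn ih =>
    have e1 : moebiusSqLogSum (n + 1) = moebiusSqLogSum n +
        (moebius (n + 1) : ℝ) ^ 2 * Real.log (n + 1 : ℕ) / (n + 1 : ℕ) := by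
      rw [moebiusSqLogSum, Finset.sum_Icc_succ_top (by omega), moebiusSqLogSum]
    have e2 : moebiusSqSum (n + 1) = moebiusSqSum n +
        (moebius (n + 1) : ℝ) ^ 2 / (n + 1 : ℕ) := by
      rw [moebiusSqSum, Finset.sum_Icc_succ_top (by omega), moebiusSqSum]
    have hQ := log_succ_le_moebiusSqSum n
    have hn0 : (0 : ℝ) < n := by exact_mod_cast hn
    have hl : Real.log n ≤ Real.log (n + 1) := Real.log_le_log hn0 (by linarith)
    rw [e1, e2]
    push_cast
    set l := Real.log n
    set l' := Real.log (n + 1 : ℝ)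
    have hpi : 0 < 3 / Real.pi ^ 2 := by positivity
    have h6 : 6 / Real.pi ^ 2 = 2 * (3 / Real.pi ^ 2) := by ring
    rw [h6] at hQ
    set k := 3 / Real.pi ^ 2
    have h7 : k * (l' + l) ≤ moebiusSqSum n := by nlinarith
    have h8 := mul_le_mul_of_nonneg_right h7 (sub_nonneg.2 hl)
    have h9 : (moebius (n + 1) : ℝ) ^ 2 * l' / (n + 1) =
        (moebius (n + 1) : ℝ) ^ 2 / (n + 1) * l' := by
      ring
    rw [h9]
    nlinarith

lemma norm_rectInt_sub_vertical_le {f : ℂ → ℂ} {a b u v B : ℝ} (hab : a ≤ b)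
    (hu : ∀ x ∈ Icc a b, ‖f (x + u * I)‖ ≤ B) (hv : ∀ x ∈ Icc a b, ‖f (x + v * I)‖ ≤ B) :
    ‖rectInt f a b u v - I * ((∫ y : ℝ in u..v, f (b + y * I)) - ∫ y : ℝ in u..v, f (a + y * I))‖ ≤
      2 * (b - a) * B := by
  have h : ∀ t : ℝ, (∀ x ∈ Icc a b, ‖f (x + t * I)‖ ≤ B) →
      ‖∫ x : ℝ in a..b, f (x + t * I)‖ ≤ B * (b - a) := by
    intro t ht
    have := intervalIntegral.norm_integral_le_of_norm_le_const (f := fun x : ℝ => f (x + t * I))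
      (a := a) (b := b) (C := B)
      fun x hx => ht x (Ioc_subset_Icc_self (by rwa [uIoc_of_le hab] at hx))
    rwa [abs_of_nonneg (sub_nonneg.2 hab)] at this
  have h1 : rectInt f a b u v - I * ((∫ y : ℝ in u..v, f (b + y * I)) -
      ∫ y : ℝ in u..v, f (a + y * I)) =
      (∫ x : ℝ in a..b, f (x + u * I)) - ∫ x : ℝ in a..b, f (x + v * I) := by
    rw [rectInt]; ring
  rw [h1]
  refine (norm_sub_le _ _).trans ?_
  linarith [h u hu, h v hv]

/-- `Z` is the set of zeros of zeta in the rectangle `[-η, 1 + η] × [u, v]`. -/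
structure IsZeroSet (η u v : ℝ) (Z : Finset ℂ) : Prop where
  mem_iff : ∀ s ∈ Icc (-η) (1 + η) ×ℂ Icc u v, riemannZeta s = 0 ↔ s ∈ Z
  zero : ∀ ρ ∈ Z, riemannZeta ρ = 0
  re_eq : ∀ ρ ∈ Z, ρ.re = 1 / 2
  im_mem : ∀ ρ ∈ Z, ρ.im ∈ Ioo u v

lemma exists_isZeroSet (hRH : RiemannHypothesis) {η u v B B' : ℝ} (hu : 0 < u)
    (hgu : IsGoodHeight η B u) (hgv : IsGoodHeight η B' v) :
    ∃ Z : Finset ℂ, IsZeroSet η u v Z := by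
  have hfin := ((isCompact_Icc (a := -η) (b := 1 + η)).reProdIm
    (isCompact_Icc (a := u) (b := v))).inter_riemannZetaZeros_finite
  have hmem : ∀ ρ, ρ ∈ hfin.toFinset ↔ ρ ∈ Icc (-η) (1 + η) ×ℂ Icc u v ∧ riemannZeta ρ = 0 := by
    intro ρ; simp [mem_riemannZetaZeros]
  refine ⟨hfin.toFinset, ⟨fun s hs => ?_, fun ρ hρ => ((hmem ρ).1 hρ).2, fun ρ hρ => ?_,
    fun ρ hρ => ?_⟩⟩
  · rw [hmem]; tauto
  all_goals
    obtain ⟨⟨h1, h2⟩, h3⟩ := (hmem ρ).1 hρ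
    simp only [mem_preimage] at h1 h2
    have him : ρ.im ≠ 0 := by linarith [h2.1]
    have hre := re_eq_half_of_zero hRH h3 him
  · exact hre
  · refine ⟨lt_of_le_of_ne h2.1 ?_, lt_of_le_of_ne h2.2 ?_⟩
    · intro h
      refine (hgu ρ.re h1).1 ?_
      rwa [h, re_add_im]
    · intro h
      refine (hgv ρ.re h1).1 ?_
      rwa [← h, re_add_im]

lemma IsZeroSet.rectInt_eq (hsimple : ∀ ρ : ℂ, riemannZeta ρ = 0 → deriv riemannZeta ρ ≠ 0)
    {η u v : ℝ} (hη : 0 < η) (hu : 0 < u) (huv : u ≤ v) {Z : Finset ℂ} (hZ : IsZeroSet η u v Z)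
    {h : ℂ → ℂ} (hh : DifferentiableOn ℂ h {1}ᶜ) :
    rectInt (fun s => h s / riemannZeta s) (-η) (1 + η) u v =
      2 * Real.pi * I * ∑ ρ ∈ Z, h ρ / deriv riemannZeta ρ := by
  refine rectInt_div_eq_sum (U := {1}ᶜ) isOpen_compl_singleton
    (fun s hs => (differentiableAt_riemannZeta hs).differentiableWithinAt) hh (by linarith) huv
    ?_ Z hZ.mem_iff ?_ fun ρ hρ => hsimple ρ (hZ.zero ρ hρ)
  · rintro s ⟨-, h2⟩ rfl
    simp only [mem_preimage, one_im] at h2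
    linarith [h2.1]
  · intro ρ hρ
    refine ⟨?_, hZ.im_mem ρ hρ⟩
    simp only [mem_preimage, hZ.re_eq ρ hρ]
    constructor <;> linarith

lemma exists_norm_inv_riemannZeta_le {η : ℝ} (hη : 0 < η) (hη4 : η ≤ 1 / 4) :
    ∃ C : ℝ, 0 < C ∧ ∀ y : ℝ, 17 ≤ y →
      riemannZeta ((-η : ℝ) + y * I) ≠ 0 ∧
      ‖riemannZeta ((-η : ℝ) + y * I)‖⁻¹ ≤ C * y ^ (-(1 / 2) : ℝ) := by
  obtain ⟨C, hC1, hC⟩ := exists_le_norm_chi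
  obtain ⟨K, hK1, hK⟩ := exists_riemannZeta_bounds (a := 1 + η) (by linarith)
  refine ⟨C * K, by positivity, fun y hy => ?_⟩
  have hy0 : 0 < y := by linarith
  have h1 := norm_riemannZeta_reflect (1 + η) hy0.ne'
  rw [show 1 - (1 + η) = -η by ring] at h1
  have h2 := (hC (1 + η) y ⟨by linarith, by linarith⟩ (by linarith)).2
  have h3 := (hK (((1 + η : ℝ) : ℂ) + y * I) (by simp)).2
  have h4 : y ^ (1 / 2 : ℝ) ≤ y ^ (1 + η - 1 / 2) :=
    Real.rpow_le_rpow_of_exponent_le (by linarith) (by linarith)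
  have h5 : 0 < y ^ (1 / 2 : ℝ) := by positivity
  have h6 : y ^ (1 / 2 : ℝ) ≤ (C * K) * ‖riemannZeta ((-η : ℝ) + y * I)‖ := by
    rw [h1]
    have := mul_le_mul (h4.trans h2) h3 zero_le_one (by positivity)
    linarith
  have h7 : 0 < ‖riemannZeta ((-η : ℝ) + y * I)‖ := by
    by_contra! h
    have : (C * K) * ‖riemannZeta ((-η : ℝ) + y * I)‖ ≤ 0 :=
      mul_nonpos_of_nonneg_of_nonpos (by positivity) h
    linarith
  refine ⟨norm_pos_iff.1 h7, ?_⟩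
  rw [Real.rpow_neg hy0.le, ← div_eq_mul_inv, inv_eq_one_div, div_le_div_iff₀ h7 h5]
  linarith

lemma integral_rpow_neg_half_le {u v : ℝ} (hu : 0 < u) :
    ∫ y in u..v, y ^ (-(1 / 2) : ℝ) ≤ 2 * v ^ (1 / 2 : ℝ) := by
  rw [integral_rpow (Or.inl (by norm_num))]
  have : 0 < u ^ (1 / 2 : ℝ) := by positivity
  norm_num
  norm_num at this
  linarith

lemma exists_norm_sum_mollifier_div_deriv_sub_le
    (hsimple : ∀ ρ : ℂ, riemannZeta ρ = 0 → deriv riemannZeta ρ ≠ 0)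
    {η : ℝ} (hη : 0 < η) (hη4 : η ≤ 1 / 4) :
    ∃ C : ℝ, 0 < C ∧ ∀ (N : ℕ), N ≠ 0 → ∀ (u v B : ℝ) (Z : Finset ℂ), 17 ≤ u → u ≤ v → 1 ≤ B →
      IsGoodHeight η B u → IsGoodHeight η B v → IsZeroSet η u v Z →
      ‖2 * Real.pi * ∑ ρ ∈ Z, mollifier N (1 - ρ) / deriv riemannZeta ρ -
        (v - u) * moebiusSqSum N‖ ≤ C * ((N : ℝ) ^ (1 + 2 * η) * B + v ^ (1 / 2 : ℝ)) := by
  obtain ⟨C₁, hC₁, hM⟩ := exists_norm_mollifier_le hη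
  obtain ⟨C₂, hC₂, hmean⟩ := exists_mean_value_bounds hη
  obtain ⟨C₃, hC₃, hleft⟩ := exists_norm_inv_riemannZeta_le hη hη4
  refine ⟨C₂ + 3 * C₁ + 2 * (C₁ * C₃), by positivity, ?_⟩
  intro N hN u v B Z hu huv hB hgu hgv hZ
  have hN0 : (0 : ℝ) < N := by positivity
  have hN1 : (1 : ℝ) ≤ N := by exact_mod_cast Nat.one_le_iff_ne_zero.2 hN
  set f : ℂ → ℂ := fun s => mollifier N (1 - s) / riemannZeta s with hf
  set W := (N : ℝ) ^ (1 + 2 * η) with hW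
  have hW0 : 0 < W := by positivity
  have hmol : Differentiable ℂ fun s => mollifier N (1 - s) :=
    (differentiable_mollifier N).comp (differentiable_id.const_sub 1)
  have hres : rectInt f (-η) (1 + η) u v = 2 * Real.pi * I *
      ∑ ρ ∈ Z, mollifier N (1 - ρ) / deriv riemannZeta ρ :=
    hZ.rectInt_eq hsimple hη (by linarith) huv hmol.differentiableOn
  have hhor : ∀ t, IsGoodHeight η B t → ∀ x ∈ Icc (-η) (1 + η), ‖f (x + t * I)‖ ≤ C₁ * W * B := by
    intro t ht x hx
    obtain ⟨-, h2, -⟩ := ht x hx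
    have h1 := hM N hN (1 - (x + t * I)) (by simp; linarith [hx.1])
    have h3 : (N : ℝ) ^ (1 + η - (1 - ((x : ℂ) + t * I)).re) ≤ W := by
      refine Real.rpow_le_rpow_of_exponent_le hN1 ?_
      simp; linarith [hx.2]
    rw [hf, norm_div, div_eq_mul_inv]
    exact mul_le_mul (h1.trans (mul_le_mul_of_nonneg_left h3 hC₁.le)) h2 (by positivity)
      (by positivity)
  have h1 := norm_rectInt_sub_vertical_le (by linarith) (hhor u hgu) (hhor v hgv)
  have h2 := (hmean N hN u v huv).1
  have h3 : ‖∫ y : ℝ in u..v, f ((-η : ℝ) + y * I)‖ ≤ 2 * (C₁ * C₃) * v ^ (1 / 2 : ℝ) := by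
    have hb : ∀ y ∈ Ioc u v, ‖f ((-η : ℝ) + y * I)‖ ≤ C₁ * C₃ * y ^ (-(1 / 2) : ℝ) := by
      intro y hy
      have h1 := hM N hN (1 - ((-η : ℝ) + y * I)) (by simp)
      have h4 : 1 + η - (1 - (((-η : ℝ) : ℂ) + y * I)).re = 0 := by simp
      rw [h4, Real.rpow_zero, mul_one] at h1
      rw [hf, norm_div, div_eq_mul_inv, mul_assoc]
      exact mul_le_mul h1 (hleft y (by linarith [hy.1])).2 (by positivity) hC₁.le
    have hInt : IntervalIntegrable (fun y : ℝ => C₁ * C₃ * y ^ (-(1 / 2) : ℝ)) volume u v :=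
      (intervalIntegrable_rpow (Or.inr (by
        rw [uIcc_of_le huv]; intro h; linarith [h.1]))).const_mul _
    refine (intervalIntegral.norm_integral_le_of_norm_le huv (ae_of_all _ hb) hInt).trans ?_
    rw [intervalIntegral.integral_const_mul]
    have := mul_le_mul_of_nonneg_left (integral_rpow_neg_half_le (v := v) (by linarith : 0 < u))
      (by positivity : 0 ≤ C₁ * C₃)
    linarith
  rw [hres] at h1
  set S := ∑ ρ ∈ Z, mollifier N (1 - ρ) / deriv riemannZeta ρ with hS
  set R := ∫ y : ℝ in u..v, f ((1 + η : ℝ) + y * I) with hR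
  set L := ∫ y : ℝ in u..v, f ((-η : ℝ) + y * I) with hL
  have h4 : 2 * Real.pi * S - (v - u) * moebiusSqSum N =
      (R - (v - u) * moebiusSqSum N) - L + (-I) * (2 * Real.pi * I * S - I * (R - L)) := by
    linear_combination (2 * Real.pi * S - R + L) * I_sq
  have h5 : ‖(-I) * (2 * Real.pi * I * S - I * (R - L))‖ ≤ 2 * (1 + η - -η) * (C₁ * W * B) := by
    rw [norm_mul, norm_neg, norm_I, one_mul]; exact h1
  rw [h4]
  have h6 : ‖R - (v - u) * moebiusSqSum N‖ ≤ C₂ * W := h2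
  have h7 : 2 * (1 + η - -η) * (C₁ * W * B) ≤ 3 * (C₁ * W * B) :=
    mul_le_mul_of_nonneg_right (by linarith) (by positivity)
  have h8 : C₂ * W ≤ C₂ * (W * B) :=
    mul_le_mul_of_nonneg_left (le_mul_of_one_le_right hW0.le hB) hC₂.le
  have h9 : 0 ≤ v ^ (1 / 2 : ℝ) := by apply Real.rpow_nonneg; linarith
  have h10 : 0 ≤ W * B := by positivity
  have h11 := (norm_add_le (R - (v - u) * moebiusSqSum N - L)
    ((-I) * (2 * Real.pi * I * S - I * (R - L)))).trans
    (add_le_add_left (norm_sub_le (R - (v - u) * moebiusSqSum N) L) _)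
  have e1 : (C₂ + 3 * C₁ + 2 * (C₁ * C₃)) * (W * B + v ^ (1 / 2 : ℝ)) =
    C₂ * (W * B) + 3 * (C₁ * W * B) + 2 * (C₁ * C₃) * v ^ (1 / 2 : ℝ) +
      (C₂ * v ^ (1 / 2 : ℝ) + 3 * C₁ * v ^ (1 / 2 : ℝ) + 2 * (C₁ * C₃) * (W * B)) := by ring
  rw [e1]
  have e2 : 0 ≤ C₂ * v ^ (1 / 2 : ℝ) + 3 * C₁ * v ^ (1 / 2 : ℝ) + 2 * (C₁ * C₃) * (W * B) := by
    positivity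
  linarith

/-- The mollifier times its reflection; it equals `‖mollifier N s‖ ^ 2` on the critical line. -/
noncomputable def mollifierSq (N : ℕ) (s : ℂ) : ℂ := mollifier N s * mollifier N (1 - s)

lemma differentiable_mollifierSq (N : ℕ) : Differentiable ℂ (mollifierSq N) :=
  (differentiable_mollifier N).mul
    ((differentiable_mollifier N).comp (differentiable_id.const_sub 1))

lemma mollifierSq_one_sub_conj (N : ℕ) (s : ℂ) :
    mollifierSq N (1 - conj s) = conj (mollifierSq N s) := by
  rw [mollifierSq, mollifierSq, sub_sub_cancel, map_mul, ← mollifier_conj, ← mollifier_conj,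
    map_sub, map_one, mul_comm]

lemma one_sub_eq_conj {s : ℂ} (hs : s.re = 1 / 2) : 1 - s = conj s := by
  apply Complex.ext
  · simp [hs]; norm_num
  · simp

lemma mollifierSq_eq_norm_sq (N : ℕ) {s : ℂ} (hs : s.re = 1 / 2) :
    mollifierSq N s = ((‖mollifier N s‖ ^ 2 : ℝ) : ℂ) := by
  rw [mollifierSq, one_sub_eq_conj hs, mollifier_conj, mul_conj, normSq_eq_norm_sq]

lemma exists_norm_mollifierSq_le {η : ℝ} (hη : 0 < η) : ∃ C : ℝ, 0 < C ∧ ∀ N : ℕ, N ≠ 0 →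
    ∀ s : ℂ, s.re ∈ Icc (-η) (1 + η) → ‖mollifierSq N s‖ ≤ C * (N : ℝ) ^ (1 + 2 * η) := by
  obtain ⟨C, hC, h⟩ := exists_norm_mollifier_le hη
  refine ⟨C * C, by positivity, fun N hN s hs => ?_⟩
  have hN0 : (0 : ℝ) < N := by positivity
  have h1 := h N hN s hs.2
  have h2 := h N hN (1 - s) (by rw [sub_re, one_re]; linarith [hs.1])
  rw [mollifierSq, norm_mul]
  refine (mul_le_mul h1 h2 (norm_nonneg _) (by positivity)).trans_eq ?_
  rw [mul_mul_mul_comm, ← Real.rpow_add hN0, sub_re, one_re]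
  ring_nf

/-- Comparison of the real parts of two vertical integrals of a holomorphic function. -/
lemma re_integral_le_of_rectInt_eq_zero {f : ℂ → ℂ} {a b u v B : ℝ} (hab : a ≤ b)
    (h0 : rectInt f a b u v = 0)
    (hu : ∀ x ∈ Icc a b, ‖f (x + u * I)‖ ≤ B) (hv : ∀ x ∈ Icc a b, ‖f (x + v * I)‖ ≤ B) :
    |(∫ y : ℝ in u..v, f (b + y * I)).re - (∫ y : ℝ in u..v, f (a + y * I)).re| ≤
      2 * (b - a) * B := by
  have h := norm_rectInt_sub_vertical_le hab hu hv
  rw [h0, zero_sub, norm_neg, norm_mul, norm_I, one_mul] at h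
  rw [← sub_re]
  exact (abs_re_le_norm _).trans h

lemma differentiableAt_deriv_chi_div {s : ℂ} (hs : s.im ≠ 0) :
    DifferentiableAt ℂ (fun z => deriv chi z / chi z) s := by
  have hopen : IsOpen {z : ℂ | z.im ≠ 0} := isOpen_ne_fun continuous_im continuous_const
  have h : DifferentiableOn ℂ chi {z : ℂ | z.im ≠ 0} :=
    fun z hz => (differentiableAt_chi hz).differentiableWithinAt
  exact ((h.deriv hopen).differentiableAt (hopen.mem_nhds hs)).div (differentiableAt_chi hs)
    (chi_ne_zero hs)

lemma continuous_vertical {f : ℂ → ℂ} (hf : Differentiable ℂ f) (a : ℝ) :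
    Continuous fun y : ℝ => f (a + y * I) :=
  hf.continuous.comp (by fun_prop)

lemma continuousOn_deriv_chi_div (a : ℝ) {u v : ℝ} (hu : 0 < u) :
    ContinuousOn (fun y : ℝ => deriv chi (a + y * I) / chi (a + y * I)) (Icc u v) := by
  intro y hy
  have him : ((a : ℂ) + y * I).im ≠ 0 := by simp; linarith [hy.1]
  have := ((differentiableAt_deriv_chi_div him).continuousAt).comp (x := y)
    (f := fun y : ℝ => (a : ℂ) + y * I) (by fun_prop)
  exact this.continuousWithinAt

lemma exists_re_integral_chi_mul_mollifierSq_le {η : ℝ} (hη : 0 < η) (hη4 : η ≤ 1 / 4) :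
    ∃ C : ℝ, 0 < C ∧ ∀ (N : ℕ), N ≠ 0 → ∀ u v : ℝ, 17 ≤ u → u ≤ v →
      (∫ y : ℝ in u..v, deriv chi ((1 + η : ℝ) + y * I) / chi ((1 + η : ℝ) + y * I) *
        mollifierSq N ((1 + η : ℝ) + y * I)).re ≤
      (Real.log v + C) * (v - u) * moebiusSqSum N +
        C * (N : ℝ) ^ (1 + 2 * η) * (Real.log v + C) := by
  obtain ⟨C₁, hC₁, hM⟩ := exists_norm_mollifierSq_le hη
  obtain ⟨C₂, hC₂, hmean⟩ := exists_mean_value_bounds hη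
  obtain ⟨D, hD, hchi⟩ := exists_norm_logDeriv_chi_sub_log_le
  refine ⟨D + 4 * C₁ + C₂, by positivity, fun N hN u v hu huv => ?_⟩
  set W := (N : ℝ) ^ (1 + 2 * η) with hW
  have hW0 : 0 ≤ W := by positivity
  have hlogv : 0 ≤ Real.log v := Real.log_nonneg (by linarith)
  set Q := moebiusSqSum N with hQ
  have hQ0 : 0 ≤ Q := Finset.sum_nonneg fun n _ => by positivity
  have hchi' : ∀ x ∈ Icc (1 / 2 : ℝ) (1 + η), ∀ y ∈ Icc u v,
      ‖deriv chi (x + y * I) / chi (x + y * I)‖ ≤ Real.log v + D := by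
    intro x hx y hy
    have h1 := hchi x y ⟨hx.1, by linarith [hx.2]⟩ (by linarith [hy.1])
    have h2 := norm_le_insert' (deriv chi (x + y * I) / chi (x + y * I)) (Real.log y : ℂ)
    rw [Complex.norm_real, Real.norm_of_nonneg (Real.log_nonneg (by linarith [hy.1]))] at h2
    have := Real.log_le_log (by linarith [hy.1]) hy.2
    linarith
  have hB : ∀ x ∈ Icc (1 / 2 : ℝ) (1 + η), ∀ y : ℝ, ‖mollifierSq N (x + y * I)‖ ≤ C₁ * W := by
    intro x hx y
    refine hM N hN _ ?_
    simp
    exact ⟨by linarith [hx.1], by linarith [hx.2]⟩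
  have hhalf : ∀ y : ℝ, mollifierSq N ((1 / 2 : ℝ) + y * I) =
      ((‖mollifier N ((1 / 2 : ℝ) + y * I)‖ ^ 2 : ℝ) : ℂ) :=
    fun y => mollifierSq_eq_norm_sq N (by simp)
  have hle : (1 / 2 : ℝ) ≤ 1 + η := by linarith
  have humem : u ∈ Icc u v := ⟨le_rfl, huv⟩
  have hvmem : v ∈ Icc u v := ⟨huv, le_rfl⟩
  -- shift both integrals between the right edge and the critical line
  have hshift1 := re_integral_le_of_rectInt_eq_zero (f := mollifierSq N) (u := u) (v := v) hle
    (rectInt_eq_zero hle huv (differentiable_mollifierSq N).differentiableOn)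
    (fun x hx => hB x hx u) (fun x hx => hB x hx v)
  have hshift2 := re_integral_le_of_rectInt_eq_zero
    (f := fun s => deriv chi s / chi s * mollifierSq N s) (u := u) (v := v)
    (B := (Real.log v + D) * (C₁ * W)) hle
    (rectInt_eq_zero hle huv fun s hs => by
      have him : s.im ≠ 0 := by have := hs.2.1; linarith
      exact ((differentiableAt_deriv_chi_div him).mul
        (differentiable_mollifierSq N s)).differentiableWithinAt)
    (fun x hx => by
      rw [norm_mul]
      exact mul_le_mul (hchi' x hx u humem) (hB x hx u) (norm_nonneg _) (by positivity))
    (fun x hx => by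
      rw [norm_mul]
      exact mul_le_mul (hchi' x hx v hvmem) (hB x hx v) (norm_nonneg _) (by positivity))
  have hInt1 : IntervalIntegrable (fun y : ℝ => mollifierSq N ((1 / 2 : ℝ) + y * I)) volume u v :=
    (continuous_vertical (differentiable_mollifierSq N) _).intervalIntegrable _ _
  have hInt2 : IntervalIntegrable (fun y : ℝ => deriv chi ((1 / 2 : ℝ) + y * I) /
      chi ((1 / 2 : ℝ) + y * I) * mollifierSq N ((1 / 2 : ℝ) + y * I)) volume u v := by
    refine ContinuousOn.intervalIntegrable ?_
    rw [uIcc_of_le huv]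
    exact (continuousOn_deriv_chi_div _ (by linarith)).mul
      (continuous_vertical (differentiable_mollifierSq N) _).continuousOn
  have hmid : (∫ y : ℝ in u..v, deriv chi ((1 / 2 : ℝ) + y * I) / chi ((1 / 2 : ℝ) + y * I) *
      mollifierSq N ((1 / 2 : ℝ) + y * I)).re ≤
      (Real.log v + D) * (∫ y : ℝ in u..v, mollifierSq N ((1 / 2 : ℝ) + y * I)).re := by
    have e1 := (reCLM.intervalIntegral_comp_comm hInt1).symm
    have e2 := (reCLM.intervalIntegral_comp_comm hInt2).symm
    simp only [reCLM_apply] at e1 e2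
    rw [e1, e2, ← intervalIntegral.integral_const_mul]
    refine intervalIntegral.integral_mono_on huv ?_ ?_ fun y hy => ?_
    · exact ⟨hInt2.1.re, hInt2.2.re⟩
    · exact (IntervalIntegrable.const_mul ⟨hInt1.1.re, hInt1.2.re⟩ _)
    · rw [hhalf, re_mul_ofReal, ofReal_re]
      exact mul_le_mul_of_nonneg_right ((re_le_norm _).trans
        (hchi' _ ⟨le_rfl, hle⟩ y hy)) (by positivity)
  have hc := (abs_le.1 ((abs_re_le_norm _).trans (hmean N hN u v huv).2.1)).2
  have hc' : (∫ y : ℝ in u..v, mollifierSq N ((1 + η : ℝ) + y * I)).re ≤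
      (v - u) * Q + C₂ * W := by
    have e : (((v : ℂ) - u) * (moebiusSqSum N : ℂ)).re = (v - u) * Q := by
      rw [← ofReal_sub, ← ofReal_mul, ofReal_re]
    rw [sub_re, e] at hc
    have : (∫ y : ℝ in u..v, mollifierSq N ((1 + η : ℝ) + y * I)).re - (v - u) * Q ≤ C₂ * W := hc
    linarith
  have h1 := (abs_le.1 hshift1).1
  have h2 := (abs_le.1 hshift2).2
  have hlen : 2 * (1 + η - 1 / 2) ≤ 2 := by linarith
  have h3 : 2 * (1 + η - 1 / 2) * (C₁ * W) ≤ 2 * (C₁ * W) :=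
    mul_le_mul_of_nonneg_right hlen (by positivity)
  have h4 : 2 * (1 + η - 1 / 2) * ((Real.log v + D) * (C₁ * W)) ≤
      2 * ((Real.log v + D) * (C₁ * W)) := mul_le_mul_of_nonneg_right hlen (by positivity)
  have h5 : (∫ y : ℝ in u..v, mollifierSq N ((1 / 2 : ℝ) + y * I)).re ≤
      (v - u) * Q + C₂ * W + 2 * (C₁ * W) := by linarith
  have h6 := hmid.trans (mul_le_mul_of_nonneg_left h5 (by positivity : 0 ≤ Real.log v + D))
  have h7 : (Real.log v + D) * ((v - u) * Q + (C₂ + 4 * C₁) * W) ≤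
      (Real.log v + (D + 4 * C₁ + C₂)) * ((v - u) * Q + (D + 4 * C₁ + C₂) * W) := by
    have : 0 ≤ v - u := sub_nonneg.2 huv
    refine mul_le_mul (by linarith) ?_ (by positivity) (by positivity)
    have : (C₂ + 4 * C₁) * W ≤ (D + 4 * C₁ + C₂) * W :=
      mul_le_mul_of_nonneg_right (by linarith) hW0
    linarith
  have e3 : (Real.log v + (D + 4 * C₁ + C₂)) * ((v - u) * Q + (D + 4 * C₁ + C₂) * W) =
    (Real.log v + (D + 4 * C₁ + C₂)) * (v - u) * Q +
      (D + 4 * C₁ + C₂) * W * (Real.log v + (D + 4 * C₁ + C₂)) := by ring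
  have e4 : (Real.log v + D) * ((v - u) * Q + (C₂ + 4 * C₁) * W) =
    (Real.log v + D) * ((v - u) * Q + C₂ * W + 2 * (C₁ * W)) +
      2 * ((Real.log v + D) * (C₁ * W)) := by ring
  linarith

lemma exists_sum_norm_sq_mollifier_le
    (hsimple : ∀ ρ : ℂ, riemannZeta ρ = 0 → deriv riemannZeta ρ ≠ 0)
    {η : ℝ} (hη : 0 < η) (hη4 : η ≤ 1 / 4) :
    ∃ C : ℝ, 0 < C ∧ ∀ (N : ℕ), N ≠ 0 → ∀ (u v B : ℝ) (Z : Finset ℂ), 17 ≤ u → u ≤ v → 1 ≤ B →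
      IsGoodHeight η B u → IsGoodHeight η B v → IsZeroSet η u v Z →
      2 * Real.pi * ∑ ρ ∈ Z, ‖mollifier N ρ‖ ^ 2 ≤
        2 * (v - u) * moebiusSqLogSum N + (Real.log v + C) * (v - u) * moebiusSqSum N +
          C * (N : ℝ) ^ (1 + 2 * η) * (B + Real.log v + C) := by
  obtain ⟨C₁, hC₁, hM⟩ := exists_norm_mollifierSq_le hη
  obtain ⟨C₂, hC₂, hmean⟩ := exists_mean_value_bounds hη
  obtain ⟨C₃, hC₃, hchi⟩ := exists_re_integral_chi_mul_mollifierSq_le hη hη4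
  refine ⟨C₃ + 3 * C₁ + 2 * C₂, by positivity, ?_⟩
  intro N hN u v B Z hu huv hB hgu hgv hZ
  set W := (N : ℝ) ^ (1 + 2 * η) with hW
  have hW0 : 0 ≤ W := by positivity
  have hlogv : 0 ≤ Real.log v := Real.log_nonneg (by linarith)
  set f : ℂ → ℂ := fun s => deriv riemannZeta s * mollifierSq N s / riemannZeta s with hf
  have hopen : IsOpen ({1}ᶜ : Set ℂ) := isOpen_compl_singleton
  have hdz : DifferentiableOn ℂ riemannZeta {1}ᶜ :=
    fun s hs => (differentiableAt_riemannZeta hs).differentiableWithinAt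
  have hres : rectInt f (-η) (1 + η) u v = 2 * Real.pi * I *
      ((∑ ρ ∈ Z, ‖mollifier N ρ‖ ^ 2 : ℝ) : ℂ) := by
    rw [hf, hZ.rectInt_eq (h := fun s => deriv riemannZeta s * mollifierSq N s) hsimple hη
      (by linarith) huv ((hdz.deriv hopen).mul (differentiable_mollifierSq N).differentiableOn),
      ofReal_sum]
    congr 1
    refine Finset.sum_congr rfl fun ρ hρ => ?_
    rw [mul_div_cancel_left₀ _ (hsimple ρ (hZ.zero ρ hρ)), mollifierSq_eq_norm_sq N (hZ.re_eq ρ hρ)]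
  have hhor : ∀ t, IsGoodHeight η B t → ∀ x ∈ Icc (-η) (1 + η), ‖f (x + t * I)‖ ≤ B * (C₁ * W) := by
    intro t ht x hx
    obtain ⟨-, -, h3⟩ := ht x hx
    rw [hf]
    simp only
    rw [mul_div_right_comm, norm_mul]
    exact mul_le_mul h3 (hM N hN _ (by simpa using hx)) (norm_nonneg _) (by linarith)
  have hmain := norm_rectInt_sub_vertical_le (by linarith) (hhor u hgu) (hhor v hgv)
  set g : ℂ → ℂ := fun s => deriv riemannZeta s / riemannZeta s * mollifierSq N s with hg
  have hfg : ∀ s, f s = g s := fun s => by rw [hf, hg]; simp only; ring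
  set k : ℂ → ℂ := fun s => deriv chi s / chi s * mollifierSq N s with hk
  have hzc : ∀ y : ℝ, riemannZeta ((1 + η : ℝ) + y * I) ≠ 0 := fun y =>
    riemannZeta_ne_zero_of_one_lt_re (by simp [hη])
  have hleft : ∀ y ∈ uIcc u v, f ((-η : ℝ) + y * I) =
      -conj (k ((1 + η : ℝ) + y * I) + g ((1 + η : ℝ) + y * I)) := by
    intro y hy
    rw [uIcc_of_le huv] at hy
    have him : (((1 + η : ℝ) : ℂ) + y * I).im ≠ 0 := by simp; linarith [hy.1]
    have h1 := logDeriv_riemannZeta_reflect him (hzc y)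
    have h2 := mollifierSq_one_sub_conj N (((1 + η : ℝ) : ℂ) + y * I)
    have e : 1 - conj (((1 + η : ℝ) : ℂ) + y * I) = ((-η : ℝ) : ℂ) + y * I := by
      simp only [map_add, map_mul, conj_ofReal, conj_I]; push_cast; ring
    rw [e] at h1 h2
    rw [hfg, hg, hk]
    simp only
    rw [h1, h2, ← add_mul, map_mul]
    ring
  have hgint : IntervalIntegrable (fun y : ℝ => g ((1 + η : ℝ) + y * I)) volume u v := by
    refine ContinuousOn.intervalIntegrable ?_
    rw [uIcc_of_le huv]
    refine ContinuousOn.mul ?_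
      (continuous_vertical (differentiable_mollifierSq N) _).continuousOn
    intro y hy
    have hne : ((1 + η : ℝ) : ℂ) + y * I ≠ 1 :=
      ne_one_of_im_ne_zero (by simp; linarith [hy.1])
    have h1 : DifferentiableAt ℂ (fun s => deriv riemannZeta s / riemannZeta s)
        (((1 + η : ℝ) : ℂ) + y * I) :=
      ((hdz.deriv hopen).differentiableAt (hopen.mem_nhds hne)).div
        (differentiableAt_riemannZeta hne) (hzc y)
    have := h1.continuousAt.comp (x := y)
      (f := fun y : ℝ => (((1 + η : ℝ) : ℂ)) + y * I) (by fun_prop)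
    exact this.continuousWithinAt
  have hkint : IntervalIntegrable (fun y : ℝ => k ((1 + η : ℝ) + y * I)) volume u v := by
    refine ContinuousOn.intervalIntegrable ?_
    rw [uIcc_of_le huv]
    exact (continuousOn_deriv_chi_div _ (by linarith)).mul
      (continuous_vertical (differentiable_mollifierSq N) _).continuousOn
  have hLint : ∫ y : ℝ in u..v, f ((-η : ℝ) + y * I) =
      -conj ((∫ y : ℝ in u..v, k ((1 + η : ℝ) + y * I)) +
        ∫ y : ℝ in u..v, g ((1 + η : ℝ) + y * I)) := by
    rw [intervalIntegral.integral_congr hleft, intervalIntegral.integral_neg,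
      ← intervalIntegral.integral_add hkint hgint]
    congr 1
    have := (conjCLE.toContinuousLinearMap.intervalIntegral_comp_comm (hkint.add hgint))
    simpa using this
  have hRint : ∫ y : ℝ in u..v, f ((1 + η : ℝ) + y * I) =
      ∫ y : ℝ in u..v, g ((1 + η : ℝ) + y * I) :=
    intervalIntegral.integral_congr fun y _ => hfg _
  rw [hres, hLint, hRint] at hmain
  set G := ∫ y : ℝ in u..v, g ((1 + η : ℝ) + y * I) with hG
  set K := ∫ y : ℝ in u..v, k ((1 + η : ℝ) + y * I) with hK
  set S := ∑ ρ ∈ Z, ‖mollifier N ρ‖ ^ 2 with hS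
  have h1 := (abs_le.1 ((abs_im_le_norm _).trans hmain)).2
  have e1 : (2 * Real.pi * I * (S : ℂ) - I * (G - -conj (K + G))).im =
      2 * Real.pi * S - (2 * G.re + K.re) := by
    simp
    ring
  rw [e1] at h1
  have h2 : K.re ≤ _ := hchi N hN u v hu huv
  have hG' := (abs_le.1 ((abs_re_le_norm _).trans (hmean N hN u v huv).2.2)).2
  have h3 : G.re ≤ (v - u) * moebiusSqLogSum N + C₂ * W := by
    have e : (((v : ℂ) - u) * (moebiusSqLogSum N : ℂ)).re = (v - u) * moebiusSqLogSum N := by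
      rw [← ofReal_sub, ← ofReal_mul, ofReal_re]
    rw [sub_re, e] at hG'
    have : G.re - (v - u) * moebiusSqLogSum N ≤ C₂ * W := hG'
    linarith
  have h4 : 2 * (1 + η - -η) * (B * (C₁ * W)) ≤ 3 * (B * (C₁ * W)) :=
    mul_le_mul_of_nonneg_right (by linarith) (by positivity)
  have hQ0 : 0 ≤ moebiusSqSum N := Finset.sum_nonneg fun n _ => by positivity
  have hvu : 0 ≤ v - u := sub_nonneg.2 huv
  have h5 : (Real.log v + C₃) * (v - u) * moebiusSqSum N ≤
      (Real.log v + (C₃ + 3 * C₁ + 2 * C₂)) * (v - u) * moebiusSqSum N := by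
    refine mul_le_mul_of_nonneg_right (mul_le_mul_of_nonneg_right ?_ hvu) hQ0
    linarith
  have h6 : C₃ * W * (Real.log v + C₃) + 3 * (B * (C₁ * W)) + 2 * C₂ * W ≤
      (C₃ + 3 * C₁ + 2 * C₂) * W * (B + Real.log v + (C₃ + 3 * C₁ + 2 * C₂)) := by
    have i1 : C₃ * W * (Real.log v + C₃) ≤
        C₃ * W * (B + Real.log v + (C₃ + 3 * C₁ + 2 * C₂)) :=
      mul_le_mul_of_nonneg_left (by linarith) (by positivity)
    have i2 : 3 * C₁ * W * B ≤ 3 * C₁ * W * (B + Real.log v + (C₃ + 3 * C₁ + 2 * C₂)) :=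
      mul_le_mul_of_nonneg_left (by linarith) (by positivity)
    have i3 : 2 * C₂ * W * 1 ≤ 2 * C₂ * W * (B + Real.log v + (C₃ + 3 * C₁ + 2 * C₂)) :=
      mul_le_mul_of_nonneg_left (by linarith) (by positivity)
    linarith
  linarith

lemma IsZeroSet.sum_le_finsum {η u v T : ℝ} {Z : Finset ℂ} (hZ : IsZeroSet η u v Z) (hu : 0 < u)
    (hvT : v ≤ T) :
    ∑ ρ ∈ Z, 1 / ‖deriv riemannZeta ρ‖ ^ 2 ≤
      ∑ᶠ γ ∈ {γ : ℝ | 0 < γ ∧ γ ≤ T ∧ riemannZeta (1 / 2 + γ * I) = 0},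
        1 / ‖deriv riemannZeta (1 / 2 + γ * I)‖ ^ 2 := by
  classical
  have hfin : {γ : ℝ | 0 < γ ∧ γ ≤ T ∧ riemannZeta (1 / 2 + γ * I) = 0}.Finite := by
    have h := ((isCompact_Icc (a := (1 / 2 : ℝ)) (b := 1 / 2)).reProdIm
      (isCompact_Icc (a := 0) (b := T))).inter_riemannZetaZeros_finite
    refine (h.image im).subset ?_
    rintro γ ⟨h0, hT, hz⟩
    refine ⟨1 / 2 + γ * I, ⟨⟨?_, ?_⟩, hz⟩, by simp⟩
    · simp
    · simp [h0.le, hT]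
  have hρ : ∀ ρ ∈ Z, (1 / 2 + (ρ.im : ℂ) * I) = ρ := by
    intro ρ h
    apply Complex.ext
    · simp [hZ.re_eq ρ h]
    · simp
  rw [finsum_mem_eq_finite_toFinset_sum _ hfin]
  have hinj : Set.InjOn im (Z : Set ℂ) := by
    intro ρ h ρ' h' he
    rw [← hρ ρ h, ← hρ ρ' h', he]
  calc ∑ ρ ∈ Z, 1 / ‖deriv riemannZeta ρ‖ ^ 2
      = ∑ ρ ∈ Z, 1 / ‖deriv riemannZeta (1 / 2 + (ρ.im : ℂ) * I)‖ ^ 2 :=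
        Finset.sum_congr rfl fun ρ h => by rw [hρ ρ h]
    _ = ∑ γ ∈ Z.image im, 1 / ‖deriv riemannZeta (1 / 2 + (γ : ℂ) * I)‖ ^ 2 :=
        (Finset.sum_image (f := fun γ : ℝ =>
          1 / ‖deriv riemannZeta (1 / 2 + (γ : ℂ) * I)‖ ^ 2) hinj).symm
    _ ≤ _ := by
        refine Finset.sum_le_sum_of_subset_of_nonneg ?_ fun _ _ _ => by positivity
        intro γ hγ
        obtain ⟨ρ, h, rfl⟩ := Finset.mem_image.1 hγ
        rw [Set.Finite.mem_toFinset]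
        have him := hZ.im_mem ρ h
        exact ⟨hu.trans him.1, him.2.le.trans hvT, by rw [hρ ρ h]; exact hZ.zero ρ h⟩

lemma IsZeroSet.norm_sum_sq_le {η u v : ℝ} {Z : Finset ℂ} (hZ : IsZeroSet η u v Z) (N : ℕ) :
    ‖∑ ρ ∈ Z, mollifier N (1 - ρ) / deriv riemannZeta ρ‖ ^ 2 ≤
      (∑ ρ ∈ Z, ‖mollifier N ρ‖ ^ 2) * ∑ ρ ∈ Z, 1 / ‖deriv riemannZeta ρ‖ ^ 2 := by
  have h1 : ‖∑ ρ ∈ Z, mollifier N (1 - ρ) / deriv riemannZeta ρ‖ ≤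
      ∑ ρ ∈ Z, ‖mollifier N ρ‖ * (1 / ‖deriv riemannZeta ρ‖) := by
    refine (norm_sum_le _ _).trans_eq (Finset.sum_congr rfl fun ρ h => ?_)
    rw [norm_div, one_sub_eq_conj (hZ.re_eq ρ h), mollifier_conj, RCLike.norm_conj,
      div_eq_mul_one_div]
  refine (pow_le_pow_left₀ (norm_nonneg _) h1 2).trans ?_
  refine (Finset.sum_mul_sq_le_sq_mul_sq _ _ _).trans_eq ?_
  simp only [div_pow, one_pow]

/-- The optimization at the end of the argument: `s₁`, `s₂`, `J` are the three sums linked by the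
Cauchy–Schwarz inequality, and `q`, `r` the two diagonal sums. -/
lemma lower_bound_of_cauchySchwarz {a δ T L q r x s₁ s₂ J : ℝ} (ha : 0 < a) (hδ : 0 < δ)
    (hδ4 : δ ≤ 1 / 4) (hT : 0 < T) (hL : 0 < L) (hx : x ≤ (1 - δ) * L)
    (hq : 2 * a * ((1 - δ) * L) ≤ q) (hr : r + a * x ^ 2 ≤ q * x)
    (hs₁ : (1 - δ) * T * q ≤ 2 * Real.pi * s₁)
    (hs₂ : 2 * Real.pi * s₂ ≤ T * (2 * r + (1 + δ) * L * q)) (hJ : 0 ≤ J)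
    (hCS : s₁ ^ 2 ≤ s₂ * J) : (1 - 3 * δ) * a * T ≤ 2 * Real.pi * J := by
  set l := (1 - δ) * L with hl
  have hl0 : 0 < l := mul_pos (by linarith) hL
  have hq0 : 0 < q := lt_of_lt_of_le (by positivity) hq
  set D := 2 * q * l - 2 * a * l ^ 2 + (1 + δ) * L * q with hD
  have hrD : 2 * r + (1 + δ) * L * q ≤ D := by
    have : 0 ≤ (l - x) * (q - a * (l + x)) := by
      refine mul_nonneg (by linarith) ?_
      have : a * x ≤ a * l := mul_le_mul_of_nonneg_left hx ha.le
      linarith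
    rw [hD]
    linarith
  have hDpos : 0 < D := by
    have h1 : 0 ≤ l * (q - 2 * a * l) := mul_nonneg hl0.le (by linarith)
    have h2 : 0 < (1 + δ) * L * q := by positivity
    have h3 : 0 < l * q := by positivity
    rw [hD]
    linarith
  have hkey : a * (1 - δ) * D ≤ q ^ 2 := by
    have h1 : 0 ≤ (q - 2 * a * l) ^ 2 * l := by positivity
    have h2 : 0 ≤ q * ((1 + δ) * L) * (q - 2 * a * l) :=
      mul_nonneg (by positivity) (by linarith)
    have h3 : 2 * L * (a * (1 - δ) * D) ≤ 2 * L * q ^ 2 := by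
      have e1 : 2 * L * (a * (1 - δ) * D) = 2 * a * l * D := by rw [hl]; ring
      have e2 : 2 * L * q ^ 2 = q ^ 2 * (l + (1 + δ) * L) := by rw [hl]; ring
      rw [e1, e2, hD]
      nlinarith
    exact le_of_mul_le_mul_left h3 (by positivity)
  have hpi := Real.pi_pos
  have h1 : ((1 - δ) * T * q) ^ 2 ≤ (2 * Real.pi * s₁) ^ 2 :=
    pow_le_pow_left₀ (by have : 0 ≤ 1 - δ := by linarith
                         positivity) hs₁ 2
  have h2 : (2 * Real.pi * s₁) ^ 2 ≤ 2 * Real.pi * (T * D) * J := by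
    have h3 : 2 * Real.pi * s₂ ≤ T * D := hs₂.trans (mul_le_mul_of_nonneg_left hrD hT.le)
    have h4 := mul_le_mul_of_nonneg_left (mul_le_mul_of_nonneg_right h3 hJ)
      (by positivity : 0 ≤ 2 * Real.pi)
    have h5 := mul_le_mul_of_nonneg_left hCS (by positivity : 0 ≤ (2 * Real.pi) ^ 2)
    nlinarith
  have h3 : ((1 - δ) * T) ^ 2 * (a * (1 - δ) * D) ≤ ((1 - δ) * T * q) ^ 2 := by
    rw [mul_pow _ q]
    exact mul_le_mul_of_nonneg_left hkey (by positivity)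
  have h4 : (T * D) * ((1 - δ) ^ 3 * a * T) ≤ (T * D) * (2 * Real.pi * J) := by
    linarith
  have h5 := le_of_mul_le_mul_left h4 (by positivity)
  refine le_trans ?_ h5
  have h6 : 1 - 3 * δ ≤ (1 - δ) ^ 3 := by nlinarith [sq_nonneg δ]
  exact mul_le_mul_of_nonneg_right (mul_le_mul_of_nonneg_right h6 ha.le) hT.le

set_option maxHeartbeats 800000 in
lemma eventually_lower_bound (hRH : RiemannHypothesis)
    (hsimple : ∀ ρ : ℂ, riemannZeta ρ = 0 → deriv riemannZeta ρ ≠ 0) {δ : ℝ} (hδ : 0 < δ)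
    (hδ4 : δ ≤ 1 / 4) :
    ∀ᶠ T : ℝ in atTop, (1 - 3 * δ) * (3 / Real.pi ^ 2) * T ≤ 2 * Real.pi *
      ∑ᶠ γ ∈ {γ : ℝ | 0 < γ ∧ γ ≤ T ∧ riemannZeta (1 / 2 + γ * I) = 0},
        1 / ‖deriv riemannZeta (1 / 2 + γ * I)‖ ^ 2 := by
  set η := δ / 8 with hη
  set e := δ / 8 with he
  have hη0 : 0 < η := by positivity
  have he0 : 0 < e := by positivity
  have hη4 : η ≤ 1 / 4 := by linarith
  obtain ⟨C₁, hC₁, hS₁⟩ := exists_norm_sum_mollifier_div_deriv_sub_le hsimple hη0 hη4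
  obtain ⟨C₂, hC₂, hS₂⟩ := exists_sum_norm_sq_mollifier_le hsimple hη0 hη4
  have hgood := eventually_exists_isGoodHeight hRH hsimple hη4 he0
  obtain ⟨T₁, ⟨u, hu, hgu⟩, hT₁⟩ := (hgood.and (eventually_ge_atTop 18)).exists
  have hu17 : 17 ≤ u := by linarith [hu.1]
  have hlog : ∀ᶠ T : ℝ in atTop, Real.log T ≤ T ^ e := by
    filter_upwards [(isLittleO_log_rpow_atTop he0).bound one_pos, eventually_ge_atTop 1] with
      T hT h1
    rw [one_mul, Real.norm_of_nonneg (Real.log_nonneg h1),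
      Real.norm_of_nonneg (by positivity)] at hT
    exact hT
  filter_upwards [hgood, hlog, eventually_ge_atTop T₁, eventually_ge_atTop (u + 1),
    eventually_mul_rpow_le (2 * C₁) (1 - 5 * δ / 8) (show 1 - 5 * δ / 8 < 1 - δ / 2 by linarith),
    eventually_mul_rpow_le (3 * C₂) (1 - 5 * δ / 8) (show 1 - 5 * δ / 8 < 1 - δ / 2 by linarith),
    eventually_mul_rpow_le (2 / δ) (1 - δ / 2) (show 1 - δ / 2 < 1 by linarith),
    eventually_ge_atTop (2 * (u + 1) / δ),
    (tendsto_rpow_atTop he0).eventually_ge_atTop C₂,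
    Real.tendsto_log_atTop.eventually_ge_atTop 3,
    Real.tendsto_log_atTop.eventually_ge_atTop ((C₂ + δ / 2) / δ)] with
    T hgT hLe hTT₁ hTu hE₁ hE₂ hE₃ hTδ hC₂e hL3 hLδ
  obtain ⟨v, hv, hgv⟩ := hgT
  have hT1 : 1 ≤ T := by linarith
  have hT0 : 0 < T := by linarith
  set L := Real.log T with hL
  set B := T ^ e with hB
  have hB1 : 1 ≤ B := Real.one_le_rpow hT1 he0.le
  have huv : u ≤ v := by linarith [hv.1]
  have hguB : IsGoodHeight η B u := by
    have hle : T₁ ^ e ≤ B := Real.rpow_le_rpow (by linarith) hTT₁ he0.le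
    exact fun x hx => ⟨(hgu x hx).1, (hgu x hx).2.1.trans hle, (hgu x hx).2.2.trans hle⟩
  obtain ⟨Z, hZ⟩ := exists_isZeroSet hRH (by linarith) hguB hgv
  set N := ⌊T ^ (1 - δ)⌋₊ with hN
  have hTN1 : 1 ≤ T ^ (1 - δ) := Real.one_le_rpow hT1 (by linarith)
  have hN1 : 1 ≤ N := Nat.one_le_floor_iff _ |>.2 hTN1
  have hN0 : N ≠ 0 := by omega
  have hNpos : (0 : ℝ) < N := by exact_mod_cast hN1
  have hNle : (N : ℝ) ≤ T ^ (1 - δ) := Nat.floor_le (by positivity)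
  have hNlt : T ^ (1 - δ) < N + 1 := Nat.lt_floor_add_one _
  have hlogN : Real.log N ≤ (1 - δ) * L := by
    rw [hL, ← Real.log_rpow hT0]
    exact Real.log_le_log hNpos hNle
  have hlogN1 : (1 - δ) * L ≤ Real.log (N + 1) := by
    rw [hL, ← Real.log_rpow hT0]
    exact Real.log_le_log (by positivity) hNlt.le
  set q := moebiusSqSum N with hq
  set r := moebiusSqLogSum N with hr
  set a := 3 / Real.pi ^ 2 with ha
  have hpi := Real.pi_pos
  have ha0 : 0 < a := by positivity
  have ha3 : 3 / 10 ≤ a := by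
    rw [ha]
    refine div_le_div_of_nonneg_left (by norm_num) (by positivity) ?_
    have := Real.pi_lt_d2
    nlinarith
  have hqL : 2 * a * ((1 - δ) * L) ≤ q := by
    have h1 := log_succ_le_moebiusSqSum N
    have h2 : (6 / Real.pi ^ 2) = 2 * a := by rw [ha]; ring
    rw [h2] at h1
    exact (mul_le_mul_of_nonneg_left hlogN1 (by positivity)).trans h1
  have hq1 : 1 ≤ q := by
    refine le_trans ?_ hqL
    have h1 : 9 / 4 ≤ (1 - δ) * L := by nlinarith
    nlinarith
  have hr0 : 0 ≤ r := Finset.sum_nonneg fun n _ => by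
    have := Real.log_natCast_nonneg n
    positivity
  set W := (N : ℝ) ^ (1 + 2 * η) with hW
  have hWle : W ≤ T ^ (1 - 3 * δ / 4) := by
    calc W ≤ (T ^ (1 - δ)) ^ (1 + 2 * η) :=
          Real.rpow_le_rpow hNpos.le hNle (by positivity)
      _ = T ^ ((1 - δ) * (1 + 2 * η)) := (Real.rpow_mul hT0.le _ _).symm
      _ ≤ _ := Real.rpow_le_rpow_of_exponent_le hT1 (by rw [hη]; nlinarith)
  have hWB : W * B ≤ T ^ (1 - 5 * δ / 8) := by
    calc W * B ≤ T ^ (1 - 3 * δ / 4) * T ^ e := mul_le_mul_of_nonneg_right hWle (by positivity)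
      _ = T ^ (1 - 5 * δ / 8) := by
        rw [← Real.rpow_add hT0]
        congr 1
        rw [he]; ring
  have hsqrt : v ^ (1 / 2 : ℝ) ≤ T ^ (1 - 5 * δ / 8) :=
    (Real.rpow_le_rpow (by linarith) hv.2 (by norm_num)).trans
      (Real.rpow_le_rpow_of_exponent_le hT1 (by linarith))
  have hE : T ^ (1 - δ / 2) ≤ δ / 2 * T := by
    rw [Real.rpow_one] at hE₃
    have := mul_le_mul_of_nonneg_left hE₃ (by positivity : 0 ≤ δ / 2)
    have e1 : δ / 2 * (2 / δ * T ^ (1 - δ / 2)) = T ^ (1 - δ / 2) := by field_simp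
    linarith
  have hvu : (1 - δ / 2) * T ≤ v - u := by
    rw [div_le_iff₀ hδ] at hTδ
    linarith [hv.1]
  have hvu' : v - u ≤ T := by linarith [hv.2]
  have hvu0 : 0 ≤ v - u := by linarith
  have hlogv : Real.log v ≤ L := Real.log_le_log (by linarith) hv.2
  have hlogv0 : 0 ≤ Real.log v := Real.log_nonneg (by linarith)
  set S₁ := ∑ ρ ∈ Z, mollifier N (1 - ρ) / deriv riemannZeta ρ with hS₁'
  set S₂ := ∑ ρ ∈ Z, ‖mollifier N ρ‖ ^ 2 with hS₂'
  set J := ∑ ρ ∈ Z, 1 / ‖deriv riemannZeta ρ‖ ^ 2 with hJ'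
  have hb₁ := hS₁ N hN0 u v B Z hu17 huv hB1 hguB hgv hZ
  have hb₂ := hS₂ N hN0 u v B Z hu17 huv hB1 hguB hgv hZ
  have hs₁ : (1 - δ) * T * q ≤ 2 * Real.pi * ‖S₁‖ := by
    have h1 : C₁ * (W * B + v ^ (1 / 2 : ℝ)) ≤ δ / 2 * T := by
      have := mul_le_mul_of_nonneg_left (add_le_add hWB hsqrt) hC₁.le
      linarith
    have h2 := norm_sub_norm_le (((v : ℂ) - u) * (q : ℂ)) (2 * Real.pi * S₁)
    rw [norm_sub_rev] at h2
    have h3 : ‖((v : ℂ) - u) * (q : ℂ)‖ = (v - u) * q := by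
      rw [← ofReal_sub, ← ofReal_mul, Complex.norm_real, Real.norm_of_nonneg]
      exact mul_nonneg hvu0 (by linarith)
    have h4 : ‖2 * (Real.pi : ℂ) * S₁‖ = 2 * Real.pi * ‖S₁‖ := by
      rw [norm_mul, norm_mul, Complex.norm_real, Real.norm_of_nonneg hpi.le, Complex.norm_ofNat]
    rw [h3, h4] at h2
    have h5 : (1 - δ / 2) * T * q ≤ (v - u) * q := mul_le_mul_of_nonneg_right hvu (by linarith)
    have h6 : δ / 2 * T * 1 ≤ δ / 2 * T * q := mul_le_mul_of_nonneg_left hq1 (by positivity)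
    have h7 := hb₁.trans h1
    linarith
  have hs₂ : 2 * Real.pi * S₂ ≤ T * (2 * r + (1 + δ) * L * q) := by
    have h1 : C₂ * W * (B + Real.log v + C₂) ≤ δ / 2 * T := by
      have h2 : C₂ * W * (B + Real.log v + C₂) ≤ C₂ * W * (3 * B) :=
        mul_le_mul_of_nonneg_left (by linarith) (by positivity)
      have h3 := mul_le_mul_of_nonneg_left hWB (by positivity : 0 ≤ 3 * C₂)
      linarith
    have h2 : 2 * (v - u) * r ≤ 2 * T * r := mul_le_mul_of_nonneg_right (by linarith) hr0
    have h3 : (Real.log v + C₂) * (v - u) * q ≤ (L + C₂) * T * q :=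
      mul_le_mul_of_nonneg_right (mul_le_mul (by linarith) hvu' hvu0 (by linarith)) (by linarith)
    have h4 : δ / 2 * T * 1 ≤ δ / 2 * T * q := mul_le_mul_of_nonneg_left hq1 (by positivity)
    rw [div_le_iff₀ hδ] at hLδ
    have h5 : (C₂ + δ / 2) * (T * q) ≤ L * δ * (T * q) :=
      mul_le_mul_of_nonneg_right hLδ (by positivity)
    linarith
  have hJ0 : 0 ≤ J := Finset.sum_nonneg fun _ _ => by positivity
  have hfinal := lower_bound_of_cauchySchwarz ha0 hδ hδ4 hT0 (by linarith : 0 < L) hlogN hqL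
    (moebiusSqLogSum_le hN1) hs₁ hs₂ hJ0 (hZ.norm_sum_sq_le N)
  refine hfinal.trans (mul_le_mul_of_nonneg_left ?_ (by positivity))
  exact hZ.sum_le_finsum (by linarith) hv.2

end Gonek

/-- Assuming the Riemann Hypothesis and that all zeros of the
Riemann zeta-function are simple, for every fixed `ε > 0` there exists `T₀` such
that for all `T ≥ T₀` the sum of `1/|ζ'(ρ)|²` over the non-trivial zeros
`ρ = 1/2 + iγ` with `0 < γ ≤ T` is at least `(3/(2π³) − ε)·T`. -/
theorem gonek_lower_bound
    (hRH : RiemannHypothesis)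
    (hsimple : ∀ ρ : ℂ, riemannZeta ρ = 0 → deriv riemannZeta ρ ≠ 0) :
    ∀ ε : ℝ, 0 < ε → ∃ T₀ : ℝ, ∀ T : ℝ, T₀ ≤ T →
      (3 / (2 * Real.pi ^ 3) - ε) * T ≤
        ∑ᶠ γ ∈ {γ : ℝ | 0 < γ ∧ γ ≤ T ∧ riemannZeta (1 / 2 + γ * I) = 0},
          1 / ‖deriv riemannZeta (1 / 2 + γ * I)‖ ^ 2 := by
  intro ε hε
  have hδ : 0 < min ε (1 / 4) := lt_min hε (by norm_num)
  obtain ⟨T₀, hT₀⟩ := Filter.eventually_atTop.1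
    ((Gonek.eventually_lower_bound hRH hsimple hδ (min_le_right _ _)).and
      (Filter.eventually_ge_atTop 0))
  refine ⟨T₀, fun T hT => ?_⟩
  obtain ⟨h, hT0⟩ := hT₀ T hT
  set δ := min ε (1 / 4) with hδdef
  have hδε : δ ≤ ε := min_le_left _ _
  have hpi := Real.pi_pos
  have hpi3 : 27 < Real.pi ^ 3 := by
    have := pow_lt_pow_left₀ Real.pi_gt_three (by norm_num) (n := 3) (by norm_num)
    linarith
  have h1 : (3 / (2 * Real.pi ^ 3)) * (1 - 3 * δ) * T ≤
      ∑ᶠ γ ∈ {γ : ℝ | 0 < γ ∧ γ ≤ T ∧ riemannZeta (1 / 2 + γ * I) = 0},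
        1 / ‖deriv riemannZeta (1 / 2 + γ * I)‖ ^ 2 := by
    refine le_of_mul_le_mul_left ?_ (by positivity : 0 < 2 * Real.pi)
    refine le_trans (le_of_eq ?_) h
    field_simp
  refine le_trans (mul_le_mul_of_nonneg_right ?_ hT0) h1
  have h2 : 3 / (2 * Real.pi ^ 3) ≤ 1 / 3 := by
    rw [div_le_div_iff₀ (by positivity) (by norm_num)]
    linarith
  have h3 : 3 / (2 * Real.pi ^ 3) * (3 * δ) ≤ 1 / 3 * (3 * δ) :=
    mul_le_mul_of_nonneg_right h2 (by positivity)
  linarith
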